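/- Let α ∈ (0,1) be a Liouville number. For every lift g of an orientation-preserving C^∞ circle diffeomorphism with rotation number ρ(g) = α, every r ∈ ℕ and every ε > 0, there exists a lift f of an orientation-preserving C^∞ circle diffeomorphism with rotation number ρ(f) = α such that d_r(f, g) < ε and the circle diffeomorphism induced by f has ratio set r(f) = [0, ∞) (i.e. it is of type III_∞). -/

import Mathlib

noncomputable section
open MeasureTheory Filter Topology

/-- A lift of an orientation-preserving `C^∞` circle diffeomorphism: a `C^∞` map
`f : ℝ → ℝ` with `f (x+1) = f x + 1` and everywhere positive derivative. -/
def IsCircleDiffeoLift (f : ℝ → ℝ) : Prop :=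
  ContDiff ℝ (⊤ : ℕ∞) f ∧ (∀ x : ℝ, f (x + 1) = f x + 1) ∧ ∀ x : ℝ, 0 < deriv f x

/-- The `C^r` norm `‖φ‖_r = max_{0 ≤ i ≤ r} sup_x |φ^{(i)}(x)|`. -/
def CrNorm (r : ℕ) (φ : ℝ → ℝ) : ℝ :=
  (Finset.range (r + 1)).sup' (Finset.nonempty_range_iff.mpr r.succ_ne_zero)
    fun i => ⨆ x : ℝ, |iteratedDeriv i φ x|

/-- `d_r(f, g) = max {‖f - g‖_r, ‖f⁻¹ - g⁻¹‖_r}`. -/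
def liftDist (r : ℕ) (f g : ℝ → ℝ) : ℝ :=
  max (CrNorm r (fun x => f x - g x))
    (CrNorm r (fun x => Function.invFun f x - Function.invFun g x))

/-- `|f|_r = max {‖f - id‖_r, ‖f⁻¹ - id‖_r, 1}`. -/
def liftNorm (r : ℕ) (f : ℝ → ℝ) : ℝ :=
  max (max (CrNorm r (fun x => f x - x)) (CrNorm r (fun x => Function.invFun f x - x))) 1

/-- The lift `x ↦ x + a` of the rotation by `a`. -/
def RotLift (a : ℝ) : ℝ → ℝ := fun x => x + a

/-- The rotation number of the circle diffeomorphism induced by the lift `f` equals `a`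
(mod 1): the translation number `lim (fⁿ(0) - 0)/n` equals `a + k` for some integer `k`. -/
def HasRotationNumber (f : ℝ → ℝ) (a : ℝ) : Prop :=
  ∃ k : ℤ, Tendsto (fun n : ℕ => f^[n] 0 / (n : ℝ)) atTop (nhds (a + k))

/-- The lift of the `i`-th iterate (`i ∈ ℤ`) of the circle diffeomorphism induced by `f`. -/
def zpowLift (f : ℝ → ℝ) : ℤ → ℝ → ℝ := fun i =>
  if 0 ≤ i then f^[i.toNat] else (Function.invFun f)^[(-i).toNat]

/-- The ratio set of a circle diffeomorphism, described through the family `Fz i` of its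
iterates (`i ∈ ℤ`) and the family `D i` of the derivatives of its iterates: `t ≥ 0` lies in
the ratio set iff for every Borel `A` of positive Haar measure and every `ε > 0` there are a
Borel `B ⊆ A` of positive measure and `i ∈ ℤ` with `Fz i '' B ⊆ A` and `|D i x - t| < ε`
on `B`. -/
def ratioSet (Fz : ℤ → UnitAddCircle → UnitAddCircle) (D : ℤ → UnitAddCircle → ℝ) : Set ℝ :=
  {t : ℝ | 0 ≤ t ∧ ∀ A : Set UnitAddCircle, MeasurableSet A → 0 < volume A →
    ∀ ε : ℝ, 0 < ε → ∃ B : Set UnitAddCircle, MeasurableSet B ∧ B ⊆ A ∧ 0 < volume B ∧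
      ∃ i : ℤ, Fz i '' B ⊆ A ∧ ∀ x ∈ B, |D i x - t| < ε}

/-- A lift of an orientation-preserving `C¹` circle diffeomorphism. -/
def IsC1CircleLift (f : ℝ → ℝ) : Prop :=
  ContDiff ℝ 1 f ∧ (∀ x : ℝ, f (x + 1) = f x + 1) ∧ ∀ x : ℝ, 0 < deriv f x

/-- Smooth real functions. -/
abbrev Smooth (u : ℝ → ℝ) : Prop := ContDiff ℝ (⊤ : ℕ∞) u

lemma Smooth.deriv {u : ℝ → ℝ} (h : Smooth u) : Smooth (deriv u) :=
  (contDiff_infty_iff_deriv.mp h).2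

lemma Smooth.diff {u : ℝ → ℝ} (h : Smooth u) : Differentiable ℝ u :=
  (contDiff_infty_iff_deriv.mp h).1

lemma Smooth.hasDerivAt {u : ℝ → ℝ} (h : Smooth u) (x : ℝ) : HasDerivAt u (_root_.deriv u x) x :=
  (h.diff x).hasDerivAt

lemma Smooth.of_nat {u : ℝ → ℝ} (h : Smooth u) (n : ℕ) : ContDiff ℝ n u :=
  h.of_le (by exact_mod_cast le_top)

lemma Smooth.iteratedDeriv {u : ℝ → ℝ} (h : Smooth u) (n : ℕ) : Smooth (iteratedDeriv n u) := by
  induction n with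
  | zero => simpa using h
  | succ n ih => rw [iteratedDeriv_succ]; exact ih.deriv

/-- `|D^b u| ≤ K l^b` on `U` for all `b ≤ j`. -/
def Bd (U : Set ℝ) (j : ℕ) (l K : ℝ) (u : ℝ → ℝ) : Prop :=
  ∀ b ≤ j, ∀ x ∈ U, |iteratedDeriv b u x| ≤ K * l ^ b

namespace Bd
variable {U V : Set ℝ} {j i : ℕ} {l l' K K' K₁ K₂ : ℝ} {u v : ℝ → ℝ}

lemma zero_iff : Bd U 0 l K u ↔ ∀ x ∈ U, |u x| ≤ K := by
  simp [Bd]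

lemma succ_iff : Bd U (j + 1) l K u ↔
    (∀ x ∈ U, |u x| ≤ K) ∧ Bd U j l (K * l) (deriv u) := by
  constructor
  · intro h
    refine ⟨fun x hx => by simpa using h 0 (by omega) x hx, fun b hb x hx => ?_⟩
    have := h (b + 1) (by omega) x hx
    rw [iteratedDeriv_succ'] at this
    rw [mul_assoc, ← pow_succ']
    exact this
  · rintro ⟨h0, h1⟩ b hb x hx
    cases b with
    | zero => simpa using h0 x hx
    | succ b =>
      rw [iteratedDeriv_succ', pow_succ', ← mul_assoc]
      exact h1 b (by omega) x hx

lemma abs_le (h : Bd U j l K u) {x : ℝ} (hx : x ∈ U) : |u x| ≤ K := by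
  simpa using h 0 (by omega) x hx

lemma mono_order (h : Bd U j l K u) (hi : i ≤ j) : Bd U i l K u :=
  fun b hb x hx => h b (hb.trans hi) x hx

lemma mono_const (h : Bd U j l K u) (hl : 0 ≤ l) (hK : K ≤ K') : Bd U j l K' u :=
  fun b hb x hx => (h b hb x hx).trans (mul_le_mul_of_nonneg_right hK (by positivity))

lemma add (hu : Smooth u) (hv : Smooth v) (h₁ : Bd U j l K₁ u) (h₂ : Bd U j l K₂ v) :
    Bd U j l (K₁ + K₂) (fun x => u x + v x) := by
  intro b hb x hx
  have : iteratedDeriv b (fun x => u x + v x) x = iteratedDeriv b u x + iteratedDeriv b v x :=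
    iteratedDeriv_fun_add (hu.of_nat b).contDiffAt (hv.of_nat b).contDiffAt
  rw [this, add_mul]
  exact (abs_add_le _ _).trans (add_le_add (h₁ b hb x hx) (h₂ b hb x hx))

lemma const_mul (c : ℝ) (h : Bd U j l K u) :
    Bd U j l (|c| * K) (fun x => c * u x) := by
  intro b hb x hx
  have : iteratedDeriv b (fun x => c * u x) x = c * iteratedDeriv b u x := by
    simp
  rw [this, abs_mul, mul_assoc]
  exact mul_le_mul_of_nonneg_left (h b hb x hx) (abs_nonneg c)

lemma neg (h : Bd U j l K u) : Bd U j l K (fun x => -u x) := by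
  have := h.const_mul (-1)
  simpa using this

lemma sub (hu : Smooth u) (hv : Smooth v) (h₁ : Bd U j l K₁ u) (h₂ : Bd U j l K₂ v) :
    Bd U j l (K₁ + K₂) (fun x => u x - v x) := by
  have := add hu hv.neg h₁ h₂.neg
  simpa [sub_eq_add_neg] using this

lemma const (hl : 0 ≤ l) (c : ℝ) : Bd U j l |c| (fun _ => c) := by
  intro b hb x hx
  rw [iteratedDeriv_const]
  split_ifs with h
  · subst h; simp
  · simp; positivity

lemma mul (hl : 0 ≤ l) (hu : Smooth u) (hv : Smooth v) (h₁ : Bd U j l K₁ u) (h₂ : Bd U j l K₂ v) :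
    Bd U j l (2 ^ j * (K₁ * K₂)) (fun x => u x * v x) := by
  rcases U.eq_empty_or_nonempty with rfl | ⟨x₀, hx₀⟩
  · intro b _ x hx; exact hx.elim
  induction j generalizing u v K₁ K₂ with
  | zero =>
    rw [zero_iff] at *
    intro x hx
    rw [abs_mul, pow_zero, one_mul]
    exact mul_le_mul (h₁ x hx) (h₂ x hx) (abs_nonneg _) ((abs_nonneg _).trans (h₁ x hx))
  | succ j ih =>
    have hK₁ : 0 ≤ K₁ := (abs_nonneg _).trans (h₁.abs_le hx₀)
    have hK₂ : 0 ≤ K₂ := (abs_nonneg _).trans (h₂.abs_le hx₀)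
    have e : deriv (fun x => u x * v x) = fun x => deriv u x * v x + u x * deriv v x := by
      ext x; exact deriv_fun_mul (hu.diff x) (hv.diff x)
    rw [succ_iff]
    refine ⟨fun x hx => ?_, ?_⟩
    · rw [abs_mul]
      calc |u x| * |v x| ≤ K₁ * K₂ := mul_le_mul (h₁.abs_le hx) (h₂.abs_le hx) (abs_nonneg _) hK₁
        _ ≤ 2 ^ (j + 1) * (K₁ * K₂) := le_mul_of_one_le_left (by positivity)
            (one_le_pow₀ (by norm_num))
    · rw [e]
      have a := ih hu.deriv hv (succ_iff.mp h₁).2 (h₂.mono_order (by omega))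
      have b := ih hu hv.deriv (h₁.mono_order (by omega)) (succ_iff.mp h₂).2
      refine ((a.add (hu.deriv.mul hv) (hu.mul hv.deriv) b)).mono_const hl (le_of_eq ?_)
      ring

lemma comp_succ {φ : ℝ → ℝ} {μ A a : ℝ} (hl : 0 ≤ l) (hA : 0 ≤ A) (hμ : 0 ≤ μ) (hφ : Smooth φ)
    (hu : Smooth u) (hm : Set.MapsTo φ U V)
    (h₁ : Bd V (j + 1) μ K u) (h₂ : Bd U j l A (_root_.deriv φ)) (ha : A * μ ≤ a * l)
    (ha1 : 1 ≤ a) :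
    Bd U (j + 1) l (K * (2 ^ j * a) ^ (j + 1)) (fun x => u (φ x)) := by
  rcases U.eq_empty_or_nonempty with rfl | ⟨x₀, hx₀⟩
  · intro b _ x hx; exact hx.elim
  have key : ∀ i ≤ j + 1, ∀ (u : ℝ → ℝ) (K : ℝ), Smooth u → Bd V i μ K u →
      Bd U i l (K * (2 ^ j * a) ^ i) (fun x => u (φ x)) := by
    intro i
    induction i with
    | zero =>
      intro _ u K hu h
      rw [zero_iff] at *
      intro x hx; simpa using h _ (hm hx)
    | succ i ih =>
      intro hi u K hu h
      have hK : 0 ≤ K := (abs_nonneg _).trans (h.abs_le (hm hx₀))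
      rw [succ_iff]
      have e : _root_.deriv (fun x => u (φ x)) = fun x => _root_.deriv u (φ x) * _root_.deriv φ x := by
        ext x; exact ((hu.hasDerivAt _).comp x (hφ.hasDerivAt x)).deriv
      have h2a : 1 ≤ 2 ^ j * a := one_le_mul_of_one_le_of_one_le (one_le_pow₀ (by norm_num)) ha1
      refine ⟨fun x hx => (h.abs_le (hm hx)).trans (le_mul_of_one_le_right hK (one_le_pow₀ h2a)), ?_⟩
      rw [e]
      have b := ih (by omega) _ _ hu.deriv (succ_iff.mp h).2
      refine (mul hl (hu.deriv.comp hφ) hφ.deriv b (h₂.mono_order (by omega))).mono_const hl ?_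
      calc 2 ^ i * (K * μ * (2 ^ j * a) ^ i * A)
          = K * (2 ^ j * a) ^ i * (2 ^ i * (A * μ)) := by ring
        _ ≤ K * (2 ^ j * a) ^ i * (2 ^ j * (a * l)) := by
            refine mul_le_mul_of_nonneg_left ?_ (by positivity)
            refine mul_le_mul ?_ ha (by positivity) (by positivity)
            exact pow_le_pow_right₀ (by norm_num) (by omega)
        _ = K * (2 ^ j * a) ^ (i + 1) * l := by ring
  exact key (j + 1) le_rfl u K hu h₁

lemma inv_one (hl : 0 ≤ l) (hu : Smooth u) (hpos : ∀ x, 0 < u x) (h1 : ∀ x ∈ U, 1 ≤ u x)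
    (hK : 1 ≤ K) (h : Bd U j l K u) :
    Bd U j l ((4 ^ j * K) ^ (3 ^ j)) (fun x => (u x)⁻¹) := by
  have hs : Smooth (fun x => (u x)⁻¹) := hu.inv (fun x => (hpos x).ne')
  induction j with
  | zero =>
    rw [zero_iff] at *
    intro x hx
    rw [abs_of_pos (inv_pos.mpr (hpos x))]
    simpa using (inv_le_one_of_one_le₀ (h1 x hx)).trans hK
  | succ j ih =>
    have ihj := ih (h.mono_order (by omega))
    rw [succ_iff] at *
    have hA : (1 : ℝ) ≤ 4 ^ j * K := one_le_mul_of_one_le_of_one_le (one_le_pow₀ (by norm_num)) hK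
    have hmono : (4 ^ j * K) ≤ 4 ^ (j + 1) * K :=
      mul_le_mul_of_nonneg_right (pow_le_pow_right₀ (by norm_num) (by omega)) (by linarith)
    refine ⟨fun x hx => ?_, ?_⟩
    · rw [abs_of_pos (inv_pos.mpr (hpos x))]
      exact (inv_le_one_of_one_le₀ (h1 x hx)).trans (one_le_pow₀ (hA.trans hmono))
    · have e : _root_.deriv (fun x => (u x)⁻¹) =
          fun x => -(_root_.deriv u x * ((u x)⁻¹ * (u x)⁻¹)) := by
        ext x
        rw [((hu.hasDerivAt x).fun_inv (hpos x).ne').deriv]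
        have := (hpos x).ne'
        field_simp
      rw [e]
      have b := mul hl hs hs ihj ihj
      have c := (mul hl hu.deriv (hs.mul hs) h.2 b).neg
      refine c.mono_const hl ?_
      calc 2 ^ j * (K * l * (2 ^ j * ((4 ^ j * K) ^ 3 ^ j * (4 ^ j * K) ^ 3 ^ j)))
          = ((4 ^ j * K) ^ (2 * 3 ^ j + 1)) * l := by
            have : (4 : ℝ) ^ j = 2 ^ j * 2 ^ j := by rw [← mul_pow]; norm_num
            rw [pow_succ, two_mul, pow_add]
            rw [show 2 ^ j * (K * l * (2 ^ j * ((4 ^ j * K) ^ 3 ^ j * (4 ^ j * K) ^ 3 ^ j)))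
              = (4 ^ j * K) ^ 3 ^ j * (4 ^ j * K) ^ 3 ^ j * ((2 ^ j * 2 ^ j) * K) * l by ring, ← this]
        _ ≤ ((4 ^ j * K) ^ (3 ^ (j + 1))) * l := by
            refine mul_le_mul_of_nonneg_right (pow_le_pow_right₀ hA ?_) hl
            have : 1 ≤ 3 ^ j := Nat.one_le_pow _ _ (by norm_num)
            rw [pow_succ]; omega
        _ ≤ _ := mul_le_mul_of_nonneg_right (pow_le_pow_left₀ (by positivity) hmono _) hl

lemma inv {k : ℝ} (hl : 0 ≤ l) (hu : Smooth u) (hpos : ∀ x, 0 < u x) (hk : 0 < k)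
    (h1 : ∀ x ∈ U, k ≤ u x) (hK : k ≤ K) (h : Bd U j l K u) :
    Bd U j l (k⁻¹ * (4 ^ j * (K / k)) ^ (3 ^ j)) (fun x => (u x)⁻¹) := by
  have h2 := (h.const_mul k⁻¹)
  have h3 := inv_one (K := |k⁻¹| * K) hl (contDiff_const.mul hu) (fun x => mul_pos (inv_pos.mpr hk) (hpos x))
    (fun x hx => by
      have := h1 x hx
      rw [← div_eq_inv_mul, le_div_iff₀ hk]; simpa using this) (by
      rw [abs_of_pos (inv_pos.mpr hk), ← div_eq_inv_mul, le_div_iff₀ hk]; simpa using hK) h2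
  have h4 := h3.const_mul k⁻¹
  rw [abs_of_pos (inv_pos.mpr hk), ← div_eq_inv_mul K k] at h4
  convert h4 using 2 with x
  rw [mul_inv, inv_inv, ← mul_assoc, inv_mul_cancel₀ hk.ne', one_mul]

lemma finset_sum {ι : Type*} (s : Finset ι) {w : ι → ℝ → ℝ} {c : ι → ℝ}
    (hs : ∀ i ∈ s, Smooth (w i)) (h : ∀ i ∈ s, Bd U j l (c i) (w i)) :
    Bd U j l (∑ i ∈ s, c i) (fun x => ∑ i ∈ s, w i x) := by
  intro b hb x hx
  rw [iteratedDeriv_fun_sum (fun i hi => ((hs i hi).of_nat b).contDiffAt), Finset.sum_mul]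
  exact (Finset.abs_sum_le_sum_abs _ _).trans (Finset.sum_le_sum fun i hi => h i hi b hb x hx)

end Bd

/-- Landau's inequality. -/
lemma landau {u : ℝ → ℝ} (hu : Smooth u) {A B : ℝ} (hA : ∀ x, |u x| ≤ A) (hB : 0 < B)
    (h2 : ∀ x, |deriv (deriv u) x| ≤ B) (x : ℝ) : deriv u x ^ 2 ≤ 8 * A * B := by
  by_cases h0 : deriv u x = 0
  · rw [h0]; have := (abs_nonneg _).trans (hA x); simp only [ne_eq, OfNat.ofNat_ne_zero, not_false_eq_true, zero_pow]; positivity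
  set h := |deriv u x| / (2 * B) with hh
  have hpos : 0 < h := by have := abs_pos.mpr h0; positivity
  obtain ⟨ξ, hξ, e⟩ := exists_deriv_eq_slope u (show x < x + h by linarith)
    hu.continuous.continuousOn hu.diff.differentiableOn
  have e2 : |deriv u ξ - deriv u x| ≤ B * |ξ - x| := by
    have := Convex.norm_image_sub_le_of_norm_deriv_le (f := deriv u) (s := Set.univ) (C := B)
      (fun y _ => (hu.deriv.diff y)) (fun y _ => h2 y) convex_univ (Set.mem_univ x) (Set.mem_univ ξ)
    simpa using this
  have e3 : |ξ - x| ≤ h := by rw [abs_of_pos (by linarith [hξ.1])]; linarith [hξ.2]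
  have e4 : |deriv u ξ| * h ≤ 2 * A := by
    rw [e, add_sub_cancel_left, abs_div, abs_of_pos hpos, div_mul_cancel₀ _ hpos.ne']
    exact (abs_sub _ _).trans (by linarith [hA x, hA (x + h)])
  have e5 : |deriv u x| ≤ |deriv u ξ| + B * h := by
    have := abs_sub_abs_le_abs_sub (deriv u x) (deriv u ξ)
    rw [abs_sub_comm] at this
    nlinarith
  have e6 : |deriv u x| = 2 * B * h := by rw [hh]; field_simp
  rw [← sq_abs, e6]
  have e7 : 2 * B * h * h ≤ 2 * A + B * h * h := by
    have := mul_le_mul_of_nonneg_right e5 hpos.le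
    rw [e6] at this; linarith
  have : B * h * h ≤ 2 * A := by linarith
  nlinarith

/-- Interpolation of derivatives. -/
lemma interp {u : ℝ → ℝ} (hu : Smooth u) {T s : ℝ} {r : ℕ} (hT : 0 < T) (hs : 0 ≤ s)
    (h1 : ∀ b ≤ r + 1, ∀ x, |iteratedDeriv b u x| ≤ T) (h0 : ∀ x, |u x| ≤ T * s ^ (2 ^ r)) (hs1 : s ≤ 1) :
    ∀ b ≤ r, ∀ x, |iteratedDeriv b u x| ≤ 8 * T * s := by
  have key : ∀ b ≤ r, ∀ x, |iteratedDeriv b u x| ≤ 8 * T * s ^ (2 ^ (r - b)) := by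
    intro b
    induction b with
    | zero => intro _ x; simp only [iteratedDeriv_zero, Nat.sub_zero]
              have : 0 ≤ T * s ^ 2 ^ r := by positivity
              linarith [h0 x]
    | succ b ih =>
      intro hb x
      have := landau (hu.iteratedDeriv b) (ih (by omega)) hT (fun y => by
        rw [← iteratedDeriv_succ, ← iteratedDeriv_succ]; exact h1 _ (by omega) y) x
      rw [← iteratedDeriv_succ] at this
      have e : r - b = (r - (b + 1)) + 1 := by omega
      rw [e, pow_succ 2, pow_mul] at this
      apply abs_le_of_sq_le_sq' _ (by positivity) |> abs_le.mpr
      calc _ ≤ _ := this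
        _ = _ := by ring
  intro b hb x
  refine (key b hb x).trans (mul_le_mul_of_nonneg_left ?_ (by positivity))
  exact pow_le_of_le_one hs hs1 (by positivity)

/-- Derivatives up to order `j` bounded on `U` by a power of `B`. -/
abbrev PB (U : Set ℝ) (j : ℕ) (B : ℝ) (N : ℕ) (u : ℝ → ℝ) : Prop := Bd U j 1 (B ^ N) u

namespace PB
variable {U V : Set ℝ} {j i N N' N₁ N₂ : ℕ} {B : ℝ} {u v : ℝ → ℝ}

lemma mono (h : PB U j B N u) (hB : 2 ≤ B) (hN : N ≤ N') : PB U j B N' u :=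
  h.mono_const zero_le_one (pow_le_pow_right₀ (by linarith) hN)

lemma two_pow (hB : 2 ≤ B) (j : ℕ) : 2 ^ j ≤ B ^ j := pow_le_pow_left₀ (by norm_num) hB j

lemma mul (hB : 2 ≤ B) (hu : Smooth u) (hv : Smooth v) (h₁ : PB U j B N₁ u) (h₂ : PB U j B N₂ v) :
    PB U j B (j + (N₁ + N₂)) (fun x => u x * v x) := by
  refine (Bd.mul zero_le_one hu hv h₁ h₂).mono_const zero_le_one ?_
  rw [pow_add B j, pow_add B N₁]
  exact mul_le_mul_of_nonneg_right (two_pow hB j) (by positivity)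

lemma add (hB : 2 ≤ B) (hu : Smooth u) (hv : Smooth v) (h₁ : PB U j B N₁ u) (h₂ : PB U j B N₂ v) :
    PB U j B (N₁ + N₂ + 1) (fun x => u x + v x) := by
  refine (Bd.add hu hv h₁ h₂).mono_const zero_le_one ?_
  have a : B ^ N₁ ≤ B ^ (N₁ + N₂) := pow_le_pow_right₀ (by linarith) (by omega)
  have b : B ^ N₂ ≤ B ^ (N₁ + N₂) := pow_le_pow_right₀ (by linarith) (by omega)
  rw [pow_succ]
  have : 0 ≤ B ^ (N₁ + N₂) := by positivity
  nlinarith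

lemma neg (h : PB U j B N u) : PB U j B N (fun x => -u x) := Bd.neg h

lemma inv (hB : 2 ≤ B) (hu : Smooth u) (hpos : ∀ x, 0 < u x)
    (h1 : ∀ x ∈ U, (B ^ N₁)⁻¹ ≤ u x) (h : PB U j B N₂ u) :
    PB U j B (N₁ + (2 * j + (N₁ + N₂)) * 3 ^ j) (fun x => (u x)⁻¹) := by
  have hB0 : 0 < B := by linarith
  refine (Bd.inv zero_le_one hu hpos (by positivity) h1 ?_ h).mono_const zero_le_one ?_
  · exact (inv_le_one_of_one_le₀ (one_le_pow₀ (by linarith))).trans (one_le_pow₀ (by linarith))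
  · rw [inv_inv, pow_add, pow_mul]
    refine mul_le_mul_of_nonneg_left (pow_le_pow_left₀ (by positivity) ?_ _) (by positivity)
    rw [div_inv_eq_mul, pow_add B (2 * j), pow_mul, pow_add, mul_comm (B ^ N₂)]
    exact mul_le_mul_of_nonneg_right (pow_le_pow_left₀ (by norm_num) (by nlinarith) _) (by positivity)

lemma comp_succ {φ : ℝ → ℝ} (hB : 2 ≤ B) (hφ : Smooth φ) (hu : Smooth u) (hm : Set.MapsTo φ U V)
    (h₁ : PB V (j + 1) B N₁ u) (h₂ : PB U j B N₂ (deriv φ)) :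
    PB U (j + 1) B (N₁ + (j + N₂) * (j + 1)) (fun x => u (φ x)) := by
  have hB0 : 0 < B := by linarith
  refine (Bd.comp_succ zero_le_one (A := B ^ N₂) (a := B ^ N₂) (by positivity) zero_le_one hφ hu hm h₁ h₂
    le_rfl (one_le_pow₀ (by linarith))).mono_const zero_le_one ?_
  rw [pow_add B N₁, pow_mul, pow_add B j]
  refine mul_le_mul_of_nonneg_left (pow_le_pow_left₀ (by positivity) ?_ _) (by positivity)
  exact mul_le_mul_of_nonneg_right (two_pow hB j) (by positivity)

/-- Bounds for solutions of `F' = a · (v ∘ F)`. -/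
lemma of_ode (j N : ℕ) : ∃ N' : ℕ, ∀ (B : ℝ) (_ : 2 ≤ B) (U V : Set ℝ) (F a v : ℝ → ℝ),
    Smooth F → Smooth a → Smooth v → Set.MapsTo F U V → (∀ x, deriv F x = a x * v (F x)) →
    PB U j B N a → PB V j B N v → PB U j B N' (deriv F) := by
  induction j with
  | zero =>
    refine ⟨N + N, fun B hB U V F a v hF ha hv hm he h1 h2 => ?_⟩
    intro b hb x hx
    obtain rfl : b = 0 := by omega
    have hB0 : 0 < B := by linarith
    simp only [iteratedDeriv_zero, pow_zero, mul_one]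
    rw [he, abs_mul, pow_add]
    exact mul_le_mul (h1.abs_le hx) (h2.abs_le (hm hx)) (abs_nonneg _) (by positivity)
  | succ j ih =>
    obtain ⟨N', h⟩ := ih
    refine ⟨(j + 1) + (N + (N + (j + N') * (j + 1))),
      fun B hB U V F a v hF ha hv hm he h1 h2 => ?_⟩
    have h3 := h B hB U V F a v hF ha hv hm he (h1.mono_order (by omega)) (h2.mono_order (by omega))
    have h4 := comp_succ hB hF hv hm h2 h3
    rw [show deriv F = fun x => a x * v (F x) from funext he]
    exact h1.mul hB ha (hv.comp hF) h4

end PB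

/-- Functions of period one. -/
def Per (u : ℝ → ℝ) : Prop := ∀ x, u (x + 1) = u x

namespace Per
variable {u : ℝ → ℝ}

lemma int (h : Per u) (x : ℝ) (n : ℤ) : u (x + n) = u x := by
  have : Function.Periodic u 1 := h
  simpa using this.int_mul n x

lemma deriv (h : Per u) : Per (deriv u) := by
  intro x
  rw [← deriv_comp_add_const]
  congr 1
  funext y; exact h y

lemma iteratedDeriv (h : Per u) (n : ℕ) : Per (iteratedDeriv n u) := by
  induction n with
  | zero => simpa using h
  | succ n ih => rw [iteratedDeriv_succ]; exact ih.deriv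

lemma fract (h : Per u) (x : ℝ) : u x = u (Int.fract x) := by
  conv_lhs => rw [← Int.fract_add_floor x]
  exact h.int _ _

lemma bdd (h : Per u) (hc : Continuous u) : ∃ C, ∀ x, |u x| ≤ C := by
  obtain ⟨C, hC⟩ := (isCompact_Icc (a := (0 : ℝ)) (b := 1)).exists_bound_of_continuousOn hc.continuousOn
  refine ⟨C, fun x => ?_⟩
  rw [h.fract]
  exact hC _ ⟨Int.fract_nonneg x, (Int.fract_lt_one x).le⟩

lemma pos_min (h : Per u) (hc : Continuous u) (hp : ∀ x, 0 < u x) : ∃ c > 0, ∀ x, c ≤ u x := by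
  obtain ⟨y, _, hy⟩ := (isCompact_Icc (a := (0 : ℝ)) (b := 1)).exists_isMinOn ⟨0, by simp⟩ hc.continuousOn
  refine ⟨u y, hp y, fun x => ?_⟩
  rw [h.fract x]
  exact hy ⟨Int.fract_nonneg x, (Int.fract_lt_one x).le⟩

lemma exists_max (h : Per u) (hc : Continuous u) : ∃ y, ∀ x, u x ≤ u y := by
  obtain ⟨y, _, hy⟩ := (isCompact_Icc (a := (0 : ℝ)) (b := 1)).exists_isMaxOn ⟨0, by simp⟩ hc.continuousOn
  refine ⟨y, fun x => ?_⟩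
  rw [h.fract x]
  exact hy ⟨Int.fract_nonneg x, (Int.fract_lt_one x).le⟩

lemma bdd_iter (h : Per u) (hs : Smooth u) (j : ℕ) : ∃ C, 0 < C ∧ Bd Set.univ j 1 C u := by
  induction j with
  | zero =>
    obtain ⟨C, hC⟩ := h.bdd hs.continuous
    exact ⟨max C 1, by positivity, Bd.zero_iff.mpr fun x _ => (hC x).trans (le_max_left _ _)⟩
  | succ j ih =>
    obtain ⟨C, hC0, hC⟩ := ih
    obtain ⟨C', hC'⟩ := (h.iteratedDeriv (j + 1)).bdd (hs.iteratedDeriv _).continuous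
    refine ⟨max C C', by positivity, fun b hb x hx => ?_⟩
    rw [one_pow, mul_one]
    rcases Nat.lt_or_ge b (j + 1) with h' | h'
    · have := hC b (by omega) x hx
      rw [one_pow, mul_one] at this
      exact this.trans (le_max_left _ _)
    · obtain rfl : b = j + 1 := by omega
      exact (hC' x).trans (le_max_right _ _)

end Per

namespace IsCircleDiffeoLift
variable {f g : ℝ → ℝ}

lemma smooth (h : IsCircleDiffeoLift f) : Smooth f := h.1
lemma pos (h : IsCircleDiffeoLift f) (x : ℝ) : 0 < deriv f x := h.2.2 x
lemma strictMono (h : IsCircleDiffeoLift f) : StrictMono f := strictMono_of_deriv_pos h.2.2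
lemma cont (h : IsCircleDiffeoLift f) : Continuous f := h.1.continuous

lemma per_sub_id (h : IsCircleDiffeoLift f) : Per (fun x => f x - x) := by
  intro x; simp only [h.2.1 x]; ring

lemma per_sub (h : IsCircleDiffeoLift f) (h' : IsCircleDiffeoLift g) : Per (fun x => f x - g x) := by
  intro x; simp only [h.2.1 x, h'.2.1 x]; ring

lemma add_int (h : IsCircleDiffeoLift f) (x : ℝ) (n : ℤ) : f (x + n) = f x + n := by
  have := h.per_sub_id.int x n
  linarith

lemma sub_int (h : IsCircleDiffeoLift f) (x : ℝ) (n : ℤ) : f (x - n) = f x - n := by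
  have := h.add_int x (-n)
  push_cast at this; simpa [sub_eq_add_neg] using this

lemma per_deriv (h : IsCircleDiffeoLift f) : Per (deriv f) := by
  intro x
  rw [← deriv_comp_add_const]
  have : (fun y => f (y + 1)) = fun y => f y + 1 := funext h.2.1
  rw [this, deriv_add_const]

lemma surj (h : IsCircleDiffeoLift f) : Function.Surjective f := by
  intro y
  obtain ⟨C, hC⟩ := h.per_sub_id.bdd (h.cont.sub continuous_id)
  have h1 := abs_le.mp (hC (y - C))
  have h2 := abs_le.mp (hC (y + C))
  have hC0 := (abs_nonneg _).trans (hC 0)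
  obtain ⟨x, _, hx⟩ := intermediate_value_Icc (show y - C ≤ y + C by linarith) h.cont.continuousOn
    (show y ∈ Set.Icc (f (y - C)) (f (y + C)) from ⟨by linarith, by linarith⟩)
  exact ⟨x, hx⟩

lemma inv_right (h : IsCircleDiffeoLift f) (y : ℝ) : f (Function.invFun f y) = y :=
  Function.rightInverse_invFun h.surj y

lemma inv_left (h : IsCircleDiffeoLift f) (y : ℝ) : Function.invFun f (f y) = y :=
  Function.leftInverse_invFun h.strictMono.injective y

lemma inv_smooth (h : IsCircleDiffeoLift f) : Smooth (Function.invFun f) := by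
  let e := (StrictMono.orderIsoOfSurjective f h.strictMono h.surj).toHomeomorph
  have he : ∀ x, e x = f x := fun x => rfl
  have h1 : Smooth e.symm := e.contDiff_symm_deriv (f' := deriv f) (fun x => (h.pos x).ne')
    (fun x => h.smooth.hasDerivAt x) h.smooth
  have : Function.invFun f = e.symm := by
    funext y
    apply h.strictMono.injective
    rw [h.inv_right, ← he, e.apply_symm_apply]
  rw [this]; exact h1

lemma inv_deriv (h : IsCircleDiffeoLift f) (y : ℝ) :
    deriv (Function.invFun f) y = (deriv f (Function.invFun f y))⁻¹ := by
  have h1 := (h.smooth.hasDerivAt (Function.invFun f y)).comp y (h.inv_smooth.hasDerivAt y)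
  have h2 : HasDerivAt (f ∘ Function.invFun f) 1 y := by
    have : f ∘ Function.invFun f = id := funext h.inv_right
    rw [this]; exact hasDerivAt_id y
  exact eq_inv_of_mul_eq_one_right (h1.unique h2)

lemma inv (h : IsCircleDiffeoLift f) : IsCircleDiffeoLift (Function.invFun f) := by
  refine ⟨h.inv_smooth, fun x => ?_, fun x => ?_⟩
  · apply h.strictMono.injective
    rw [h.2.1, h.inv_right, h.inv_right]
  · rw [h.inv_deriv]; exact inv_pos.mpr (h.pos _)

lemma deriv_comp (h : IsCircleDiffeoLift f) (h' : IsCircleDiffeoLift g) (x : ℝ) :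
    deriv (fun x => f (g x)) x = deriv f (g x) * deriv g x :=
  ((h.smooth.hasDerivAt _).comp x (h'.smooth.hasDerivAt x)).deriv

lemma comp (h : IsCircleDiffeoLift f) (h' : IsCircleDiffeoLift g) :
    IsCircleDiffeoLift (fun x => f (g x)) := by
  refine ⟨h.smooth.comp h'.smooth, fun x => ?_, fun x => ?_⟩
  · simp only [h'.2.1, h.2.1]
  · rw [deriv_comp h h']; exact mul_pos (h.pos _) (h'.pos _)

lemma ident : IsCircleDiffeoLift (fun x => x) :=
  ⟨contDiff_id, fun _ => rfl, fun x => by simp⟩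

lemma iter (h : IsCircleDiffeoLift f) (n : ℕ) : IsCircleDiffeoLift (f^[n]) := by
  induction n with
  | zero => exact ident
  | succ n ih => rw [Function.iterate_succ]; exact ih.comp h

lemma add_const (h : IsCircleDiffeoLift f) (c : ℝ) : IsCircleDiffeoLift (fun x => f x + c) := by
  refine ⟨h.smooth.add contDiff_const, fun x => by simp only [h.2.1]; ring, fun x => ?_⟩
  rw [deriv_add_const]; exact h.pos x

lemma invFun_eq (h : IsCircleDiffeoLift f) {x y : ℝ} (e : f x = y) : Function.invFun f y = x := by
  rw [← e, h.inv_left]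

lemma of_bdd (h : IsCircleDiffeoLift f) (j : ℕ) : ∃ C, 0 < C ∧ Bd Set.univ j 1 C (deriv f) :=
  h.per_deriv.bdd_iter h.smooth.deriv j

lemma pos_min (h : IsCircleDiffeoLift f) : ∃ c > 0, ∀ x, c ≤ deriv f x :=
  h.per_deriv.pos_min h.smooth.deriv.continuous h.pos

end IsCircleDiffeoLift

/-- `|D^b (f - g)| ≤ δ` for `b ≤ r`. -/
def Close (r : ℕ) (δ : ℝ) (f g : ℝ → ℝ) : Prop :=
  ∀ b ≤ r, ∀ x, |iteratedDeriv b (fun x => f x - g x) x| ≤ δ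

namespace Close
variable {r s : ℕ} {δ δ' : ℝ} {f g h : ℝ → ℝ}

lemma mono (hc : Close r δ f g) (hs : s ≤ r) (hδ : δ ≤ δ') : Close s δ' f g :=
  fun b hb x => (hc b (hb.trans hs) x).trans hδ

lemma trans (hf : Smooth f) (hg : Smooth g) (hh : Smooth h) (h1 : Close r δ f g)
    (h2 : Close r δ' g h) : Close r (δ + δ') f h := by
  intro b hb x
  have e : (fun x => f x - h x) = fun x => (f x - g x) + (g x - h x) := by funext x; ring
  rw [e, iteratedDeriv_fun_add (Smooth.of_nat (hf.sub hg) b).contDiffAt (Smooth.of_nat (hg.sub hh) b).contDiffAt]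
  exact (abs_add_le _ _).trans (add_le_add (h1 b hb x) (h2 b hb x))

lemma val (hc : Close r δ f g) (x : ℝ) : |f x - g x| ≤ δ := by simpa using hc 0 (by omega) x

lemma der (hf : Smooth f) (hg : Smooth g) (hc : Close r δ f g) (hr : 1 ≤ r) (x : ℝ) :
    |deriv f x - deriv g x| ≤ δ := by
  have := hc 1 hr x
  rw [iteratedDeriv_one] at this
  rwa [deriv_fun_sub (hf.diff x) (hg.diff x)] at this

lemma bd_deriv (hf : Smooth f) (hg : Smooth g) (hc : Close (r + 1) δ f g) :
    Bd Set.univ r 1 δ (fun x => deriv f x - deriv g x) := by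
  intro b hb x _
  have := hc (b + 1) (by omega) x
  rw [iteratedDeriv_succ'] at this
  have e : deriv (fun x => f x - g x) = fun x => deriv f x - deriv g x := by
    funext y; exact deriv_fun_sub (hf.diff y) (hg.diff y)
  rw [e] at this
  simpa using this

end Close

lemma close_inv {g : ℝ → ℝ} (hg : IsCircleDiffeoLift g) (r : ℕ) {ε : ℝ} (hε : 0 < ε) :
    ∃ δ > 0, ∀ f, IsCircleDiffeoLift f → Close (r + 1) δ f g →
      Close r ε (Function.invFun f) (Function.invFun g) := by
  obtain ⟨C, hC0, hC⟩ := hg.of_bdd r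
  obtain ⟨c, hc0, hc⟩ := hg.pos_min
  set B : ℝ := max 2 (max (C + 1) (2 / c)) with hBdef
  have hB2 : 2 ≤ B := le_max_left _ _
  have hB0 : 0 < B := by linarith
  have hBC : C + 1 ≤ B := (le_max_left _ _).trans (le_max_right _ _)
  have hBc : 2 / c ≤ B := (le_max_right _ _).trans (le_max_right _ _)
  obtain ⟨N', hN'⟩ := PB.of_ode r ((1 + (2 * r + (1 + 1)) * 3 ^ r))
  have key : ∀ f, IsCircleDiffeoLift f → (∀ x, c / 2 ≤ deriv f x) → Bd Set.univ r 1 B (deriv f) →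
      PB Set.univ r B N' (deriv (Function.invFun f)) := by
    intro f hf hfc hfB
    have hv : PB Set.univ r B ((1 + (2 * r + (1 + 1)) * 3 ^ r)) (fun x => (deriv f x)⁻¹) := by
      refine PB.inv hB2 hf.smooth.deriv hf.pos (fun x _ => ?_) (by simpa [PB] using hfB)
      refine le_trans ?_ (hfc x)
      rw [pow_one, inv_le_comm₀ hB0 (by positivity)]
      simpa using hBc
    refine hN' B hB2 Set.univ Set.univ _ (fun _ => 1) (fun x => (deriv f x)⁻¹) hf.inv_smooth contDiff_const
      (hf.smooth.deriv.inv fun x => (hf.pos x).ne') (Set.mapsTo_univ _ _) (fun x => by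
        rw [hf.inv_deriv, one_mul]) ?_ hv
    refine (Bd.const zero_le_one 1).mono_const zero_le_one ?_
    rw [abs_one]; exact one_le_pow₀ (by linarith)
  set T : ℝ := 2 * B ^ N' with hT
  have hT1 : 1 ≤ T := by
    have : 1 ≤ B ^ N' := one_le_pow₀ (by linarith)
    linarith
  set s : ℝ := min 1 (ε / (8 * T)) with hs
  have hs0 : 0 < s := by positivity
  refine ⟨min (min 1 (c / 2)) (c / 2 * (T * s ^ (2 ^ r))), by positivity, fun f hf hfg => ?_⟩
  have hδ1 : Close (r + 1) 1 f g := hfg.mono le_rfl ((min_le_left _ _).trans (min_le_left _ _))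
  have hδ2 : Close (r + 1) (c / 2) f g := hfg.mono le_rfl ((min_le_left _ _).trans (min_le_right _ _))
  have hδ3 : Close (r + 1) (c / 2 * (T * s ^ (2 ^ r))) f g := hfg.mono le_rfl (min_le_right _ _)
  have hfc : ∀ x, c / 2 ≤ deriv f x := fun x => by
    have := abs_le.mp (hδ2.der hf.smooth hg.smooth (by omega) x)
    linarith [hc x]
  have kf := key f hf hfc (by
    have := Bd.add (hf.smooth.deriv.sub hg.smooth.deriv) hg.smooth.deriv
      (hδ1.bd_deriv hf.smooth hg.smooth) hC
    simp only [sub_add_cancel] at this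
    exact this.mono_const zero_le_one (by linarith))
  have kg := key g hg (fun x => by linarith [hc x]) (hC.mono_const zero_le_one (by linarith))
  have hv : ∀ y, |Function.invFun f y - Function.invFun g y| ≤ T * s ^ (2 ^ r) := by
    intro y
    set x := Function.invFun f y
    set z := Function.invFun g y
    have e : f x = y := hf.inv_right y
    have e2 : g z = y := hg.inv_right y
    have h3 := hδ3.val x
    have h4 : c / 2 * |x - z| ≤ |g x - g z| := by
      have lower : ∀ a b : ℝ, a ≤ b → c * (b - a) ≤ g b - g a := fun a b hab => by
        have := Convex.mul_sub_le_image_sub_of_le_deriv (D := Set.univ) convex_univ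
          hg.cont.continuousOn hg.smooth.diff.differentiableOn (C := c)
          (fun x _ => hc x) a (Set.mem_univ _) b (Set.mem_univ _) hab
        exact this
      rcases le_total x z with h' | h'
      · rw [abs_of_nonpos (by linarith)]
        have := lower x z h'
        have := neg_le_abs (g x - g z)
        nlinarith
      · rw [abs_of_nonneg (by linarith)]
        have := lower z x h'
        have := le_abs_self (g x - g z)
        nlinarith
    rw [e2, ← e, abs_sub_comm (g x)] at h4
    have : c / 2 * |x - z| ≤ c / 2 * (T * s ^ 2 ^ r) := h4.trans h3
    exact le_of_mul_le_mul_left this (by positivity)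
  have hbT : ∀ b ≤ r + 1, ∀ x,
      |iteratedDeriv b (fun x => Function.invFun f x - Function.invFun g x) x| ≤ T := by
    intro b hb x
    cases b with
    | zero =>
      simp only [iteratedDeriv_zero]
      exact (hv x).trans (mul_le_of_le_one_right (by linarith) (pow_le_one₀ hs0.le (min_le_left _ _)))
    | succ b =>
      rw [iteratedDeriv_succ']
      have e : deriv (fun x => Function.invFun f x - Function.invFun g x) =
          fun x => deriv (Function.invFun f) x - deriv (Function.invFun g) x := by
        funext y; exact deriv_fun_sub (hf.inv_smooth.diff y) (hg.inv_smooth.diff y)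
      rw [e]
      have := (Bd.sub hf.inv_smooth.deriv hg.inv_smooth.deriv kf kg) b (by omega) x (Set.mem_univ _)
      rw [one_pow, mul_one] at this
      linarith
  intro b hb x
  refine (interp (hf.inv_smooth.sub hg.inv_smooth) (by linarith) hs0.le hbT hv (min_le_left _ _) b hb x).trans ?_
  have := min_le_right 1 (ε / (8 * T))
  calc 8 * T * s ≤ 8 * T * (ε / (8 * T)) := mul_le_mul_of_nonneg_left this (by positivity)
    _ = ε := by field_simp

/-- A cyclically ordered periodic orbit of combinatorics `p / q` whose largest gap is the one
starting at index `0`. -/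
structure CycOrbit (f : ℝ → ℝ) (p : ℤ) (q : ℕ) (z : ℤ → ℝ) : Prop where
  mono : StrictMono z
  per : ∀ n, z (n + q) = z n + 1
  map : ∀ n, f (z n) = z (n + p)
  cop : IsCoprime p (q : ℤ)
  three_le : 3 ≤ q
  max : ∀ n, z (n + 1) - z n ≤ z 1 - z 0

lemma int_per_max {u : ℤ → ℝ} {q : ℕ} (hq : 0 < q) (h : ∀ n, u (n + q) = u n) :
    ∃ m, ∀ n, u n ≤ u m := by
  have hp : Function.Periodic u (q : ℤ) := h
  obtain ⟨m, _, hm⟩ := Finset.exists_max_image (Finset.range q) (fun i : ℕ => u i) ⟨0, by simpa using hq⟩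
  refine ⟨m, fun n => ?_⟩
  have e : u n = u (n % q) := by
    conv_lhs => rw [← Int.emod_add_mul_ediv n q, mul_comm]
    exact hp.int_mul _ _
  have hq' : (0 : ℤ) < q := by exact_mod_cast hq
  have h1 := Int.emod_nonneg n hq'.ne'
  have h2 := Int.emod_lt_of_pos n hq'
  have := hm (n % q).toNat (by simp; omega)
  rw [e]
  rwa [Int.toNat_of_nonneg h1] at this

lemma exists_cycOrbit {f : ℝ → ℝ} (hf : IsCircleDiffeoLift f) {p : ℤ} {q : ℕ}
    (hcop : IsCoprime p (q : ℤ)) (hq : 3 ≤ q) (h0 : f^[q] 0 = p) : ∃ z, CycOrbit f p q z := by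
  let F : ℝ ≃o ℝ := StrictMono.orderIsoOfSurjective f hf.strictMono hf.surj
  let T : ℝ ≃o ℝ := OrderIso.addRight 1
  have hF : ∀ x, F x = f x := fun _ => rfl
  have hT : ∀ x, T x = x + 1 := fun _ => rfl
  have hTi : ∀ x, T⁻¹ x = x - 1 := fun x => by
    have : T⁻¹ (T (x - 1)) = x - 1 := RelIso.inv_apply_self T (x - 1)
    rwa [hT, sub_add_cancel] at this
  have hTz : ∀ (c : ℤ) x, (T ^ c) x = x + c := by
    intro c
    induction c using Int.induction_on with
    | zero => intro x; simp
    | succ i ih => intro x; rw [zpow_add, zpow_one, RelIso.mul_apply, ih, hT]; push_cast; ring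
    | pred i ih =>
      intro x; rw [sub_eq_add_neg, zpow_add, zpow_neg_one, RelIso.mul_apply, ih, hTi]; push_cast; ring
  have hcomm : Commute F T := by
    ext x; rw [RelIso.mul_apply, RelIso.mul_apply, hT, hT, hF, hF, hf.2.1]
  have hFq : ∀ n : ℕ, ∀ x, (F ^ n) x = f^[n] x := by
    intro n
    induction n with
    | zero => intro x; simp
    | succ n ih => intro x; rw [pow_succ, RelIso.mul_apply, ih, Function.iterate_succ_apply, hF]
  have hFq0 : (F ^ (q : ℤ)) 0 = (T ^ p) 0 := by
    rw [zpow_natCast, hFq, h0, hTz]; simp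
  obtain ⟨b, c, hbc⟩ := hcop
  -- stabilizer of zero
  let S : ℝ ≃o ℝ := F ^ (q : ℤ) * T ^ (-p)
  have hS0 : S 0 = 0 := by
    have e : S = T ^ (-p) * F ^ (q : ℤ) := (hcomm.zpow_zpow _ _)
    rw [e, RelIso.mul_apply, hFq0, ← RelIso.mul_apply, ← zpow_add]; simp
  have hSz : ∀ c : ℤ, (S ^ c) 0 = 0 := by
    have hSi : S⁻¹ 0 = 0 := by
      conv_lhs => rw [← hS0]
      exact RelIso.inv_apply_self S 0
    intro c
    induction c using Int.induction_on with
    | zero => simp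
    | succ i ih => rw [zpow_add, zpow_one, RelIso.mul_apply, hS0, ih]
    | pred i ih => rw [sub_eq_add_neg, zpow_add, zpow_neg_one, RelIso.mul_apply, hSi, ih]
  have hSzz : ∀ c : ℤ, S ^ c = F ^ ((q : ℤ) * c) * T ^ (-p * c) := by
    intro c
    rw [(hcomm.zpow_zpow _ _).mul_zpow, ← zpow_mul, ← zpow_mul]
  let G : ℝ ≃o ℝ := F ^ b * T ^ c
  have hGz : ∀ n : ℤ, G ^ n = F ^ (b * n) * T ^ (c * n) := by
    intro n
    rw [(hcomm.zpow_zpow _ _).mul_zpow, ← zpow_mul, ← zpow_mul]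
  have hmulz : ∀ i j k l : ℤ, F ^ i * T ^ j * (F ^ k * T ^ l) = F ^ (i + k) * T ^ (j + l) := by
    intro i j k l
    rw [mul_assoc, ← mul_assoc (T ^ j), (hcomm.zpow_zpow k j).symm.eq, zpow_add, zpow_add]
    simp only [mul_assoc]
  have hGT : Commute G T := (hcomm.zpow_left b).mul_left ((Commute.refl T).zpow_left c)
  have hGF : Commute F G := ((Commute.refl F).zpow_right b).mul_right (hcomm.zpow_right c)
  have hGq : G ^ (q : ℤ) = T * S ^ b := by
    rw [hGz, hSzz]
    have := hmulz 0 1 (q * b) (-p * b)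
    rw [zpow_zero, one_mul, zpow_one] at this
    rw [this]
    congr 2 <;> linarith
  have hGp : G ^ p = F * S ^ (-c) := by
    rw [hGz, hSzz]
    have := hmulz 1 0 (q * (-c)) (-p * (-c))
    rw [zpow_zero, mul_one, zpow_one] at this
    rw [this]
    congr 2 <;> linarith
  have hGq0 : (G ^ (q : ℤ)) 0 = 1 := by rw [hGq, RelIso.mul_apply, hSz, hT, zero_add]
  have hGp0 : (G ^ p) 0 = F 0 := by rw [hGp, RelIso.mul_apply, hSz]
  have hG0 : 0 < G 0 := by
    by_contra hneg
    push Not at hneg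
    have : ∀ n : ℕ, (G ^ n) 0 ≤ 0 := by
      intro n
      induction n with
      | zero => simp
      | succ n ih =>
        rw [pow_succ, RelIso.mul_apply]
        exact ((G ^ n).monotone hneg).trans ih
    have := this q
    rw [zpow_natCast] at hGq0
    linarith
  let z : ℤ → ℝ := fun n => (G ^ n) 0
  have hzmono : StrictMono z := strictMono_int_of_lt_succ fun n => by
    change (G ^ n) 0 < (G ^ (n + 1)) 0
    rw [zpow_add, zpow_one, RelIso.mul_apply]
    exact (G ^ n).strictMono hG0
  have hzper : ∀ n, z (n + q) = z n + 1 := fun n => by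
    change (G ^ (n + (q : ℤ))) 0 = (G ^ n) 0 + 1
    rw [zpow_add, RelIso.mul_apply, hGq0, ← hT, ← RelIso.mul_apply, ← (hGT.zpow_left n).eq,
      RelIso.mul_apply, hT, zero_add]
  have hzmap : ∀ n, f (z n) = z (n + p) := fun n => by
    change F ((G ^ n) 0) = (G ^ (n + p)) 0
    rw [zpow_add, RelIso.mul_apply, hGp0, ← RelIso.mul_apply, ← RelIso.mul_apply,
      (hGF.zpow_right n).eq]
  obtain ⟨m, hm⟩ := int_per_max (u := fun n => z (n + 1) - z n) (q := q) (by omega) (fun n => by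
    have := hzper (n + 1)
    rw [show n + 1 + (q : ℤ) = n + q + 1 by ring] at this
    simp only [this, hzper]; ring)
  refine ⟨fun n => z (n + m), fun i j hij => hzmono (by omega), fun n => ?_, fun n => ?_, ⟨b, c, hbc⟩, hq, fun n => ?_⟩
  · rw [← hzper]; congr 1; ring
  · rw [hzmap]; congr 1; ring
  · have := hm (n + m)
    rw [show n + 1 + m = n + m + 1 by ring, show 1 + m = m + 1 by ring, zero_add]
    exact this

/-- The lift `f` has translation number exactly `a`. -/
def HasTrans (f : ℝ → ℝ) (a : ℝ) : Prop :=
  Tendsto (fun n : ℕ => f^[n] 0 / (n : ℝ)) atTop (nhds a)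

/-- The monotone degree one lift underlying a diffeomorphism lift. -/
def IsCircleDiffeoLift.cdl {f : ℝ → ℝ} (hf : IsCircleDiffeoLift f) : CircleDeg1Lift :=
  ⟨⟨f, hf.strictMono.monotone⟩, hf.2.1⟩

lemma IsCircleDiffeoLift.cdl_pow {f : ℝ → ℝ} (hf : IsCircleDiffeoLift f) (n : ℕ) (x : ℝ) :
    (hf.cdl ^ n) x = f^[n] x := by
  rw [CircleDeg1Lift.coe_pow]; rfl

lemma HasTrans.eq {f : ℝ → ℝ} (hf : IsCircleDiffeoLift f) {a : ℝ} (h : HasTrans f a) :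
    hf.cdl.translationNumber = a := by
  have := hf.cdl.tendsto_translation_number₀
  refine tendsto_nhds_unique (this.congr fun n => ?_) h
  rw [hf.cdl_pow]

lemma HasTrans.le_of_le {f : ℝ → ℝ} (hf : IsCircleDiffeoLift f) {a : ℝ} (h : HasTrans f a)
    {x : ℝ} {b : ℕ} {m : ℤ} (hb : f^[b] x ≤ x + m) : b * a ≤ m := by
  rw [← h.eq hf, ← CircleDeg1Lift.translationNumber_pow]
  exact CircleDeg1Lift.translationNumber_le_of_le_add_int _ (by rw [hf.cdl_pow]; exact hb)

lemma HasTrans.ge_of_ge {f : ℝ → ℝ} (hf : IsCircleDiffeoLift f) {a : ℝ} (h : HasTrans f a)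
    {x : ℝ} {b : ℕ} {m : ℤ} (hb : x + m ≤ f^[b] x) : m ≤ b * a := by
  rw [← h.eq hf, ← CircleDeg1Lift.translationNumber_pow]
  exact CircleDeg1Lift.le_translationNumber_of_add_int_le _ (by rw [hf.cdl_pow]; exact hb)

namespace CycOrbit
variable {f : ℝ → ℝ} {p : ℤ} {q : ℕ} {z : ℤ → ℝ}

lemma iter (h : CycOrbit f p q z) (i : ℕ) (n : ℤ) : f^[i] (z n) = z (n + i * p) := by
  induction i with
  | zero => simp
  | succ i ih => rw [Function.iterate_succ_apply', ih, h.map]; congr 1; push_cast; ring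

lemma per_int (h : CycOrbit f p q z) (n k : ℤ) : z (n + k * q) = z n + k := by
  induction k using Int.induction_on with
  | zero => simp
  | succ i ih =>
    rw [show n + ((i : ℤ) + 1) * q = n + i * q + q by ring, h.per, ih]; push_cast; ring
  | pred i ih =>
    have := h.per (n + (-(i : ℤ) - 1) * q)
    rw [show n + (-(i : ℤ) - 1) * q + q = n + (-(i : ℤ)) * q by ring, ih] at this
    push_cast at this ⊢; linarith

end CycOrbit

lemma exists_bezout {p : ℤ} {q : ℕ} (hcop : IsCoprime p (q : ℤ)) (hq : 0 < q) (s : ℤ) :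
    ∃ b : ℕ, ∃ c : ℤ, 1 ≤ b ∧ b ≤ q ∧ p * b + q * c = s := by
  obtain ⟨u, v, huv⟩ := hcop
  have hq' : (0 : ℤ) < q := by exact_mod_cast hq
  have h1 := Int.emod_nonneg (s * u - 1) hq'.ne'
  have h2 := Int.emod_lt_of_pos (s * u - 1) hq'
  have h3 := Int.emod_add_mul_ediv (s * u - 1) q
  refine ⟨((s * u - 1) % q).toNat + 1, s * v + p * ((s * u - 1) / q), by omega, by omega, ?_⟩
  push_cast
  rw [Int.toNat_of_nonneg h1]
  have : (s * u - 1) % q = (s * u - 1) - q * ((s * u - 1) / q) := by linarith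
  rw [this]
  linear_combination s * huv

lemma iterate_le_of_le {f g : ℝ → ℝ} (hg : Monotone g) (h : ∀ x, g x ≤ f x) (n : ℕ) (x : ℝ) :
    g^[n] x ≤ f^[n] x := by
  induction n generalizing x with
  | zero => simp
  | succ n ih =>
    rw [Function.iterate_succ_apply, Function.iterate_succ_apply]
    exact ((hg.iterate n) (h x)).trans (ih _)

lemma iterate_add_le {f g : ℝ → ℝ} (hg : Monotone g) {t : ℝ} (ht : 0 ≤ t)
    (h : ∀ x, g x + t ≤ f x) {n : ℕ} (hn : 1 ≤ n) (x : ℝ) : g^[n] x + t ≤ f^[n] x := by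
  obtain ⟨n, rfl⟩ : ∃ k, n = k + 1 := ⟨n - 1, by omega⟩
  rw [Function.iterate_succ_apply', Function.iterate_succ_apply']
  have := hg (iterate_le_of_le (f := f) hg (fun y => by linarith [h y]) n x)
  linarith [h (f^[n] x)]

lemma cycOrbit_shift_le {g : ℝ → ℝ} (hg : IsCircleDiffeoLift g) {a t : ℝ} (ha : HasTrans g a)
    {p : ℤ} {q : ℕ} {z : ℤ → ℝ} (hz : CycOrbit (fun x => g x + t) p q z)
    (hpq : |a - p / q| < 1 / (q : ℝ) ^ 2) : |t| ≤ z 1 - z 0 := by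
  have hq0 : 0 < q := by have := hz.three_le; omega
  have hqr : (0 : ℝ) < q := by exact_mod_cast hq0
  have hf : IsCircleDiffeoLift (fun x => g x + t) := hg.add_const t
  have key : |q * a - p| * q < 1 := by
    have : |q * a - p| = q * |a - p / q| := by
      rw [← abs_of_pos hqr, ← abs_mul, abs_of_pos hqr]; congr 1; field_simp
    rw [this]
    rw [lt_div_iff₀ (by positivity)] at hpq
    nlinarith
  have key2 : ∀ b : ℕ, b ≤ q → |q * a - p| * b < 1 := fun b hb => by
    have : (b : ℝ) ≤ q := by exact_mod_cast hb
    exact lt_of_le_of_lt (mul_le_mul_of_nonneg_left this (abs_nonneg _)) key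
  rw [abs_le]
  constructor
  · by_contra! hlt
    obtain ⟨b, c, hb1, hbq, e⟩ := exists_bezout hz.cop hq0 (-1)
    have h1 := hz.iter b 0
    have h2 := hz.per_int (-1) (-c)
    have e3 : (0 : ℤ) + b * p = -1 + -c * q := by linarith
    rw [e3, h2] at h1
    have h4 := iterate_add_le hf.strictMono.monotone (t := -t) (f := g)
      (by have := hz.mono (show (0 : ℤ) < 1 by norm_num); linarith) (fun x => by simp) hb1 (z 0)
    rw [h1] at h4
    have h5 := hz.max (-1)
    simp only [Int.reduceNeg, neg_add_cancel] at h5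
    have h6 := ha.ge_of_ge hg (x := z 0) (b := b) (m := -c) (by push_cast at h4 ⊢; linarith)
    push_cast at h6
    have er : (p : ℝ) * b + q * c = -1 := by exact_mod_cast e
    have h7 := key2 b hbq
    have h8 : -((c : ℝ) * q) ≤ b * a * q := by nlinarith
    have h9 := le_abs_self (q * a - p)
    have hb0 : (0 : ℝ) ≤ b := by positivity
    nlinarith
  · by_contra! hlt
    obtain ⟨b, c, hb1, hbq, e⟩ := exists_bezout hz.cop hq0 1
    have h1 := hz.iter b 0
    have h2 := hz.per_int 1 (-c)
    have e3 : (0 : ℤ) + b * p = 1 + -c * q := by linarith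
    rw [e3, h2] at h1
    have h4 := iterate_add_le hg.strictMono.monotone (t := t) (f := fun x => g x + t)
      (by have := hz.mono (show (0 : ℤ) < 1 by norm_num); linarith) (fun x => by simp) hb1 (z 0)
    rw [h1] at h4
    have h6 := ha.le_of_le hg (x := z 0) (b := b) (m := -c) (by push_cast at h4 ⊢; linarith)
    push_cast at h6
    have er : (p : ℝ) * b + q * c = 1 := by exact_mod_cast e
    have h7 := key2 b hbq
    have h8 : b * a * q ≤ -((c : ℝ) * q) := by nlinarith
    have h9 := neg_le_abs (q * a - p)
    have hb0 : (0 : ℝ) ≤ b := by positivity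
    nlinarith

/-- Every reduced fraction close to the rotation number is realised by a periodic orbit of a
translate of `g`. -/
lemma exists_shift_cycOrbit {g : ℝ → ℝ} (hg : IsCircleDiffeoLift g) {p : ℤ} {q : ℕ}
    (hcop : IsCoprime p (q : ℤ)) (hq : 3 ≤ q) :
    ∃ t z, CycOrbit (fun x => g x + t) p q z := by
  have hcont : ∀ n : ℕ, Continuous (fun t : ℝ => (fun x => g x + t)^[n] 0) := by
    intro n
    induction n with
    | zero => exact continuous_const
    | succ n ih =>
      simp only [Function.iterate_succ_apply']
      exact (hg.cont.comp ih).add continuous_id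
  obtain ⟨C, hC⟩ := hg.per_sub_id.bdd (hg.cont.sub continuous_id)
  have hlow : ∀ s : ℝ, ∀ n : ℕ, n * s ≤ (fun x => g x + (s + C))^[n] 0 := by
    intro s n
    induction n with
    | zero => simp
    | succ n ih =>
      rw [Function.iterate_succ_apply']
      have := abs_le.mp (hC ((fun x => g x + (s + C))^[n] 0))
      push_cast; linarith
  have hup : ∀ s : ℝ, ∀ n : ℕ, (fun x => g x + (s - C))^[n] 0 ≤ n * s := by
    intro s n
    induction n with
    | zero => simp
    | succ n ih =>
      rw [Function.iterate_succ_apply']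
      have := abs_le.mp (hC ((fun x => g x + (s - C))^[n] 0))
      push_cast; linarith
  have hqr : (0 : ℝ) < q := by exact_mod_cast (by omega : 0 < q)
  have h1 := hlow (p / q) q
  have h2 := hup (p / q) q
  rw [mul_div_cancel₀ _ hqr.ne'] at h1 h2
  have hC0 := (abs_nonneg _).trans (hC 0)
  obtain ⟨t, _, ht⟩ := intermediate_value_Icc (show (p / q : ℝ) - C ≤ p / q + C by linarith)
    (hcont q).continuousOn (show (p : ℝ) ∈ Set.Icc _ _ from ⟨h2, h1⟩)
  exact ⟨t, exists_cycOrbit (hg.add_const t) hcop hq ht⟩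

/-- The length of the `n`-th gap of a sequence. -/
def gap (z : ℤ → ℝ) (n : ℤ) : ℝ := z (n + 1) - z n

/-- `log f'` is `L`-Lipschitz. -/
def LogLip (f : ℝ → ℝ) (L : ℝ) : Prop :=
  ∀ x y, |Real.log (deriv f x) - Real.log (deriv f y)| ≤ L * |x - y|

lemma sum_zmod {A : ℤ → ℝ} {q : ℕ} [NeZero q] (hA : ∀ n, A (n + q) = A n) :
    (∀ m : ℤ, A m = A ((m : ZMod q).val)) ∧
    ∑ i ∈ Finset.range q, A i = ∑ x : ZMod q, A x.val := by
  have hp : Function.Periodic A (q : ℤ) := hA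
  constructor
  · intro m
    have h1 : (((m : ZMod q).val : ℤ)) = m % q := ZMod.val_intCast m
    rw [h1]
    conv_lhs => rw [← Int.emod_add_mul_ediv m q, mul_comm]
    exact hp.int_mul _ _
  · symm
    refine Finset.sum_nbij' (fun x => x.val) (fun i => (i : ZMod q)) ?_ ?_ ?_ ?_ ?_
    · intro x _; simpa using ZMod.val_lt x
    · intro i _; simp
    · intro x _; simp
    · intro i hi; exact ZMod.val_cast_of_lt (by simpa using hi)
    · intro x _; rfl

lemma sum_orbit {A : ℤ → ℝ} {q : ℕ} (hq : 0 < q) (hA : ∀ n, A (n + q) = A n) {p : ℤ}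
    (hcop : IsCoprime p (q : ℤ)) (n : ℤ) :
    ∑ i ∈ Finset.range q, A (n + i * p) = ∑ i ∈ Finset.range q, A i := by
  have : NeZero q := ⟨hq.ne'⟩
  obtain ⟨h1, h2⟩ := sum_zmod hA
  rw [h2]
  have hA' : ∀ m, (fun i : ℤ => A (n + i * p)) (m + q) = (fun i : ℤ => A (n + i * p)) m := by
    intro m
    have hp : Function.Periodic A (q : ℤ) := hA
    simp only
    rw [show n + (m + (q : ℤ)) * p = n + m * p + p * q by ring]
    exact hp.int_mul _ _
  have h4 : ∑ i ∈ Finset.range q, A (n + i * p) = ∑ x : ZMod q, A (n + x.val * p) :=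
    (sum_zmod (A := fun i : ℤ => A (n + i * p)) hA').2
  rw [h4]
  obtain ⟨u, v, huv⟩ := hcop
  have hu : (u : ZMod q) * p = 1 := by
    have := congrArg (fun k : ℤ => (k : ZMod q)) huv
    simpa using this
  refine Finset.sum_nbij' (fun x => n + x * p) (fun y => (y - n) * u) ?_ ?_ ?_ ?_ ?_
  · intro x _; simp
  · intro x _; simp
  · intro x _; linear_combination x * hu
  · intro y _; linear_combination (y - n) * hu
  · intro x _
    rw [h1]
    congr 1
    push_cast
    simp

namespace CycOrbit
variable {f : ℝ → ℝ} {p : ℤ} {q : ℕ} {z : ℤ → ℝ} {L : ℝ}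

lemma q_pos (h : CycOrbit f p q z) : 0 < q := by have := h.three_le; omega

lemma gap_pos (h : CycOrbit f p q z) (n : ℤ) : 0 < gap z n :=
  sub_pos.mpr (h.mono (by omega))

lemma gap_le (h : CycOrbit f p q z) (n : ℤ) : gap z n ≤ gap z 0 := by
  have := h.max n; simpa [gap] using this

lemma gap_per (h : CycOrbit f p q z) (n : ℤ) : gap z (n + q) = gap z n := by
  unfold gap
  rw [show n + (q : ℤ) + 1 = n + 1 + q by ring, h.per, h.per]; ring

lemma gap_per_int (h : CycOrbit f p q z) (n k : ℤ) : gap z (n + k * q) = gap z n :=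
  (show Function.Periodic (gap z) (q : ℤ) from h.gap_per).int_mul k n

lemma sum_gap_range (h : CycOrbit f p q z) : ∑ i ∈ Finset.range q, gap z i = 1 := by
  have : ∀ m : ℕ, ∑ i ∈ Finset.range m, gap z i = z m - z 0 := by
    intro m
    induction m with
    | zero => simp
    | succ m ih => rw [Finset.sum_range_succ, ih, gap]; push_cast; ring
  rw [this]
  have := h.per 0
  rw [zero_add] at this; rw [this]; ring

lemma sum_gap (h : CycOrbit f p q z) (n : ℤ) :
    ∑ i ∈ Finset.range q, gap z (n + i * p) = 1 := by
  rw [sum_orbit h.q_pos h.gap_per h.cop, h.sum_gap_range]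

lemma sum_gap_neg (h : CycOrbit f p q z) (n : ℤ) :
    ∑ i ∈ Finset.range q, gap z (n + i * (-p)) = 1 := by
  rw [sum_orbit h.q_pos h.gap_per h.cop.neg_left, h.sum_gap_range]

lemma sum_gap_two (h : CycOrbit f p q z) (n : ℤ) {l : ℕ} (hl : l ≤ 2 * q) :
    ∑ i ∈ Finset.range l, gap z (n + i * p) ≤ 2 := by
  calc ∑ i ∈ Finset.range l, gap z (n + i * p)
      ≤ ∑ i ∈ Finset.range (q + q), gap z (n + i * p) :=
        Finset.sum_le_sum_of_subset_of_nonneg (by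
          intro x hx; simp at *; omega) (fun i _ _ => (h.gap_pos _).le)
    _ = ∑ i ∈ Finset.range q, gap z (n + i * p) + ∑ i ∈ Finset.range q, gap z (n + q * p + i * p) := by
        rw [Finset.sum_range_add]
        congr 1
        refine Finset.sum_congr rfl fun i _ => ?_
        congr 1; push_cast; ring
    _ ≤ 2 := by rw [h.sum_gap, h.sum_gap]; norm_num

lemma one_le_q_mul (h : CycOrbit f p q z) : 1 ≤ q * gap z 0 := by
  rw [← h.sum_gap 0]
  refine (Finset.sum_le_card_nsmul _ _ _ fun i _ => h.gap_le _).trans ?_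
  simp

lemma gap_zero_le_one (h : CycOrbit f p q z) : gap z 0 ≤ 1 := by
  rw [← h.sum_gap_range]
  exact Finset.single_le_sum (f := fun i : ℕ => gap z i) (fun i _ => (h.gap_pos _).le)
    (Finset.mem_range.mpr h.q_pos)

/-- Every index is reached from a given one along the orbit. -/
lemma exists_rep (h : CycOrbit f p q z) (m n : ℤ) : ∃ i < q, ∃ k : ℤ, n = m + i * p + k * q := by
  obtain ⟨b, c, hb1, hbq, e⟩ := exists_bezout h.cop h.q_pos (n - m)
  rcases hbq.lt_or_eq with hlt | rfl
  · exact ⟨b, hlt, c, by linarith⟩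
  · exact ⟨0, h.q_pos, c + p, by push_cast; linarith⟩

lemma log_iter (hf : IsCircleDiffeoLift f) (l : ℕ) (x : ℝ) :
    Real.log (deriv f^[l] x) = ∑ i ∈ Finset.range l, Real.log (deriv f (f^[i] x)) := by
  induction l with
  | zero => simp
  | succ l ih =>
    rw [Finset.sum_range_succ, ← ih]
    have : f^[l + 1] = fun x => f (f^[l] x) := funext fun x => Function.iterate_succ_apply' f l x
    rw [this, hf.deriv_comp (hf.iter l), Real.log_mul (hf.pos _).ne' ((hf.iter l).pos _).ne', add_comm]

lemma log_iter_sub (hf : IsCircleDiffeoLift f) (hL : LogLip f L) (l : ℕ) (x y : ℝ) :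
    |Real.log (deriv f^[l] x) - Real.log (deriv f^[l] y)| ≤
      L * ∑ i ∈ Finset.range l, |f^[i] x - f^[i] y| := by
  rw [log_iter hf, log_iter hf, ← Finset.sum_sub_distrib, Finset.mul_sum]
  exact (Finset.abs_sum_le_sum_abs _ _).trans (Finset.sum_le_sum fun i _ => hL _ _)

lemma sub_eq_sum_gap (n : ℤ) (s : ℕ) : z (n + s) - z n = ∑ k ∈ Finset.range s, gap z (n + k) := by
  induction s with
  | zero => simp
  | succ s ih => rw [Finset.sum_range_succ, ← ih, gap]; push_cast; rw [add_assoc]; ring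

lemma iter_mem (hf : IsCircleDiffeoLift f) (h : CycOrbit f p q z) {n m : ℤ} {x : ℝ}
    (hx : x ∈ Set.Icc (z n) (z m)) (i : ℕ) :
    f^[i] x ∈ Set.Icc (z (n + i * p)) (z (m + i * p)) := by
  rw [← h.iter, ← h.iter]
  exact ⟨(hf.iter i).strictMono.monotone hx.1, (hf.iter i).strictMono.monotone hx.2⟩

lemma distortion (hf : IsCircleDiffeoLift f) (h : CycOrbit f p q z) (hL : LogLip f L) (hL0 : 0 ≤ L)
    {n : ℤ} {s l : ℕ} (hl : l ≤ 2 * q) {x y : ℝ} (hx : x ∈ Set.Icc (z n) (z (n + s)))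
    (hy : y ∈ Set.Icc (z n) (z (n + s))) :
    |Real.log (deriv f^[l] x) - Real.log (deriv f^[l] y)| ≤ 2 * s * L := by
  refine (log_iter_sub hf hL l x y).trans ?_
  rw [mul_comm]
  refine mul_le_mul_of_nonneg_right ?_ hL0
  have h1 : ∀ i ∈ Finset.range l, |f^[i] x - f^[i] y| ≤
      ∑ k ∈ Finset.range s, gap z (n + k + i * p) := by
    intro i _
    have hx' := h.iter_mem hf hx i
    have hy' := h.iter_mem hf hy i
    have := sub_eq_sum_gap (z := z) (n + i * p) s
    rw [show n + i * p + (s : ℤ) = n + s + i * p by ring] at this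
    have e : ∑ k ∈ Finset.range s, gap z (n + k + i * p) = z (n + s + i * p) - z (n + i * p) := by
      rw [this]
      exact Finset.sum_congr rfl fun k _ => by congr 1; ring
    rw [e, abs_le]
    constructor <;> linarith [hx'.1, hx'.2, hy'.1, hy'.2]
  refine (Finset.sum_le_sum h1).trans ?_
  rw [Finset.sum_comm]
  refine (Finset.sum_le_card_nsmul _ _ 2 fun k _ => h.sum_gap_two _ hl).trans ?_
  simp; linarith

lemma exists_mvt (hf : IsCircleDiffeoLift f) (h : CycOrbit f p q z) (n : ℤ) (i : ℕ) :
    ∃ ξ ∈ Set.Icc (z n) (z (n + 1)), deriv f^[i] ξ * gap z n = gap z (n + i * p) := by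
  obtain ⟨ξ, hξ, e⟩ := exists_deriv_eq_slope f^[i] (h.mono (show n < n + 1 by omega))
    (hf.iter i).cont.continuousOn (hf.iter i).smooth.diff.differentiableOn
  refine ⟨ξ, ⟨hξ.1.le, hξ.2.le⟩, ?_⟩
  rw [e, h.iter, h.iter, gap, div_mul_cancel₀ _ (sub_ne_zero.mpr (h.mono (show n < n + 1 by omega)).ne'),
    gap]
  congr 2; ring

lemma le_exp_mul {a b c : ℝ} (ha : 0 < a) (hb : 0 < b) (h : |Real.log a - Real.log b| ≤ c) :
    a ≤ Real.exp c * b := by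
  have := (abs_le.mp h).2
  rw [← Real.exp_log ha, ← Real.exp_log hb, Real.log_exp, Real.log_exp] at *
  rw [← Real.exp_add, Real.exp_le_exp]; linarith

lemma deriv_iter_le (hf : IsCircleDiffeoLift f) (h : CycOrbit f p q z) (hL : LogLip f L)
    (hL0 : 0 ≤ L) {n : ℤ} {l : ℕ} (hl : l ≤ 2 * q) {x : ℝ} (hx : x ∈ Set.Icc (z n) (z (n + 1))) :
    deriv f^[l] x * gap z n ≤ Real.exp (2 * L) * gap z (n + l * p) := by
  obtain ⟨ξ, hξ, e⟩ := h.exists_mvt hf n l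
  have := h.distortion hf hL hL0 (n := n) (s := 1) hl hx hξ
  have h2 := le_exp_mul ((hf.iter l).pos x) ((hf.iter l).pos ξ) this
  rw [← e, ← mul_assoc]
  simp only [Nat.cast_one, mul_one] at h2
  exact mul_le_mul_of_nonneg_right h2 (h.gap_pos n).le

lemma le_deriv_iter (hf : IsCircleDiffeoLift f) (h : CycOrbit f p q z) (hL : LogLip f L)
    (hL0 : 0 ≤ L) {n : ℤ} {l : ℕ} (hl : l ≤ 2 * q) {x : ℝ} (hx : x ∈ Set.Icc (z n) (z (n + 1))) :
    gap z (n + l * p) ≤ Real.exp (2 * L) * (deriv f^[l] x * gap z n) := by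
  obtain ⟨ξ, hξ, e⟩ := h.exists_mvt hf n l
  have := h.distortion hf hL hL0 (n := n) (s := 1) hl hξ hx
  have h2 := le_exp_mul ((hf.iter l).pos ξ) ((hf.iter l).pos x) this
  rw [← e, ← mul_assoc]
  simp only [Nat.cast_one, mul_one] at h2
  exact mul_le_mul_of_nonneg_right h2 (h.gap_pos n).le

lemma exists_min (h : CycOrbit f p q z) : ∃ m, ∀ n, gap z m ≤ gap z n := by
  obtain ⟨m, hm⟩ := int_per_max (u := fun n => - gap z n) h.q_pos (fun n => by simp only [h.gap_per])
  exact ⟨m, fun n => by have := hm n; linarith⟩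

lemma gap_le_succ (hf : IsCircleDiffeoLift f) (h : CycOrbit f p q z) (hL : LogLip f L)
    (hL0 : 0 ≤ L) (n : ℤ) : gap z n ≤ Real.exp (4 * L) * gap z (n + 1) := by
  obtain ⟨m, hm⟩ := h.exists_min
  obtain ⟨i, hi, k, e⟩ := h.exists_rep m n
  obtain ⟨ξ, hξ, e1⟩ := h.exists_mvt hf m i
  obtain ⟨η, hη, e2⟩ := h.exists_mvt hf (m + 1) i
  have e3 : gap z n = gap z (m + i * p) := by rw [e, h.gap_per_int]
  have e4 : gap z (n + 1) = gap z (m + 1 + i * p) := by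
    rw [e, show m + i * p + k * q + 1 = m + 1 + i * p + k * q by ring, h.gap_per_int]
  have hd := h.distortion hf hL hL0 (n := m) (s := 2) (l := i) (by omega) (x := ξ) (y := η)
    ⟨hξ.1, hξ.2.trans (h.mono.monotone (by push_cast; omega))⟩
    ⟨(h.mono.monotone (by omega)).trans hη.1, hη.2.trans (h.mono.monotone (by push_cast; omega))⟩
  have h2 := le_exp_mul ((hf.iter i).pos ξ) ((hf.iter i).pos η) hd
  rw [e3, e4, ← e1, ← e2]
  calc deriv f^[i] ξ * gap z m ≤ (Real.exp (2 * (2 : ℕ) * L) * deriv f^[i] η) * gap z (m + 1) :=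
        mul_le_mul h2 (hm _) (h.gap_pos m).le (by have := (hf.iter i).pos η; positivity)
    _ = _ := by rw [mul_assoc]; congr 2; push_cast; ring

lemma gap_succ_le (hf : IsCircleDiffeoLift f) (h : CycOrbit f p q z) (hL : LogLip f L)
    (hL0 : 0 ≤ L) (n : ℤ) : gap z (n + 1) ≤ Real.exp (4 * L) * gap z n := by
  obtain ⟨m, hm⟩ := h.exists_min
  obtain ⟨i, hi, k, e⟩ := h.exists_rep (m - 1) n
  obtain ⟨ξ, hξ, e1⟩ := h.exists_mvt hf m i
  obtain ⟨η, hη, e2⟩ := h.exists_mvt hf (m - 1) i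
  have e3 : gap z n = gap z (m - 1 + i * p) := by rw [e, h.gap_per_int]
  have e4 : gap z (n + 1) = gap z (m + i * p) := by
    rw [e, show m - 1 + i * p + k * q + 1 = m + i * p + k * q by ring, h.gap_per_int]
  have hd := h.distortion hf hL hL0 (n := m - 1) (s := 2) (l := i) (by omega) (x := ξ) (y := η)
    ⟨(h.mono.monotone (by omega)).trans hξ.1, hξ.2.trans (h.mono.monotone (by push_cast; omega))⟩
    ⟨hη.1, hη.2.trans (h.mono.monotone (by push_cast; omega))⟩
  have h2 := le_exp_mul ((hf.iter i).pos ξ) ((hf.iter i).pos η) hd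
  rw [e3, e4, ← e1, ← e2]
  calc deriv f^[i] ξ * gap z m ≤ (Real.exp (2 * (2 : ℕ) * L) * deriv f^[i] η) * gap z (m - 1) :=
        mul_le_mul h2 (hm _) (h.gap_pos m).le (by have := (hf.iter i).pos η; positivity)
    _ = _ := by rw [mul_assoc]; congr 2; push_cast; ring

/-- If `Q` is a record for `p / q`, then the gap at `-Qp` is comparable to the largest gap. -/
lemma gap_record (hf : IsCircleDiffeoLift f) (h : CycOrbit f p q z) (hL : LogLip f L)
    (hL0 : 0 ≤ L) {Q : ℕ} (hQ : 2 ≤ Q) {m₀ : ℤ}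
    (hrec : ∀ i : ℕ, 0 < i → i < Q → ∀ m : ℤ, |Q * p - q * m₀| < |i * p - q * m|) :
    gap z 0 ≤ Real.exp L * gap z (Q * (-p)) := by
  set D : ℤ := Q * p - q * m₀ with hD
  have hq := h.q_pos
  have hq' : (0 : ℤ) < q := by exact_mod_cast hq
  have hDq : |D| < q := by
    refine (hrec 1 one_pos (by omega) (p / q)).trans ?_
    have h1 := Int.emod_nonneg p hq'.ne'
    have h2 := Int.emod_lt_of_pos p hq'
    have h3 := Int.emod_add_mul_ediv p q
    push_cast
    rw [one_mul, show p - q * (p / q) = p % q by linarith, abs_of_nonneg h1]; exact h2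
  obtain ⟨ξ, hξ, e1⟩ := h.exists_mvt hf 0 Q
  obtain ⟨η, hη, e2⟩ := h.exists_mvt hf (-D) Q
  have g1 : gap z (0 + Q * p) ≤ gap z 0 := h.gap_le _
  have g2 : gap z (-D + Q * p) = gap z 0 := by
    rw [show -D + Q * p = 0 + m₀ * q by rw [hD]; ring, h.gap_per_int]
  have g3 : gap z (-D) = gap z (Q * (-p)) := by
    rw [show -D = Q * (-p) + m₀ * q by rw [hD]; ring, h.gap_per_int]
  rw [← e1] at g1
  rw [← e2] at g2
  rw [← g3]
  set s : ℤ := min 0 (-D) with hs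
  set w : ℕ := D.natAbs + 1 with hw
  have hsw : s + w = Max.max 0 (-D) + 1 := by rw [hs, hw]; omega
  have hsum : ∑ i ∈ Finset.range Q, |f^[i] η - f^[i] ξ| ≤ 1 := by
    have hb : ∀ i ∈ Finset.range Q, |f^[i] η - f^[i] ξ| ≤
        ∑ k ∈ Finset.range w, gap z (s + k + i * p) := by
      intro i _
      have hx : ξ ∈ Set.Icc (z s) (z (s + w)) :=
        ⟨(h.mono.monotone (by omega)).trans hξ.1, hξ.2.trans (h.mono.monotone (by omega))⟩
      have hy : η ∈ Set.Icc (z s) (z (s + w)) :=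
        ⟨(h.mono.monotone (by omega)).trans hη.1, hη.2.trans (h.mono.monotone (by omega))⟩
      have hx' := h.iter_mem hf hx i
      have hy' := h.iter_mem hf hy i
      have := sub_eq_sum_gap (z := z) (s + i * p) w
      rw [show s + i * p + (w : ℤ) = s + w + i * p by ring] at this
      have e : ∑ k ∈ Finset.range w, gap z (s + k + i * p) = z (s + w + i * p) - z (s + i * p) := by
        rw [this]
        exact Finset.sum_congr rfl fun k _ => by congr 1; ring
      rw [e, abs_le]
      constructor <;> linarith [hx'.1, hx'.2, hy'.1, hy'.2]
    refine (Finset.sum_le_sum hb).trans ?_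
    have : NeZero q := ⟨hq.ne'⟩
    obtain ⟨hz1, hz2⟩ := sum_zmod (q := q) h.gap_per
    rw [← h.sum_gap_range, hz2, ← Finset.sum_product']
    have hinj : Set.InjOn (fun x : ℕ × ℕ => ((s + x.2 + x.1 * p : ℤ) : ZMod q))
        (Finset.range Q ×ˢ Finset.range w : Finset (ℕ × ℕ)) := by
      rintro ⟨i, k⟩ hik ⟨i', k'⟩ hik' hee
      simp only [Finset.coe_product, Finset.coe_range, Set.mem_prod, Set.mem_Iio] at hik hik'
      simp only at hee
      rw [ZMod.intCast_eq_intCast_iff_dvd_sub] at hee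
      obtain ⟨c, hc⟩ := hee
      have hkk : |(k : ℤ) - k'| ≤ |D| := by
        rw [abs_le]; rw [hw] at hik hik'
        have := Int.natCast_natAbs D
        omega
      rcases lt_trichotomy i i' with hlt | rfl | hlt
      · exfalso
        have := hrec (i' - i) (by omega) (by omega) c
        rw [Nat.cast_sub hlt.le] at this
        rw [show ((i' : ℤ) - i) * p - q * c = (k - k') by linarith] at this
        omega
      · have : (k : ℤ) - k' = q * (-c) := by linarith
        have hc0 : c = 0 := by
          by_contra hc0
          have h5 : (q : ℤ) ≤ |(k : ℤ) - k'| := by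
            rw [this, abs_mul, abs_neg, abs_of_pos hq']
            exact le_mul_of_one_le_right hq'.le (Int.one_le_abs hc0)
          omega
        rw [hc0] at this
        simp at this
        have : k = k' := by omega
        rw [this]
      · exfalso
        have := hrec (i - i') (by omega) (by omega) (-c)
        rw [Nat.cast_sub hlt.le] at this
        rw [show ((i : ℤ) - i') * p - q * (-c) = (k' - k) by linarith, abs_sub_comm (k' : ℤ)] at this
        omega
    calc ∑ x ∈ Finset.range Q ×ˢ Finset.range w, gap z (s + x.2 + x.1 * p)
        = ∑ x ∈ Finset.range Q ×ˢ Finset.range w, gap z (((s + x.2 + x.1 * p : ℤ) : ZMod q).val) :=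
          Finset.sum_congr rfl fun x _ => hz1 _
      _ = ∑ y ∈ (Finset.range Q ×ˢ Finset.range w).image
            (fun x : ℕ × ℕ => ((s + x.2 + x.1 * p : ℤ) : ZMod q)), gap z y.val :=
          (Finset.sum_image (f := fun y : ZMod q => gap z y.val) hinj).symm
      _ ≤ _ := Finset.sum_le_sum_of_subset_of_nonneg (Finset.subset_univ _)
          fun i _ _ => (h.gap_pos _).le
  have hd := (log_iter_sub hf hL Q η ξ).trans (mul_le_of_le_one_right hL0 hsum)
  have h2 := le_exp_mul ((hf.iter Q).pos η) ((hf.iter Q).pos ξ) hd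
  have p0 := h.gap_pos 0
  have pD := h.gap_pos (-D)
  have h3 : deriv f^[Q] ξ ≤ 1 := by
    by_contra! hlt; nlinarith
  calc gap z 0 = deriv f^[Q] η * gap z (-D) := g2.symm
    _ ≤ (Real.exp L * 1) * gap z (-D) := by
        refine mul_le_mul_of_nonneg_right (h2.trans ?_) pD.le
        exact mul_le_mul_of_nonneg_left h3 (Real.exp_pos _).le
    _ = _ := by rw [mul_one]

end CycOrbit

/-- `Q` is a best approximation denominator of `a`, with numerator `m₀`. -/
def IsRecord (a : ℝ) (Q : ℕ) (m₀ : ℤ) : Prop :=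
  2 ≤ Q ∧ ∀ i : ℕ, 0 < i → i < Q → ∀ m : ℤ, |Q * a - m₀| < |i * a - m|

lemma exists_record {a : ℝ} (ha : Irrational a) (B : ℕ) : ∃ Q > B, ∃ m₀, IsRecord a Q m₀ := by
  have hpos : ∀ i : ℕ, 0 < i → 0 < |(i : ℝ) * a - round ((i : ℝ) * a)| := fun i hi => by
    rw [abs_pos, sub_ne_zero]
    exact (ha.natCast_mul hi.ne').ne_int _
  obtain ⟨μ, hμ0, hμ⟩ : ∃ μ > 0, ∀ i : ℕ, 0 < i → i ≤ B + 1 → ∀ m : ℤ, μ ≤ |(i : ℝ) * a - m| := by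
    obtain ⟨i₀, hi₀, hmin⟩ := Finset.exists_min_image (Finset.Icc 1 (B + 1))
      (fun i : ℕ => |(i : ℝ) * a - round ((i : ℝ) * a)|) ⟨1, by simp⟩
    refine ⟨_, hpos i₀ (by simp at hi₀; omega), fun i hi hiB m => ?_⟩
    exact (hmin i (by simp; omega)).trans (round_le _ m)
  have hex : ∃ Q : ℕ, 0 < Q ∧ ∃ m : ℤ, |(Q : ℝ) * a - m| < μ := by
    obtain ⟨n, hn⟩ := exists_nat_one_div_lt hμ0
    obtain ⟨j, k, hk0, _, hk⟩ := Real.exists_int_int_abs_mul_sub_le a (n := n + 1) (by omega)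
    refine ⟨k.toNat, by omega, j, ?_⟩
    have : ((k.toNat : ℤ) : ℝ) = k := by rw [Int.toNat_of_nonneg hk0.le]
    rw [Int.cast_natCast] at this
    rw [this]
    refine lt_of_le_of_lt hk (lt_of_le_of_lt ?_ hn)
    push_cast
    exact one_div_le_one_div_of_le (by positivity) (by linarith)
  classical
  obtain ⟨hQ0, m₀, hm₀⟩ := Nat.find_spec hex
  have hQB : B + 1 < Nat.find hex := by
    by_contra! hle
    exact absurd hm₀ (not_lt.mpr (hμ _ hQ0 hle m₀))
  refine ⟨Nat.find hex, by omega, m₀, by omega, fun i hi hiQ m => ?_⟩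
  refine lt_of_lt_of_le hm₀ ?_
  by_contra! hlt
  exact Nat.find_min hex hiQ ⟨hi, m, hlt⟩

lemma IsRecord.eventually {a : ℝ} {Q : ℕ} {m₀ : ℤ} (h : IsRecord a Q m₀) :
    ∀ᶠ x : ℝ in 𝓝 a, IsRecord x Q m₀ := by
  have : ∀ i ∈ Finset.range Q, ∀ᶠ x : ℝ in 𝓝 a, 0 < i → ∀ m : ℤ, |Q * x - m₀| < |i * x - m| := by
    intro i hi
    rcases Nat.eq_zero_or_pos i with rfl | hi0
    · exact Eventually.of_forall fun x hx => absurd hx (by omega)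
    · have h1 : Tendsto (fun x : ℝ => |Q * x - m₀| + i * |x - a|) (𝓝 a) (𝓝 (|Q * a - m₀| + i * |a - a|)) := by
        apply Continuous.tendsto; fun_prop
      have h2 := h.2 i hi0 (by simpa using hi) (round ((i : ℝ) * a))
      filter_upwards [h1.eventually (gt_mem_nhds (by simpa using h2))] with x hx _ m
      have h3 := round_le ((i : ℝ) * a) m
      have h4 : |(i : ℝ) * a - m| ≤ |i * x - m| + i * |x - a| := by
        have : (i : ℝ) * a - m = (i * x - m) - i * (x - a) := by ring
        rw [this]
        refine (abs_sub _ _).trans ?_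
        rw [abs_mul, Nat.abs_cast]
      linarith
  filter_upwards [(Filter.eventually_all_finset _).mpr this] with x hx
  exact ⟨h.1, fun i hi hiQ m => hx i (by simpa using hiQ) hi m⟩

/-- The largest gap tends to zero as the combinatorics approach an irrational number. -/
lemma max_gap_small {a : ℝ} (ha : Irrational a) {L : ℝ} (hL0 : 0 ≤ L) {η : ℝ} (hη : 0 < η) :
    ∃ γ > 0, ∃ q₀ : ℕ, ∀ f p q z, IsCircleDiffeoLift f → LogLip f L → CycOrbit f p q z → q₀ ≤ q →
      |(p / q : ℝ) - a| < γ → gap z 0 ≤ η := by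
  obtain ⟨N, hN⟩ := exists_nat_gt (Real.exp L / η)
  have hinf : {Q : ℕ | ∃ m₀, IsRecord a Q m₀}.Infinite :=
    Set.infinite_of_forall_exists_gt fun B => by
      obtain ⟨Q, hQ, h⟩ := exists_record ha B
      exact ⟨Q, h, hQ⟩
  obtain ⟨R, hR, hcard⟩ := hinf.exists_subset_card_eq N
  have hR' : ∀ Q ∈ R, ∃ m₀, IsRecord a Q m₀ := fun Q hQ => hR hQ
  choose! m hm using hR'
  have hev : ∀ᶠ x : ℝ in 𝓝 a, ∀ Q ∈ R, IsRecord x Q (m Q) :=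
    (Filter.eventually_all_finset _).mpr fun Q hQ => (hm Q hQ).eventually
  obtain ⟨γ, hγ, hball⟩ := Metric.eventually_nhds_iff.mp hev
  refine ⟨γ, hγ, R.sup id + 1, fun f p q z hf hL hz hq hpq => ?_⟩
  have hrec := hball (y := (p / q : ℝ)) (by rwa [Real.dist_eq])
  have hqr : (0 : ℝ) < q := by exact_mod_cast hz.q_pos
  have h1 : ∀ Q ∈ R, gap z 0 ≤ Real.exp L * gap z (Q * (-p)) := by
    intro Q hQ
    obtain ⟨h2, h3⟩ := hrec Q hQ
    refine hz.gap_record hf hL hL0 h2 (m₀ := m Q) fun i hi hiQ k => ?_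
    have := h3 i hi hiQ k
    have e : ∀ (j : ℕ) (k : ℤ), |(j : ℝ) * (p / q) - k| * q = |((j * p - q * k : ℤ) : ℝ)| := by
      intro j k
      rw [← abs_of_pos hqr, ← abs_mul, abs_of_pos hqr]
      congr 1; push_cast; field_simp
    have h5 := mul_lt_mul_of_pos_right this hqr
    rw [e, e] at h5
    exact_mod_cast h5
  have h2 : N * gap z 0 ≤ Real.exp L * 1 := by
    rw [← hz.sum_gap_neg 0, Finset.mul_sum]
    calc N * gap z 0 = ∑ Q ∈ R, gap z 0 := by rw [Finset.sum_const, hcard, nsmul_eq_mul]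
      _ ≤ ∑ Q ∈ R, Real.exp L * gap z (0 + Q * (-p)) :=
          Finset.sum_le_sum fun Q hQ => by rw [zero_add]; exact h1 Q hQ
      _ ≤ _ := Finset.sum_le_sum_of_subset_of_nonneg (fun Q hQ => by
          have : id Q ≤ R.sup id := Finset.le_sup hQ
          simp only [id] at this
          simp; omega) fun i _ _ => by have := hz.gap_pos (0 + i * (-p)); positivity
  have hNpos : 0 < (N : ℝ) := lt_trans (by positivity) hN
  rw [div_lt_iff₀ hη] at hN
  by_contra! hlt
  nlinarith

/-- The nonlinearity `f'' / f'`. -/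
def nonlin (f : ℝ → ℝ) : ℝ → ℝ := fun x => deriv (deriv f) x * (deriv f x)⁻¹

/-- The Schwarzian derivative. -/
def schwarz (f : ℝ → ℝ) : ℝ → ℝ := fun x => deriv (nonlin f) x - nonlin f x ^ 2 / 2

namespace IsCircleDiffeoLift
variable {f g : ℝ → ℝ}

lemma smooth_nonlin (h : IsCircleDiffeoLift f) : Smooth (nonlin f) :=
  h.smooth.deriv.deriv.mul (h.smooth.deriv.inv fun x => (h.pos x).ne')

lemma smooth_schwarz (h : IsCircleDiffeoLift f) : Smooth (schwarz f) :=
  h.smooth_nonlin.deriv.sub ((h.smooth_nonlin.pow 2).div_const 2)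

lemma per_nonlin (h : IsCircleDiffeoLift f) : Per (nonlin f) := fun x => by
  unfold nonlin; rw [h.per_deriv x, h.per_deriv.deriv x]

lemma per_schwarz (h : IsCircleDiffeoLift f) : Per (schwarz f) := fun x => by
  unfold schwarz; rw [h.per_nonlin x, h.per_nonlin.deriv x]

lemma deriv_deriv_eq (h : IsCircleDiffeoLift f) (x : ℝ) :
    deriv (deriv f) x = deriv f x * nonlin f x := by
  unfold nonlin; have := (h.pos x).ne'; field_simp

lemma nonlin_comp (h : IsCircleDiffeoLift f) (h' : IsCircleDiffeoLift g) (x : ℝ) :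
    nonlin (fun x => f (g x)) x = nonlin f (g x) * deriv g x + nonlin g x := by
  have e : deriv (fun x => f (g x)) = fun x => deriv f (g x) * deriv g x :=
    funext fun x => deriv_comp h h' x
  have e2 : deriv (deriv (fun x => f (g x))) x =
      deriv (deriv f) (g x) * deriv g x * deriv g x + deriv f (g x) * deriv (deriv g) x := by
    rw [e]
    exact (((h.smooth.deriv.hasDerivAt (g x)).comp x (h'.smooth.hasDerivAt x)).mul
      (h'.smooth.deriv.hasDerivAt x)).deriv
  unfold nonlin
  rw [e2, e]
  have := (h.pos (g x)).ne'
  have := (h'.pos x).ne'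
  field_simp

lemma schwarz_comp (h : IsCircleDiffeoLift f) (h' : IsCircleDiffeoLift g) (x : ℝ) :
    schwarz (fun x => f (g x)) x = schwarz f (g x) * deriv g x ^ 2 + schwarz g x := by
  have e : nonlin (fun x => f (g x)) = fun x => nonlin f (g x) * deriv g x + nonlin g x :=
    funext fun x => nonlin_comp h h' x
  have e2 : deriv (nonlin (fun x => f (g x))) x =
      deriv (nonlin f) (g x) * deriv g x * deriv g x + nonlin f (g x) * deriv (deriv g) x
        + deriv (nonlin g) x := by
    rw [e]
    exact ((((h.smooth_nonlin.hasDerivAt (g x)).comp x (h'.smooth.hasDerivAt x)).mul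
      (h'.smooth.deriv.hasDerivAt x)).add (h'.smooth_nonlin.hasDerivAt x)).deriv
  unfold schwarz
  rw [e2, e, h'.deriv_deriv_eq]
  ring

lemma iter_succ_eq (l : ℕ) : f^[l + 1] = fun x => f (f^[l] x) :=
  funext fun x => Function.iterate_succ_apply' f l x

lemma iter_add_eq (l k : ℕ) : f^[l + k] = fun x => f^[l] (f^[k] x) :=
  funext fun x => Function.iterate_add_apply f l k x

lemma schwarz_iter (h : IsCircleDiffeoLift f) (l : ℕ) (x : ℝ) :
    schwarz f^[l] x = ∑ i ∈ Finset.range l, schwarz f (f^[i] x) * deriv f^[i] x ^ 2 := by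
  induction l with
  | zero =>
    have : nonlin (id : ℝ → ℝ) = fun _ => 0 := by
      funext y; simp [nonlin]
    simp [schwarz, this]
  | succ l ih =>
    rw [Finset.sum_range_succ, ← ih, iter_succ_eq, schwarz_comp h (h.iter l), add_comm]

lemma deriv_nonlin (f : ℝ → ℝ) (x : ℝ) :
    deriv (nonlin f) x = schwarz f x + nonlin f x * nonlin f x * (1 / 2) := by
  unfold schwarz; ring

end IsCircleDiffeoLift

/-- Uniform control on `f` through quantities that only depend on `f'`. -/
structure Ctrl (L : ℝ) (Cs : ℕ → ℝ) (f : ℝ → ℝ) : Prop where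
  lift : IsCircleDiffeoLift f
  L_nonneg : 0 ≤ L
  logLip : LogLip f L
  schwarz : ∀ j, Bd Set.univ j 1 (Cs j) (schwarz f)

lemma Bd.exp_type (j : ℕ) (C : ℝ) : ∃ C' : ℝ, 1 ≤ C' ∧ ∀ (U : Set ℝ) (l E : ℝ) (e w : ℝ → ℝ), 0 ≤ l →
    0 ≤ E → Smooth e → Smooth w → (∀ x, deriv e x = e x * w x) → Bd U j l (C * l) w →
    (∀ x ∈ U, |e x| ≤ E) → Bd U j l (C' * E) e := by
  induction j with
  | zero =>
    refine ⟨1, le_rfl, fun U l E e w hl hE he hw hd hb h0 => Bd.zero_iff.mpr fun x hx => ?_⟩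
    rw [one_mul]; exact h0 x hx
  | succ j ih =>
    obtain ⟨C', hC1, h⟩ := ih
    refine ⟨max C' (2 ^ j * (C' * C)), hC1.trans (le_max_left _ _),
      fun U l E e w hl hE he hw hd hb h0 => Bd.succ_iff.mpr ⟨fun x hx => (h0 x hx).trans ?_, ?_⟩⟩
    · exact le_mul_of_one_le_left hE (hC1.trans (le_max_left _ _))
    · have h1 := h U l E e w hl hE he hw hd (hb.mono_order (by omega)) h0
      rw [show deriv e = fun x => e x * w x from funext hd]
      refine (Bd.mul hl he hw h1 (hb.mono_order (by omega))).mono_const hl ?_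
      calc 2 ^ j * (C' * E * (C * l)) = 2 ^ j * (C' * C) * (E * l) := by ring
        _ ≤ max C' (2 ^ j * (C' * C)) * (E * l) :=
            mul_le_mul_of_nonneg_right (le_max_right _ _) (by positivity)
        _ = _ := by ring

namespace CycOrbit
variable {f : ℝ → ℝ} {p : ℤ} {q : ℕ} {z : ℤ → ℝ} {L : ℝ} {Cs : ℕ → ℝ}

/-- The closed `n`-th gap. -/
abbrev J (z : ℤ → ℝ) (n : ℤ) : Set ℝ := Set.Icc (z n) (z (n + 1))

lemma exists_mem (h : CycOrbit f p q z) (x : ℝ) : ∃ n, x ∈ J z n := by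
  have h0 : ∃ n, z n ≤ x := by
    refine ⟨0 + ⌊x - z 0⌋ * q, ?_⟩
    rw [h.per_int]; linarith [Int.floor_le (x - z 0)]
  have hb : ∃ b : ℤ, ∀ n, z n ≤ x → n ≤ b := by
    refine ⟨0 + (⌊x - z 0⌋ + 1) * q, fun n hn => ?_⟩
    by_contra! hlt
    have := h.mono hlt
    rw [h.per_int] at this
    push_cast at this
    linarith [Int.lt_floor_add_one (x - z 0)]
  obtain ⟨n, hn, hmax⟩ := Int.exists_greatest_of_bdd hb h0
  refine ⟨n, hn, ?_⟩
  by_contra! hlt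
  have := hmax _ hlt.le
  omega

lemma deriv_iter_le' (hc : Ctrl L Cs f) (h : CycOrbit f p q z) {n : ℤ} {l : ℕ} (hl : l ≤ 2 * q)
    {x : ℝ} (hx : x ∈ J z n) :
    deriv f^[l] x ≤ Real.exp (2 * L) * (gap z (n + l * p) / gap z n) := by
  rw [← mul_div_assoc, le_div_iff₀ (h.gap_pos n)]
  exact h.deriv_iter_le hc.lift hc.logLip hc.L_nonneg hl hx

lemma sum_sq_le (h : CycOrbit f p q z) (n : ℤ) {l : ℕ} (hl : l ≤ 2 * q) :
    ∑ i ∈ Finset.range l, (gap z (n + i * p) / gap z n) ^ 2 ≤ 2 * (gap z 0 / gap z n ^ 2) := by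
  have h1 : ∀ i ∈ Finset.range l, (gap z (n + i * p) / gap z n) ^ 2 ≤
      gap z 0 / gap z n ^ 2 * gap z (n + i * p) := by
    intro i _
    rw [div_pow, div_mul_eq_mul_div]
    have := h.gap_pos n
    have := h.gap_pos (n + i * p)
    refine div_le_div_of_nonneg_right ?_ (by positivity)
    nlinarith [h.gap_le (n + i * p)]
  refine (Finset.sum_le_sum h1).trans ?_
  rw [← Finset.mul_sum, mul_comm]
  exact mul_le_mul_of_nonneg_right (h.sum_gap_two n hl)
    (div_nonneg (h.gap_pos 0).le (by positivity))

lemma schwarz_le (hc : Ctrl L Cs f) (h : CycOrbit f p q z) {n : ℤ} {l : ℕ} (hl : l ≤ 2 * q)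
    {x : ℝ} (hx : x ∈ J z n) :
    |schwarz f^[l] x| ≤ Cs 0 * (Real.exp (2 * L) ^ 2 * (2 * (gap z 0 / gap z n ^ 2))) := by
  rw [hc.lift.schwarz_iter]
  have hC0 : 0 ≤ Cs 0 := (abs_nonneg _).trans ((hc.schwarz 0).abs_le (Set.mem_univ 0))
  calc _ ≤ ∑ i ∈ Finset.range l, |schwarz f (f^[i] x) * deriv f^[i] x ^ 2| :=
        Finset.abs_sum_le_sum_abs _ _
    _ ≤ ∑ i ∈ Finset.range l, Cs 0 * (Real.exp (2 * L) ^ 2 * (gap z (n + i * p) / gap z n) ^ 2) := by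
        refine Finset.sum_le_sum fun i hi => ?_
        rw [abs_mul, abs_of_nonneg (sq_nonneg (deriv f^[i] x)), ← mul_pow]
        refine mul_le_mul ((hc.schwarz 0).abs_le (Set.mem_univ _)) ?_ (sq_nonneg _) hC0
        exact pow_le_pow_left₀ ((hc.lift.iter i).pos x).le
          (h.deriv_iter_le' hc (by simp at hi; omega) hx) 2
    _ = Cs 0 * (Real.exp (2 * L) ^ 2 * ∑ i ∈ Finset.range l, (gap z (n + i * p) / gap z n) ^ 2) := by
        rw [Finset.mul_sum, Finset.mul_sum]
    _ ≤ _ := by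
        refine mul_le_mul_of_nonneg_left (mul_le_mul_of_nonneg_left (h.sum_sq_le n hl) ?_) hC0
        positivity

/-- Constant in the first nonlinearity estimate. -/
def nlC (L : ℝ) (Cs : ℕ → ℝ) : ℝ := √(4 * (Cs 0 * Real.exp (2 * L) ^ 2))

lemma nonlin_le_min (hc : Ctrl L Cs f) (h : CycOrbit f p q z) {m : ℤ} (hm : ∀ n, gap z m ≤ gap z n)
    {l : ℕ} (hl : l ≤ 2 * q) (x : ℝ) :
    |nonlin f^[l] x| ≤ nlC L Cs * (√(gap z 0) / gap z m) := by
  have hs := (hc.lift.iter l).smooth_nonlin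
  obtain ⟨y, hy⟩ := Per.exists_max (u := fun x => nonlin f^[l] x ^ 2)
    (fun x => by simp only [(hc.lift.iter l).per_nonlin x]) (hs.pow 2).continuous
  have hd : deriv (fun x => nonlin f^[l] x ^ 2) y = 0 :=
    IsLocalMax.deriv_eq_zero (Eventually.of_forall hy)
  rw [((hs.hasDerivAt y).fun_pow 2).deriv] at hd
  have hC0 : 0 ≤ Cs 0 := (abs_nonneg _).trans ((hc.schwarz 0).abs_le (Set.mem_univ 0))
  have key : nonlin f^[l] y ^ 2 ≤ 4 * (Cs 0 * Real.exp (2 * L) ^ 2) * (gap z 0 / gap z m ^ 2) := by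
    have hmp := h.gap_pos m
    have h0p := h.gap_pos 0
    rcases eq_or_ne (nonlin f^[l] y) 0 with h0 | h0
    · rw [h0]; simp only [ne_eq, OfNat.ofNat_ne_zero, not_false_eq_true, zero_pow]; positivity
    · have hd' : deriv (nonlin f^[l]) y = 0 := by
        simpa [h0] using hd
      rw [IsCircleDiffeoLift.deriv_nonlin] at hd'
      obtain ⟨n, hn⟩ := h.exists_mem y
      have h1 := h.schwarz_le hc hl hn
      have h2 : nonlin f^[l] y ^ 2 ≤ 2 * |schwarz f^[l] y| := by
        have := neg_le_abs (schwarz f^[l] y); nlinarith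
      have h3 : gap z 0 / gap z n ^ 2 ≤ gap z 0 / gap z m ^ 2 :=
        div_le_div_of_nonneg_left h0p.le (by positivity) (pow_le_pow_left₀ hmp.le (hm n) 2)
      calc _ ≤ _ := h2
        _ ≤ 2 * _ := mul_le_mul_of_nonneg_left h1 (by norm_num)
        _ = 4 * (Cs 0 * Real.exp (2 * L) ^ 2) * (gap z 0 / gap z n ^ 2) := by ring
        _ ≤ _ := mul_le_mul_of_nonneg_left h3 (by positivity)
  have h5 : nlC L Cs * (√(gap z 0) / gap z m) =
      √(4 * (Cs 0 * Real.exp (2 * L) ^ 2) * (gap z 0 / gap z m ^ 2)) := by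
    rw [Real.sqrt_mul (by positivity), Real.sqrt_div (h.gap_pos 0).le, Real.sqrt_sq (h.gap_pos m).le,
      nlC]
  rw [h5]
  exact Real.abs_le_sqrt ((hy x).trans key)

lemma nonlin_le (hc : Ctrl L Cs f) (h : CycOrbit f p q z) {n : ℤ}
    {l : ℕ} (hl : l ≤ q) {x : ℝ} (hx : x ∈ J z n) :
    |nonlin f^[l] x| ≤ 2 * nlC L Cs * Real.exp (2 * L) * (√(gap z 0) / gap z n) := by
  obtain ⟨m, hm⟩ := h.exists_min
  obtain ⟨i, hi, k, e⟩ := h.exists_rep m n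
  have hfi := hc.lift.iter i
  set y := Function.invFun f^[i] (x - k) with hy
  have hyx : f^[i] y = x - k := hfi.inv_right _
  have hym : y ∈ J z m := by
    constructor
    · rw [← hfi.strictMono.le_iff_le, hyx, h.iter]
      have := hx.1; rw [e, h.per_int] at this; linarith
    · rw [← hfi.strictMono.le_iff_le, hyx, h.iter]
      have := hx.2
      rw [e, show m + i * p + k * q + 1 = m + 1 + i * p + k * q by ring, h.per_int] at this; linarith
  have h1 : nonlin f^[l + i] y = nonlin f^[l] x * deriv f^[i] y + nonlin f^[i] y := by
    rw [IsCircleDiffeoLift.iter_add_eq, (hc.lift.iter l).nonlin_comp hfi, hyx]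
    have := (hc.lift.iter l).per_nonlin.int x (-k)
    push_cast at this
    rw [sub_eq_add_neg, this]
  have h2 := h.nonlin_le_min hc hm (l := l + i) (by omega) y
  have h3 := h.nonlin_le_min hc hm (l := i) (by omega) y
  have h4 : |nonlin f^[l] x| * deriv f^[i] y ≤ 2 * (nlC L Cs * (√(gap z 0) / gap z m)) := by
    rw [← abs_of_pos (hfi.pos y), ← abs_mul, show nonlin f^[l] x * deriv f^[i] y =
      nonlin f^[l + i] y - nonlin f^[i] y by rw [h1]; ring]
    exact (abs_sub _ _).trans (by linarith)
  have h5 := h.le_deriv_iter hc.lift hc.logLip hc.L_nonneg (l := i) (by omega) hym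
  have e5 : gap z (m + i * p) = gap z n := by rw [e, h.gap_per_int]
  rw [e5] at h5
  have hn := h.gap_pos n
  have hmp := h.gap_pos m
  rw [← mul_div_assoc, le_div_iff₀ hn]
  have h6 := mul_le_mul_of_nonneg_left h5 (abs_nonneg (nonlin f^[l] x))
  refine h6.trans ?_
  have h7 := mul_le_mul_of_nonneg_right h4 hmp.le
  have h8 : 2 * (nlC L Cs * (√(gap z 0) / gap z m)) * gap z m = 2 * nlC L Cs * √(gap z 0) := by
    field_simp
  rw [h8] at h7
  have h9 := mul_le_mul_of_nonneg_left h7 (Real.exp_pos (2 * L)).le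
  calc _ = _ := by ring
    _ ≤ _ := h9
    _ = _ := by ring

/-- The natural scale of derivatives on the `n`-th gap. -/
def scale (z : ℤ → ℝ) (n : ℤ) : ℝ := √(gap z 0) / gap z n

lemma scale_nonneg (h : CycOrbit f p q z) (n : ℤ) : 0 ≤ scale z n :=
  div_nonneg (Real.sqrt_nonneg _) (h.gap_pos n).le

lemma ratio_le_scale (h : CycOrbit f p q z) (m n : ℤ) : gap z m / gap z n ≤ scale z n := by
  refine div_le_div_of_nonneg_right ((h.gap_le m).trans ?_) (h.gap_pos n).le
  rw [Real.le_sqrt' (h.gap_pos 0)]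
  nlinarith [h.gap_pos 0, h.gap_zero_le_one]

lemma bd_nonlin (L : ℝ) (Cs : ℕ → ℝ) (j : ℕ) : ∃ C : ℝ, ∀ f p q z, Ctrl L Cs f → CycOrbit f p q z →
    ∀ n, ∀ l ≤ q, Bd (J z n) j (scale z n) (C * scale z n) (nonlin f^[l]) := by
  induction j with
  | zero =>
    refine ⟨2 * nlC L Cs * Real.exp (2 * L), fun f p q z hc h n l hl => Bd.zero_iff.mpr fun x hx => ?_⟩
    exact h.nonlin_le hc hl hx
  | succ j ih =>
    obtain ⟨C, hC⟩ := ih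
    obtain ⟨C', hC1, hC'⟩ := Bd.exp_type j C
    set E := Real.exp (2 * L) with hE
    have hE0 : 0 < E := Real.exp_pos _
    set a := Max.max 1 (C' * E) with ha
    set K₁ := Cs (j + 1) * (2 ^ j * a) ^ (j + 1) with hK₁
    set K₂ := 2 ^ j * (K₁ * (2 ^ j * (C' * E * (C' * E)))) with hK₂
    refine ⟨Max.max (2 * nlC L Cs * E) (2 * K₂ + 2 ^ j * (2 ^ j * (C * C) * (1 / 2))),
      fun f p q z hc h n l hl => Bd.succ_iff.mpr ⟨fun x hx => ?_, ?_⟩⟩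
    · exact (h.nonlin_le hc hl hx).trans
        (mul_le_mul_of_nonneg_right (le_max_left _ _) (h.scale_nonneg n))
    · set s := scale z n with hs
      have hs0 : 0 ≤ s := h.scale_nonneg n
      have hfs := fun i => hc.lift.iter i
      have hw := hC f p q z hc h n l hl
      have hK0 : 0 ≤ Cs (j + 1) := (abs_nonneg _).trans ((hc.schwarz (j + 1)).abs_le (Set.mem_univ 0))
      rw [show deriv (nonlin f^[l]) = fun x => schwarz f^[l] x + nonlin f^[l] x * nonlin f^[l] x * (1 / 2)
        from funext (IsCircleDiffeoLift.deriv_nonlin _)]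
      have hww := Bd.mul hs0 ((hfs l).smooth_nonlin.mul (hfs l).smooth_nonlin) contDiff_const
        (Bd.mul hs0 (hfs l).smooth_nonlin (hfs l).smooth_nonlin hw hw) (Bd.const hs0 (1 / 2))
      have hterm : ∀ i ∈ Finset.range l, Bd (J z n) j s (K₂ * (gap z (n + i * p) / gap z n) ^ 2)
          (fun x => schwarz f (f^[i] x) * (deriv f^[i] x * deriv f^[i] x)) := by
        intro i hi
        have hil : i ≤ q := by simp at hi; omega
        set ρ := gap z (n + i * p) / gap z n with hρ
        have hρ0 : 0 ≤ ρ := div_nonneg (h.gap_pos _).le (h.gap_pos _).le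
        have hD := hC' (J z n) s (E * ρ) (deriv f^[i]) (nonlin f^[i]) hs0 (by positivity)
          (hfs i).smooth.deriv (hfs i).smooth_nonlin (hfs i).deriv_deriv_eq
          (hC f p q z hc h n i hil) (fun x hx => by
            rw [abs_of_pos ((hfs i).pos x)]; exact h.deriv_iter_le' hc (by omega) hx)
        have hS := Bd.comp_succ hs0 (by positivity) zero_le_one (a := a) (hfs i).smooth hc.lift.smooth_schwarz
          (Set.mapsTo_univ _ _) (hc.schwarz (j + 1)) hD (by
            have := h.ratio_le_scale (n + i * p) n
            calc C' * (E * ρ) * 1 = C' * E * ρ := by ring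
              _ ≤ a * s := mul_le_mul (le_max_right _ _) this hρ0 (by positivity)) (le_max_left _ _)
        have hDD := Bd.mul hs0 (hfs i).smooth.deriv (hfs i).smooth.deriv hD hD
        refine (Bd.mul hs0 (hc.lift.smooth_schwarz.comp (hfs i).smooth)
          ((hfs i).smooth.deriv.mul (hfs i).smooth.deriv) (hS.mono_order (by omega)) hDD).mono_const hs0
          (le_of_eq ?_)
        rw [hK₂]; ring
      have hsum := Bd.finset_sum (Finset.range l) (fun i _ =>
        ((hc.lift.smooth_schwarz.comp (hfs i).smooth).mul
          ((hfs i).smooth.deriv.mul (hfs i).smooth.deriv))) hterm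
      have hsch : schwarz f^[l] = fun x => ∑ i ∈ Finset.range l,
          schwarz f (f^[i] x) * (deriv f^[i] x * deriv f^[i] x) := by
        funext x; rw [hc.lift.schwarz_iter]
        exact Finset.sum_congr rfl fun i _ => by ring
      simp only [Function.comp_def] at hsum
      rw [← hsch] at hsum
      refine (Bd.add (hfs l).smooth_schwarz (((hfs l).smooth_nonlin.mul (hfs l).smooth_nonlin).mul
        contDiff_const) hsum hww).mono_const hs0 ?_
      have hK₂0 : 0 ≤ K₂ := by positivity
      have hs2 : s ^ 2 = gap z 0 / gap z n ^ 2 := by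
        rw [hs, scale, div_pow, Real.sq_sqrt (h.gap_pos 0).le]
      rw [← Finset.mul_sum]
      calc _ ≤ K₂ * (2 * (gap z 0 / gap z n ^ 2)) + 2 ^ j * (2 ^ j * (C * s * (C * s)) * |1 / 2|) :=
            add_le_add_left (mul_le_mul_of_nonneg_left (h.sum_sq_le n (by omega)) hK₂0) _
        _ = (2 * K₂ + 2 ^ j * (2 ^ j * (C * C) * (1 / 2))) * (s * s) := by
            rw [← hs2, abs_of_pos (by norm_num : (0 : ℝ) < 1 / 2)]; ring
        _ ≤ _ := by
            rw [mul_assoc (Max.max _ _)]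
            exact mul_le_mul_of_nonneg_right (le_max_right _ _) (by positivity)

lemma bd_deriv_iter (L : ℝ) (Cs : ℕ → ℝ) (j : ℕ) : ∃ C : ℝ, 0 < C ∧ ∀ f p q z, Ctrl L Cs f →
    CycOrbit f p q z → ∀ n, ∀ l ≤ q,
    Bd (J z n) j (scale z n) (C * (gap z (n + l * p) / gap z n)) (deriv f^[l]) := by
  obtain ⟨C, hC⟩ := bd_nonlin L Cs j
  obtain ⟨C', hC1, hC'⟩ := Bd.exp_type j C
  refine ⟨C' * Real.exp (2 * L), by positivity, fun f p q z hc h n l hl => ?_⟩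
  rw [mul_assoc]
  exact hC' (J z n) _ _ _ (nonlin f^[l]) (h.scale_nonneg n)
    (mul_nonneg (Real.exp_pos _).le (div_nonneg (h.gap_pos _).le (h.gap_pos _).le))
    (hc.lift.iter l).smooth.deriv (hc.lift.iter l).smooth_nonlin (hc.lift.iter l).deriv_deriv_eq
    (hC f p q z hc h n l hl) (fun x hx => by
      rw [abs_of_pos ((hc.lift.iter l).pos x)]; exact h.deriv_iter_le' hc (by omega) hx)

end CycOrbit

/-- A function with many zeros is small if a high derivative is bounded. -/
lemma small_of_zeros (k : ℕ) : ∀ (u : ℝ → ℝ) (x : ℕ → ℝ) (A B T : ℝ), Smooth u → A ≤ B →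
    (∀ i < k, x i ∈ Set.Icc A B) → (∀ i, i + 1 < k → x i < x (i + 1)) → (∀ i < k, u (x i) = 0) →
    (∀ y ∈ Set.Icc A B, |iteratedDeriv k u y| ≤ T) → ∀ y ∈ Set.Icc A B, |u y| ≤ T * (B - A) ^ k := by
  induction k with
  | zero =>
    intro u x A B T hu hAB _ _ _ hT y hy
    simpa using hT y hy
  | succ k ih =>
    intro u x A B T hu hAB hx hmono hz hT y hy
    have hR : ∀ i, ∃ c, i < k → (c ∈ Set.Ioo (x i) (x (i + 1)) ∧ deriv u c = 0) := by
      intro i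
      by_cases hi : i < k
      · obtain ⟨c, hc, h0⟩ := exists_deriv_eq_zero (hmono i (by omega)) hu.continuous.continuousOn
          (by rw [hz i (by omega), hz (i + 1) (by omega)])
        exact ⟨c, fun _ => ⟨hc, h0⟩⟩
      · exact ⟨0, fun h => absurd h hi⟩
    choose c hc using hR
    have hd := ih (deriv u) c A B T hu.deriv hAB
      (fun i hi => ⟨(hx i (by omega)).1.trans (hc i hi).1.1.le, (hc i hi).1.2.le.trans (hx (i + 1) (by omega)).2⟩)
      (fun i hi => (hc i (by omega)).1.2.trans (hc (i + 1) hi).1.1)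
      (fun i hi => (hc i hi).2) (fun y hy => by
        have := hT y hy; rwa [iteratedDeriv_succ'] at this)
    have h0 := hx 0 (by omega)
    have := Convex.norm_image_sub_le_of_norm_deriv_le (f := u) (s := Set.Icc A B)
      (fun y _ => hu.diff y) (fun y hy => hd y hy) (convex_Icc A B) h0 hy
    rw [hz 0 (by omega), sub_zero, Real.norm_eq_abs, Real.norm_eq_abs] at this
    refine this.trans ?_
    rw [pow_succ, ← mul_assoc]
    refine mul_le_mul_of_nonneg_left ?_ ((abs_nonneg _).trans (hd y hy))
    rw [abs_le]; constructor <;> linarith [h0.1, h0.2, hy.1, hy.2]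

lemma Bd.to_one {U : Set ℝ} {j : ℕ} {l K : ℝ} {u : ℝ → ℝ} (h : Bd U j l K u) (hl : 0 ≤ l) (hK : 0 ≤ K) :
    Bd U j 1 (K * (max 1 l) ^ j) u := by
  intro b hb x hx
  refine (h b hb x hx).trans ?_
  rw [one_pow, mul_one]
  refine mul_le_mul_of_nonneg_left ?_ hK
  exact (pow_le_pow_left₀ hl (le_max_right 1 l) b).trans (pow_le_pow_right₀ (le_max_left _ _) hb)

lemma le_two_pow_ceil (C : ℝ) : C ≤ 2 ^ ⌈C⌉₊ := by
  refine (Nat.le_ceil C).trans ?_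
  exact_mod_cast Nat.lt_two_pow_self.le

lemma le_pow_ceil (C : ℝ) {B : ℝ} (hB : 2 ≤ B) : C ≤ B ^ ⌈C⌉₊ :=
  (le_two_pow_ceil C).trans (PB.two_pow hB _)

lemma PB.of_bd {U : Set ℝ} {j : ℕ} {C B : ℝ} {u : ℝ → ℝ} (h : Bd U j 1 C u) (hB : 2 ≤ B) :
    PB U j B ⌈C⌉₊ u :=
  h.mono_const zero_le_one (le_pow_ceil C hB)

/-- An antiderivative of a smooth function. -/
def prim (u : ℝ → ℝ) : ℝ → ℝ := fun x => ∫ t in (0 : ℝ)..x, u t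

lemma deriv_prim {u : ℝ → ℝ} (hu : Continuous u) : deriv (prim u) = u :=
  funext fun x => hu.deriv_integral u 0 x

lemma smooth_prim {u : ℝ → ℝ} (hu : Smooth u) : Smooth (prim u) := by
  refine contDiff_infty_iff_deriv.mpr ⟨fun x => ?_, ?_⟩
  · exact (intervalIntegral.integral_hasDerivAt_right (hu.continuous.intervalIntegrable _ _)
      hu.continuous.stronglyMeasurable.stronglyMeasurableAtFilter hu.continuous.continuousAt).differentiableAt
  · rw [deriv_prim hu.continuous]; exact hu

lemma prim_add_one {u : ℝ → ℝ} (hu : Continuous u) (hp : Per u) (x : ℝ) :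
    prim u (x + 1) = prim u x + prim u 1 := by
  have h1 := (show Function.Periodic u 1 from hp).intervalIntegral_add_eq x 0
  have h2 := intervalIntegral.integral_add_adjacent_intervals (μ := volume)
    (hu.intervalIntegrable 0 x) (hu.intervalIntegrable x (x + 1))
  rw [h1, zero_add] at h2
  exact h2.symm

lemma prim_add_int {u : ℝ → ℝ} (hu : Continuous u) (hp : Per u) (x : ℝ) (n : ℤ) :
    prim u (x + n) = prim u x + n * prim u 1 := by
  have : Per (fun x => prim u x - x * prim u 1) := fun x => by
    simp only [prim_add_one hu hp]; ring
  have := this.int x n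
  linarith

lemma iteratedDeriv_eq_zero_on {u : ℝ → ℝ} (hu : Smooth u) {A B : ℝ} (hAB : A < B)
    (h0 : ∀ x ∈ Set.Icc A B, u x = 0) (b : ℕ) : ∀ x ∈ Set.Icc A B, iteratedDeriv b u x = 0 := by
  induction b with
  | zero => simpa using h0
  | succ b ih =>
    have h1 : ∀ x ∈ Set.Ioo A B, iteratedDeriv (b + 1) u x = 0 := by
      intro x hx
      rw [iteratedDeriv_succ]
      have : iteratedDeriv b u =ᶠ[𝓝 x] fun _ => 0 := by
        filter_upwards [Icc_mem_nhds hx.1 hx.2] with y hy using ih y hy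
      rw [this.deriv_eq, deriv_const]
    have h2 : Set.Icc A B ⊆ {x | iteratedDeriv (b + 1) u x = 0} := by
      rw [← closure_Ioo hAB.ne]
      exact (isClosed_eq (hu.iteratedDeriv _).continuous continuous_const).closure_subset_iff.mpr h1
    exact h2

lemma eq_of_deriv_zero {X : ℝ → ℝ} (hX : Smooth X) {A B : ℝ} (h : ∀ x ∈ Set.Icc A B, deriv X x = 0)
    {x y : ℝ} (hx : x ∈ Set.Icc A B) (hy : y ∈ Set.Icc A B) : X x = X y := by
  have := Convex.norm_image_sub_le_of_norm_deriv_le (f := X) (s := Set.Icc A B) (C := 0)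
    (fun y _ => hX.diff y) (fun y hy => by rw [h y hy]; simp) (convex_Icc A B) hx hy
  rw [zero_mul, norm_le_zero_iff, sub_eq_zero] at this
  exact this.symm

lemma bd_smoothTransition (j : ℕ) : ∃ C, Bd Set.univ j 1 C Real.smoothTransition := by
  have hs : Smooth Real.smoothTransition := Real.smoothTransition.contDiff
  have key : ∀ b, ∃ C, ∀ x, |iteratedDeriv b Real.smoothTransition x| ≤ C := by
    intro b
    obtain ⟨C, hC⟩ := (isCompact_Icc (a := (-1 : ℝ)) (b := 2)).exists_bound_of_continuousOn
      (hs.iteratedDeriv b).continuous.continuousOn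
    refine ⟨max C 1, fun x => ?_⟩
    by_cases hx : x ∈ Set.Icc (-1 : ℝ) 2
    · exact (hC x hx).trans (le_max_left _ _)
    · refine le_trans ?_ (le_max_right _ _)
      have hx' : x < 0 ∨ 1 < x := by
        by_contra! hh
        exact hx ⟨by linarith [hh.1], by linarith [hh.2]⟩
      rcases b with _ | b
      · rw [iteratedDeriv_zero, abs_of_nonneg (Real.smoothTransition.nonneg x)]
        exact Real.smoothTransition.le_one x
      · have : ∃ c : ℝ, Real.smoothTransition =ᶠ[𝓝 x] fun _ => c := by
          rcases hx' with h | h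
          · exact ⟨0, by filter_upwards [Iio_mem_nhds h] with y hy using
              Real.smoothTransition.zero_of_nonpos (le_of_lt hy)⟩
          · exact ⟨1, by filter_upwards [Ioi_mem_nhds h] with y hy using
              Real.smoothTransition.one_of_one_le (le_of_lt hy)⟩
        obtain ⟨c, hc⟩ := this
        rw [hc.iteratedDeriv_eq, iteratedDeriv_const]; simp
  choose C hC using key
  refine ⟨∑ b ∈ Finset.range (j + 1), |C b|, fun b hb x _ => ?_⟩
  rw [one_pow, mul_one]
  refine (hC b x).trans ((le_abs_self _).trans ?_)
  exact Finset.single_le_sum (f := fun b => |C b|) (fun i _ => abs_nonneg _) (Finset.mem_range.mpr (by omega))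

lemma bd_cos (j : ℕ) : ∀ a, Bd Set.univ j (2 * Real.pi) 1 (fun x => Real.cos (2 * Real.pi * x + a)) := by
  induction j with
  | zero => exact fun a => Bd.zero_iff.mpr fun x _ => Real.abs_cos_le_one _
  | succ j ih =>
    refine fun a => Bd.succ_iff.mpr ⟨fun x _ => Real.abs_cos_le_one _, ?_⟩
    have e : deriv (fun x => Real.cos (2 * Real.pi * x + a)) =
        fun x => 2 * Real.pi * Real.cos (2 * Real.pi * x + (a + Real.pi / 2)) := by
      funext x
      have h := (((hasDerivAt_id x).const_mul (2 * Real.pi)).add_const a).cos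
      simp only [id] at h
      rw [h.deriv, ← add_assoc, Real.cos_add_pi_div_two]; ring
    rw [e]
    have := (ih (a + Real.pi / 2)).const_mul (2 * Real.pi)
    rw [abs_of_pos Real.two_pi_pos, mul_one] at this
    rwa [one_mul]

/-- A smooth one-periodic bump equal to one at distance `≤ d₀` of `c` and zero at distance `≥ d₁`. -/
def cosBump (c d₀ d₁ : ℝ) : ℝ → ℝ := fun x => Real.smoothTransition
  ((Real.cos (2 * Real.pi * x + -(2 * Real.pi * c)) - Real.cos (2 * Real.pi * d₁)) *
    (Real.cos (2 * Real.pi * d₀) - Real.cos (2 * Real.pi * d₁))⁻¹)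

section cosBump
variable {c d₀ d₁ : ℝ}

lemma smooth_cosArg (c d e : ℝ) : Smooth fun x : ℝ =>
    (Real.cos (2 * Real.pi * x + -(2 * Real.pi * c)) - d) * e :=
  ((Real.contDiff_cos.comp ((contDiff_const.mul contDiff_id).add contDiff_const)).sub contDiff_const).mul
    contDiff_const

lemma smooth_cosBump : Smooth (cosBump c d₀ d₁) :=
  (Real.smoothTransition.contDiff (n := ⊤)).comp (smooth_cosArg c _ _)

lemma per_cosBump : Per (cosBump c d₀ d₁) := fun x => by
  unfold cosBump
  rw [show 2 * Real.pi * (x + 1) + -(2 * Real.pi * c) = 2 * Real.pi * x + -(2 * Real.pi * c) + 2 * Real.pi by ring,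
    Real.cos_add_two_pi]

lemma cos_gap (h0 : 0 ≤ d₀) (h1 : d₀ < d₁) (h2 : d₀ + d₁ ≤ 1 / 2) :
    8 * ((d₁ + d₀) * (d₁ - d₀)) ≤ Real.cos (2 * Real.pi * d₀) - Real.cos (2 * Real.pi * d₁) := by
  have hp := Real.pi_pos
  rw [Real.cos_sub_cos, show (2 * Real.pi * d₀ + 2 * Real.pi * d₁) / 2 = Real.pi * (d₁ + d₀) by ring,
    show (2 * Real.pi * d₀ - 2 * Real.pi * d₁) / 2 = -(Real.pi * (d₁ - d₀)) by ring, Real.sin_neg]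
  have e : ∀ t, 0 ≤ t → t ≤ 1 / 2 → 2 * t ≤ Real.sin (Real.pi * t) := fun t ht ht' => by
    have := Real.mul_le_sin (x := Real.pi * t) (by positivity) (by nlinarith)
    calc 2 * t = 2 / Real.pi * (Real.pi * t) := by field_simp
      _ ≤ _ := this
  have a := e (d₁ + d₀) (by linarith) (by linarith)
  have b := e (d₁ - d₀) (by linarith) (by linarith)
  have := mul_le_mul a b (by linarith) (by linarith)
  linarith

lemma cosBump_nonneg (x : ℝ) : 0 ≤ cosBump c d₀ d₁ x := Real.smoothTransition.nonneg _
lemma cosBump_le_one (x : ℝ) : cosBump c d₀ d₁ x ≤ 1 := Real.smoothTransition.le_one _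

lemma cosBump_eq_one (h0 : 0 ≤ d₀) (h1 : d₀ < d₁) (h2 : d₀ + d₁ ≤ 1 / 2) {x : ℝ} (hx : |x - c| ≤ d₀) :
    cosBump c d₀ d₁ x = 1 := by
  have hp := Real.pi_pos
  have h3 := cos_gap h0 h1 h2
  have h4 : 0 < 8 * ((d₁ + d₀) * (d₁ - d₀)) := by
    have : 0 < d₁ - d₀ := by linarith
    have : 0 < d₁ + d₀ := by linarith
    positivity
  refine Real.smoothTransition.one_of_one_le ?_
  rw [← div_eq_mul_inv, le_div_iff₀ (by linarith), one_mul]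
  refine sub_le_sub_right ?_ _
  rw [show 2 * Real.pi * x + -(2 * Real.pi * c) = 2 * Real.pi * (x - c) by ring,
    ← Real.cos_abs (2 * Real.pi * (x - c)), abs_mul, abs_of_pos Real.two_pi_pos]
  exact Real.cos_le_cos_of_nonneg_of_le_pi (by positivity) (by nlinarith) (by nlinarith)

lemma cosBump_eq_zero (h0 : 0 ≤ d₀) (h1 : d₀ < d₁) (h2 : d₀ + d₁ ≤ 1 / 2) {x : ℝ}
    (hx : d₁ ≤ x - c) (hx' : x - c ≤ 1 - d₁) : cosBump c d₀ d₁ x = 0 := by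
  have hp := Real.pi_pos
  have h3 := cos_gap h0 h1 h2
  have h4 : 0 < 8 * ((d₁ + d₀) * (d₁ - d₀)) := by
    have : 0 < d₁ - d₀ := by linarith
    have : 0 < d₁ + d₀ := by linarith
    positivity
  refine Real.smoothTransition.zero_of_nonpos (mul_nonpos_of_nonpos_of_nonneg ?_ (inv_nonneg.mpr (by linarith)))
  rw [sub_nonpos, show 2 * Real.pi * x + -(2 * Real.pi * c) = 2 * Real.pi * (x - c) by ring]
  rcases le_total (x - c) (1 / 2) with h | h
  · exact Real.cos_le_cos_of_nonneg_of_le_pi (by nlinarith) (by nlinarith) (by nlinarith)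
  · rw [← Real.cos_two_pi_sub]
    exact Real.cos_le_cos_of_nonneg_of_le_pi (by nlinarith) (by nlinarith) (by nlinarith)

lemma pb_cosBump (j : ℕ) : ∃ N, ∀ B c d₀ d₁ : ℝ, 2 ≤ B → 0 ≤ d₀ → d₀ < d₁ → d₀ + d₁ ≤ 1 / 2 → ∀ m : ℕ,
    (8 * ((d₁ + d₀) * (d₁ - d₀)))⁻¹ ≤ B ^ m → PB Set.univ j B (N * (m + 1)) (cosBump c d₀ d₁) := by
  obtain ⟨C, hC⟩ := bd_smoothTransition (j + 1)
  set C₁ := (1 * max 1 (2 * Real.pi) ^ (j + 1)) with hC₁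
  set n₁ := ⌈C⌉₊ with hn₁
  set n₂ := ⌈2 * Real.pi * C₁⌉₊ with hn₂
  refine ⟨n₁ + (j + (n₂ + 1)) * (j + 1), fun B c d₀ d₁ hB h0 h1 h2 m hm => ?_⟩
  have h3 := cos_gap h0 h1 h2
  have h4 : 0 < 8 * ((d₁ + d₀) * (d₁ - d₀)) := by
    have : 0 < d₁ - d₀ := by linarith
    have : 0 < d₁ + d₀ := by linarith
    positivity
  set k := (Real.cos (2 * Real.pi * d₀) - Real.cos (2 * Real.pi * d₁))⁻¹ with hk
  have hk0 : 0 ≤ k := inv_nonneg.mpr (by linarith)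
  have hkm : k ≤ B ^ m := (inv_anti₀ h4 h3).trans hm
  have hder : deriv (fun x : ℝ => (Real.cos (2 * Real.pi * x + -(2 * Real.pi * c)) -
      Real.cos (2 * Real.pi * d₁)) * k) = fun x => (k * (2 * Real.pi)) *
        Real.cos (2 * Real.pi * x + (-(2 * Real.pi * c) + Real.pi / 2)) := by
    funext x
    have h := (((((hasDerivAt_id x).const_mul (2 * Real.pi)).add_const (-(2 * Real.pi * c))).cos).sub_const
      (Real.cos (2 * Real.pi * d₁))).mul_const k
    simp only [id] at h
    rw [h.deriv, ← add_assoc, Real.cos_add_pi_div_two]; ring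
  have hb := ((bd_cos (j + 1) (-(2 * Real.pi * c) + Real.pi / 2)).to_one Real.two_pi_pos.le
    zero_le_one).const_mul (k * (2 * Real.pi))
  rw [← hder, ← hC₁] at hb
  have hp := Real.pi_pos
  have hB0 : 0 < B := by linarith
  have hb' : PB Set.univ j B (n₂ + m) (deriv (fun x : ℝ =>
      (Real.cos (2 * Real.pi * x + -(2 * Real.pi * c)) - Real.cos (2 * Real.pi * d₁)) * k)) := by
    refine (hb.mono_order (by omega)).mono_const zero_le_one ?_
    rw [abs_of_nonneg (by positivity), pow_add]
    calc k * (2 * Real.pi) * C₁ = (2 * Real.pi * C₁) * k := by ring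
      _ ≤ _ := mul_le_mul (le_pow_ceil _ hB) hkm hk0 (by positivity)
  have := PB.comp_succ hB (smooth_cosArg c _ _) (Real.smoothTransition.contDiff (n := ⊤))
    (Set.mapsTo_univ _ _) (PB.of_bd hC hB) hb'
  have h7 : PB Set.univ j B _ (cosBump c d₀ d₁) := this.mono_order (by omega)
  refine h7.mono hB ?_
  rw [← hn₁]
  nlinarith [Nat.zero_le (n₁ * m), Nat.zero_le (m * ((j) * (j + 1))), Nat.zero_le (m * n₂ * (j+1))]

end cosBump

namespace CycOrbit
variable {f : ℝ → ℝ} {p : ℤ} {q : ℕ} {z : ℤ → ℝ} {L : ℝ} {Cs : ℕ → ℝ}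

/-- Gaps of size comparable to the largest gap. -/
def Big (L : ℝ) (z : ℤ → ℝ) (n : ℤ) : Prop := gap z 0 ≤ Real.exp (9 * L) * gap z n

lemma exp_neg_le_deriv (hc : Ctrl L Cs f) (x : ℝ) : Real.exp (-L) ≤ deriv f x := by
  obtain ⟨ξ, hξ, e⟩ := exists_deriv_eq_slope f (zero_lt_one' ℝ) hc.lift.cont.continuousOn
    hc.lift.smooth.diff.differentiableOn
  have h1 : f 1 = f 0 + 1 := by have := hc.lift.2.1 0; rwa [zero_add] at this
  rw [h1] at e
  have e1 : deriv f ξ = 1 := by rw [e]; norm_num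
  have h2 := hc.logLip (Int.fract x) ξ
  rw [e1, Real.log_one, sub_zero, ← hc.lift.per_deriv.fract x] at h2
  have h3 : |Int.fract x - ξ| ≤ 1 := by
    rw [abs_le]
    constructor <;> linarith [Int.fract_nonneg x, Int.fract_lt_one x, hξ.1, hξ.2]
  have h4 : L * |Int.fract x - ξ| ≤ L := by nlinarith [hc.L_nonneg]
  rw [← Real.exp_log (hc.lift.pos x), Real.exp_le_exp]
  linarith [(abs_le.mp (h2.trans h4)).1]

lemma big_zero (hc : Ctrl L Cs f) (h : CycOrbit f p q z) : gap z 0 ≤ Real.exp (4 * L) * gap z 1 ∧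
    gap z 0 ≤ Real.exp (4 * L) * gap z (-1) ∧ gap z 0 ≤ Real.exp (4 * L) * gap z 0 := by
  refine ⟨?_, ?_, ?_⟩
  · simpa using h.gap_le_succ hc.lift hc.logLip hc.L_nonneg 0
  · simpa using h.gap_succ_le hc.lift hc.logLip hc.L_nonneg (-1)
  · have := Real.one_le_exp (x := 4 * L) (by linarith [hc.L_nonneg])
    nlinarith [h.gap_pos 0]

lemma big_of_mem (hc : Ctrl L Cs f) (h : CycOrbit f p q z) {k : ℤ} (h1 : -1 ≤ k) (h2 : k ≤ 1) :
    gap z 0 ≤ Real.exp (4 * L) * gap z k := by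
  obtain ⟨a, b, c⟩ := h.big_zero hc
  have : k = -1 ∨ k = 0 ∨ k = 1 := by omega
  rcases this with rfl | rfl | rfl <;> assumption

lemma big_near (hc : Ctrl L Cs f) (h : CycOrbit f p q z) {k : ℤ} (h1 : -1 ≤ k) (h2 : k ≤ 1) :
    Big L z k := by
  refine (h.big_of_mem hc h1 h2).trans (mul_le_mul_of_nonneg_right ?_ (h.gap_pos _).le)
  exact Real.exp_le_exp.mpr (by linarith [hc.L_nonneg])

lemma big_image (hc : Ctrl L Cs f) (h : CycOrbit f p q z) {k : ℤ} (h1 : -1 ≤ k) (h2 : k ≤ 1) :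
    Big L z (k + p) := by
  obtain ⟨ξ, _, e⟩ := h.exists_mvt hc.lift k 1
  have h3 := exp_neg_le_deriv hc ξ
  simp only [Function.iterate_one, Nat.cast_one, one_mul] at e
  have h4 := h.big_of_mem hc h1 h2
  have h5 := h.gap_pos k
  unfold Big
  calc gap z 0 ≤ Real.exp (4 * L) * gap z k := h4
    _ = Real.exp (5 * L) * (Real.exp (-L) * gap z k) := by
        rw [← mul_assoc, ← Real.exp_add]; ring_nf
    _ ≤ Real.exp (5 * L) * gap z (k + p) := by rw [← e]; gcongr
    _ ≤ _ := mul_le_mul_of_nonneg_right (Real.exp_le_exp.mpr (by linarith [hc.L_nonneg])) (h.gap_pos _).le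

/-- The natural large parameter of a periodic orbit. -/
def size (z : ℤ → ℝ) : ℝ := 2 / gap z 0

lemma two_le_size (h : CycOrbit f p q z) : 2 ≤ size z := by
  unfold size; rw [le_div_iff₀ (h.gap_pos 0)]; linarith [h.gap_zero_le_one]

lemma size_le (h : CycOrbit f p q z) : size z ≤ 2 * q := by
  unfold size; rw [div_le_iff₀ (h.gap_pos 0)]; linarith [h.one_le_q_mul]

lemma inv_gap_le_size (h : CycOrbit f p q z) : (gap z 0)⁻¹ ≤ size z := by
  unfold size; rw [div_eq_mul_inv]
  have := inv_pos.mpr (h.gap_pos 0); linarith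

lemma inv_gap_le (h : CycOrbit f p q z) {n : ℤ} (hn : Big L z n) :
    (gap z n)⁻¹ ≤ Real.exp (9 * L) * (gap z 0)⁻¹ := by
  rw [← div_eq_mul_inv, le_div_iff₀ (h.gap_pos 0), inv_mul_le_iff₀ (h.gap_pos n)]
  unfold Big at hn; linarith

lemma pb_deriv_iter (L : ℝ) (Cs : ℕ → ℝ) (j : ℕ) : ∃ N : ℕ, ∀ f p q z, Ctrl L Cs f → CycOrbit f p q z →
    ∀ n, Big L z n → ∀ l ≤ q,
    Bd (J z n) j 1 (size z ^ N * gap z (n + l * p)) (deriv f^[l]) := by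
  obtain ⟨C, hC0, hC⟩ := bd_deriv_iter L Cs j
  refine ⟨⌈C * Real.exp (9 * L) * Real.exp (9 * L) ^ j⌉₊ + (1 + j), fun f p q z hc h n hn l hl => ?_⟩
  have hg := h.gap_pos (n + l * p)
  have hgn := h.gap_pos n
  have hg0 := h.gap_pos 0
  have hB := h.two_le_size
  refine ((hC f p q z hc h n l hl).to_one (h.scale_nonneg n) (by positivity)).mono_const zero_le_one ?_
  have e1 : 1 ≤ Real.exp (9 * L) := Real.one_le_exp (by linarith [hc.L_nonneg])
  have h1 : Max.max 1 (scale z n) ≤ Real.exp (9 * L) * size z := by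
    refine max_le (by nlinarith) ?_
    have : √(gap z 0) ≤ 1 := Real.sqrt_le_one.mpr h.gap_zero_le_one
    calc scale z n = √(gap z 0) * (gap z n)⁻¹ := div_eq_mul_inv _ _
      _ ≤ 1 * (Real.exp (9 * L) * (gap z 0)⁻¹) :=
        mul_le_mul this (h.inv_gap_le hn) (by positivity) zero_le_one
      _ ≤ _ := by rw [one_mul]; exact mul_le_mul_of_nonneg_left h.inv_gap_le_size (by positivity)
  have h2 : (gap z n)⁻¹ ≤ Real.exp (9 * L) * size z :=
    (h.inv_gap_le hn).trans (mul_le_mul_of_nonneg_left h.inv_gap_le_size (by positivity))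
  calc C * (gap z (n + l * p) / gap z n) * Max.max 1 (scale z n) ^ j
      ≤ C * (gap z (n + l * p) * (Real.exp (9 * L) * size z)) * (Real.exp (9 * L) * size z) ^ j := by
        rw [div_eq_mul_inv]; gcongr
    _ = (C * Real.exp (9 * L) * Real.exp (9 * L) ^ j) * size z ^ (1 + j) * gap z (n + l * p) := by
        rw [mul_pow, pow_add, pow_one]; ring
    _ ≤ _ := by
        rw [pow_add (size z) ⌈_⌉₊]
        have := le_pow_ceil (C * Real.exp (9 * L) * Real.exp (9 * L) ^ j) hB
        gcongr

/-- The bump of a periodic orbit. -/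
def bump (L : ℝ) (z : ℤ → ℝ) : ℝ → ℝ :=
  cosBump ((z 0 + z 1) / 2) (gap z 0 / 2) (gap z 0 / 2 + Real.exp (-(4 * L)) * gap z 0)

lemma smooth_bump : Smooth (bump L z) := smooth_cosBump
lemma per_bump : Per (bump L z) := per_cosBump
lemma bump_nonneg (x : ℝ) : 0 ≤ bump L z x := cosBump_nonneg x
lemma bump_le_one (x : ℝ) : bump L z x ≤ 1 := cosBump_le_one x

lemma radii (hc : Ctrl L Cs f) (h : CycOrbit f p q z) (hM : gap z 0 ≤ 1 / 4) :
    0 ≤ gap z 0 / 2 ∧ gap z 0 / 2 < gap z 0 / 2 + Real.exp (-(4 * L)) * gap z 0 ∧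
    gap z 0 / 2 + (gap z 0 / 2 + Real.exp (-(4 * L)) * gap z 0) ≤ 1 / 2 := by
  have hg := h.gap_pos 0
  have e1 : Real.exp (-(4 * L)) ≤ 1 := Real.exp_le_one_iff.mpr (by linarith [hc.L_nonneg])
  have e2 := Real.exp_pos (-(4 * L))
  refine ⟨by positivity, by nlinarith, by nlinarith⟩

lemma bump_eq_one (hc : Ctrl L Cs f) (h : CycOrbit f p q z) (hM : gap z 0 ≤ 1 / 4) {x : ℝ}
    (hx : x ∈ J z 0) : bump L z x = 1 := by
  obtain ⟨a, b, c⟩ := h.radii hc hM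
  refine cosBump_eq_one a b c ?_
  have h1 : z 0 ≤ x := hx.1
  have h2 : x ≤ z 1 := by simpa [J] using hx.2
  simp only [gap, zero_add]
  rw [abs_le]
  constructor <;> linarith

lemma bump_eq_zero (hc : Ctrl L Cs f) (h : CycOrbit f p q z) (hM : gap z 0 ≤ 1 / 4) {x : ℝ}
    (hx : x ∈ Set.Icc (z 2) (z (q - 1))) : bump L z x = 0 := by
  obtain ⟨a, b, c⟩ := h.radii hc hM
  have e0 : Real.exp (-(4 * L)) * Real.exp (4 * L) = 1 := by rw [← Real.exp_add]; simp
  have e2 := Real.exp_pos (-(4 * L))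
  have h1 : Real.exp (-(4 * L)) * gap z 0 ≤ gap z 1 := by
    have := mul_le_mul_of_nonneg_left (h.big_zero hc).1 e2.le
    rwa [← mul_assoc, e0, one_mul] at this
  have h2 : Real.exp (-(4 * L)) * gap z 0 ≤ gap z (-1) := by
    have := mul_le_mul_of_nonneg_left (h.big_zero hc).2.1 e2.le
    rwa [← mul_assoc, e0, one_mul] at this
  have h3 : z (q - 1) = z (-1) + 1 := by rw [← h.per]; congr 1
  rw [h3] at hx
  simp only [gap, zero_add, show (1 : ℤ) + 1 = 2 by rfl, show (-1 : ℤ) + 1 = 0 by rfl] at h1 h2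
  refine cosBump_eq_zero a b c ?_ ?_ <;> simp only [gap, zero_add] <;> linarith [hx.1, hx.2]

lemma pb_bump (L : ℝ) (Cs : ℕ → ℝ) (j : ℕ) : ∃ N : ℕ, ∀ f p q z, Ctrl L Cs f → CycOrbit f p q z →
    gap z 0 ≤ 1 / 4 → PB Set.univ j (size z) N (bump L z) := by
  obtain ⟨N, hN⟩ := pb_cosBump j
  refine ⟨N * ((⌈Real.exp (4 * L)⌉₊ + 2) + 1), fun f p q z hc h hM => ?_⟩
  obtain ⟨a, b, c⟩ := h.radii hc hM
  refine hN (size z) _ _ _ h.two_le_size a b c _ ?_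
  have hg := h.gap_pos 0
  have e2 := Real.exp_pos (-(4 * L))
  have e0 : Real.exp (-(4 * L)) * Real.exp (4 * L) = 1 := by rw [← Real.exp_add]; simp
  have hB := h.two_le_size
  rw [pow_add]
  calc _ ≤ (Real.exp (-(4 * L)) * (gap z 0 * gap z 0))⁻¹ := by
        refine inv_anti₀ (by positivity) ?_
        have : 0 ≤ (Real.exp (-(4 * L)) * gap z 0) ^ 2 := by positivity
        nlinarith
    _ = Real.exp (4 * L) * ((gap z 0)⁻¹ * (gap z 0)⁻¹) := by
        rw [mul_inv, mul_inv, ← eq_inv_of_mul_eq_one_right e0]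
    _ ≤ size z ^ ⌈Real.exp (4 * L)⌉₊ * size z ^ 2 := by
        rw [pow_two]
        have := h.inv_gap_le_size
        have h5 := le_pow_ceil (Real.exp (4 * L)) hB
        gcongr

/-- The return map is close to a translation near the largest gap. -/
lemma return_small (L : ℝ) (Cs : ℕ → ℝ) (R : ℕ) (hR : 3 ≤ R) : ∃ C : ℝ, 0 < C ∧ ∀ f p q z,
    Ctrl L Cs f → CycOrbit f p q z → ∀ x ∈ Set.Icc (z (-1)) (z 2),
    |f^[q] x - p - x| ≤ C * √(gap z 0) ^ R := by
  obtain ⟨C, hC0, hC⟩ := bd_deriv_iter L Cs R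
  set E := Real.exp (4 * L) with hE
  have hE0 : 0 < E := Real.exp_pos _
  refine ⟨C * (E ^ R) ^ R * R ^ (R + 1), by positivity, fun f p q z hc h x hx => ?_⟩
  have hM := h.gap_pos 0
  set μ := √(gap z 0) with hμ
  have hμ0 : 0 < μ := Real.sqrt_pos.mpr hM
  have hμ2 : μ * μ = gap z 0 := Real.mul_self_sqrt hM.le
  have hE1 : 1 ≤ E := Real.one_le_exp (by linarith [hc.L_nonneg])
  have hgap : ∀ n : ℕ, gap z 0 ≤ E ^ n * gap z n := by
    intro n
    induction n with
    | zero => simp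
    | succ n ih =>
      have := h.gap_le_succ hc.lift hc.logLip hc.L_nonneg n
      rw [pow_succ]
      calc gap z 0 ≤ E ^ n * gap z n := ih
        _ ≤ E ^ n * (E * gap z (n + 1)) := by gcongr
        _ = _ := by push_cast; ring
  have hgap' : ∀ n : ℤ, -1 ≤ n → n < R → gap z 0 ≤ E ^ R * gap z n := by
    intro n h1 h2
    rcases (show n = -1 ∨ 0 ≤ n by omega) with rfl | h3
    · refine (h.big_zero hc).2.1.trans (mul_le_mul_of_nonneg_right ?_ (h.gap_pos _).le)
      exact le_self_pow₀ hE1 (by omega)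
    · lift n to ℕ using h3
      exact (hgap n).trans (mul_le_mul_of_nonneg_right (pow_le_pow_right₀ hE1 (by omega)) (h.gap_pos _).le)
  set u : ℝ → ℝ := fun x => f^[q] x - p - x with hu
  have hlift := hc.lift.iter q
  have hus : Smooth u := (hlift.smooth.sub contDiff_const).sub contDiff_id
  have hz : ∀ n, u (z n) = 0 := fun n => by
    simp only [hu]
    rw [h.iter, mul_comm, h.per_int]; ring
  have hRpos : (1 : ℝ) ≤ R := by exact_mod_cast (by omega : 1 ≤ R)
  have hder : ∀ y ∈ Set.Icc (z (-1)) (z (R - 1)), |iteratedDeriv (R + 1) u y| ≤ C * (E ^ R / μ) ^ R := by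
    intro y hy
    obtain ⟨n, hn⟩ := h.exists_mem y
    obtain ⟨n, hn, hn1, hn2⟩ : ∃ n, y ∈ J z n ∧ -1 ≤ n ∧ n < R := by
      rcases lt_or_ge n (-1) with h1 | h1
      · refine ⟨-1, ⟨hy.1, ?_⟩, le_rfl, by omega⟩
        have := h.mono.monotone (show n + 1 ≤ -1 + 1 by omega)
        exact hn.2.trans this
      rcases lt_or_ge n R with h2 | h2
      · exact ⟨n, hn, h1, h2⟩
      · have := h.mono (show (R : ℤ) - 1 < n by omega)
        linarith [hn.1, hy.2]
    have e1 : iteratedDeriv (R + 1) u y = iteratedDeriv R (deriv f^[q]) y := by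
      have : deriv u = fun y => deriv f^[q] y - 1 := by
        funext y
        exact ((((hlift.smooth.hasDerivAt y).sub_const (p : ℝ))).sub (hasDerivAt_id y)).deriv
      obtain ⟨R', rfl⟩ : ∃ R', R = R' + 1 := ⟨R - 1, by omega⟩
      rw [iteratedDeriv_succ', this, iteratedDeriv_succ', iteratedDeriv_succ', deriv_sub_const_fun]
    rw [e1]
    have := hC f p q z hc h n q le_rfl R le_rfl y hn
    rw [show n + (q : ℤ) * p = n + p * q by ring, h.gap_per_int, div_self (h.gap_pos n).ne', mul_one] at this
    refine this.trans (mul_le_mul_of_nonneg_left (pow_le_pow_left₀ (h.scale_nonneg n) ?_ R) hC0.le)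
    unfold scale
    rw [div_le_div_iff₀ (h.gap_pos n) hμ0, hμ2]
    exact hgap' n hn1 hn2
  have hAB : z (-1) ≤ z (R - 1) := h.mono.monotone (by omega)
  have key := small_of_zeros (R + 1) u (fun i => z ((i : ℤ) - 1)) (z (-1)) (z (R - 1)) _ hus hAB
    (fun i hi => ⟨h.mono.monotone (by omega), h.mono.monotone (by omega)⟩)
    (fun i hi => h.mono (by push_cast; omega)) (fun i hi => hz _) hder x
    ⟨hx.1, hx.2.trans (h.mono.monotone (by omega))⟩
  have hlen : z (R - 1) - z (-1) ≤ R * gap z 0 := by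
    have := sub_eq_sum_gap (z := z) (-1) R
    rw [show (-1 : ℤ) + R = R - 1 by ring] at this
    rw [this]
    refine (Finset.sum_le_card_nsmul _ _ _ fun i _ => h.gap_le _).trans ?_
    simp
  refine key.trans ?_
  calc C * (E ^ R / μ) ^ R * (z (R - 1) - z (-1)) ^ (R + 1)
      ≤ C * (E ^ R / μ) ^ R * (R * gap z 0) ^ (R + 1) := by
        have : 0 ≤ z (R - 1) - z (-1) := by linarith
        gcongr
    _ = C * (E ^ R) ^ R * R ^ (R + 1) * (μ ^ R * (μ * μ)) := by
        rw [← hμ2, div_pow, mul_pow, mul_pow]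
        field_simp
        ring
    _ ≤ C * (E ^ R) ^ R * R ^ (R + 1) * (μ ^ R * 1) := by
        rw [hμ2]; have := h.gap_zero_le_one; gcongr
    _ = _ := by rw [mul_one]

end CycOrbit

/-- `f` is smoothly conjugate to the translation by `a`. -/
def IsSmoothConj (a : ℝ) (f : ℝ → ℝ) : Prop :=
  ∃ H : ℝ → ℝ, IsCircleDiffeoLift H ∧ ∀ x, H (f x) = H x + a

lemma exists_conj {H : ℝ → ℝ} {Q : ℝ} (hs : Smooth H) (hpos : ∀ x, 0 < deriv H x)
    (hper : ∀ x, H (x + 1) = H x + Q) (a : ℝ) : ∃ F, IsCircleDiffeoLift F ∧ IsSmoothConj a F ∧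
    (∀ x, H (F x) = H x + Q * a) ∧ ∀ x, deriv F x = deriv H x * (deriv H (F x))⁻¹ := by
  have hmono : StrictMono H := strictMono_of_deriv_pos hpos
  have hQ : 0 < Q := by have := hmono (zero_lt_one' ℝ); have := hper 0; rw [zero_add] at this; linarith
  set G : ℝ → ℝ := fun x => H x * Q⁻¹ with hG
  have hGd : ∀ x, deriv G x = deriv H x * Q⁻¹ := fun x => ((hs.hasDerivAt x).mul_const _).deriv
  have hGl : IsCircleDiffeoLift G := by
    refine ⟨hs.mul contDiff_const, fun x => ?_, fun x => ?_⟩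
    · simp only [hG, hper]; field_simp
    · rw [hGd]; have := hpos x; positivity
  have hF : IsCircleDiffeoLift (fun x => Function.invFun G (G x + a)) := hGl.inv.comp (hGl.add_const a)
  have hc : ∀ x, G (Function.invFun G (G x + a)) = G x + a := fun x => hGl.inv_right _
  have hHF : ∀ x, H (Function.invFun G (G x + a)) = H x + Q * a := fun x => by
    have h1 := hc x
    generalize Function.invFun G (G x + a) = y at h1 ⊢
    simp only [hG] at h1
    have h2 := congrArg (· * Q) h1
    simp only [add_mul, inv_mul_cancel_right₀ hQ.ne'] at h2
    rw [h2, mul_comm a]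
  refine ⟨_, hF, ⟨G, hGl, hc⟩, hHF, fun x => ?_⟩
  have h1 : HasDerivAt (fun x => H (Function.invFun G (G x + a)))
      (deriv H (Function.invFun G (G x + a)) * deriv (fun x => Function.invFun G (G x + a)) x) x :=
    (hs.hasDerivAt _).comp x (hF.smooth.hasDerivAt x)
  rw [funext hHF] at h1
  have h2 := h1.unique ((hs.hasDerivAt x).add_const _)
  rw [← h2]
  have := (hpos (Function.invFun G (G x + a))).ne'
  field_simp

namespace CycOrbit
variable {f : ℝ → ℝ} {p : ℤ} {q : ℕ} {z : ℤ → ℝ} {L : ℝ} {Cs : ℕ → ℝ}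

lemma exists_mem_three {m : ℤ} {x : ℝ} (hx : x ∈ Set.Icc (z (m - 1)) (z (m + 2))) :
    ∃ k : ℤ, -1 ≤ k ∧ k ≤ 1 ∧ x ∈ J z (k + m) := by
  rcases le_total x (z m) with h1 | h1
  · exact ⟨-1, le_rfl, by norm_num, by rw [show -1 + m = m - 1 by ring]; exact hx.1, by
      rw [show -1 + m + 1 = m by ring]; exact h1⟩
  rcases le_total x (z (m + 1)) with h2 | h2
  · exact ⟨0, by norm_num, by norm_num, by rwa [zero_add], by rwa [zero_add]⟩
  · exact ⟨1, by norm_num, le_rfl, by rwa [add_comm], by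
      rw [show 1 + m + 1 = m + 2 by ring]; exact hx.2⟩

lemma exists_int_mem (h : CycOrbit f p q z) (x : ℝ) : ∃ k : ℤ,
    x + k ∈ Set.Icc (z (-1)) (z 2) ∨ (z 2 < z (q - 1) ∧ x + k ∈ Set.Icc (z 2) (z (q - 1))) := by
  have e : z (q - 1) = z (-1) + 1 := by rw [← h.per]; congr 1
  refine ⟨-⌊x - z (-1)⌋, ?_⟩
  have h1 := Int.floor_le (x - z (-1))
  have h2 := Int.lt_floor_add_one (x - z (-1))
  push_cast
  rcases le_or_gt (x + -(⌊x - z (-1)⌋ : ℝ)) (z 2) with h3 | h3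
  · exact Or.inl ⟨by linarith, h3⟩
  · exact Or.inr ⟨by linarith, h3.le, by linarith⟩

lemma bump_int (x : ℝ) (k : ℤ) : bump L z (x + k) = bump L z x := per_bump.int x k

/-- The number of visits to the bump. -/
def visits (f : ℝ → ℝ) (L : ℝ) (q : ℕ) (z : ℤ → ℝ) : ℝ → ℝ :=
  fun x => ∑ i ∈ Finset.range q, bump L z (f^[i] x)

/-- Minus the total time of the visits to the bump. -/
def times (f : ℝ → ℝ) (L : ℝ) (q : ℕ) (z : ℤ → ℝ) : ℝ → ℝ :=
  fun x => ∑ i ∈ Finset.range q, -(i : ℝ) * bump L z (f^[i] x)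

/-- Minus the mean time of the visits to the bump. -/
def clock (f : ℝ → ℝ) (L : ℝ) (q : ℕ) (z : ℤ → ℝ) : ℝ → ℝ :=
  fun x => times f L q z x * (visits f L q z x)⁻¹

/-- The sum of the primitive of the bump along an orbit. -/
def coord (f : ℝ → ℝ) (L : ℝ) (q : ℕ) (z : ℤ → ℝ) : ℝ → ℝ :=
  fun x => ∑ i ∈ Finset.range q, prim (bump L z) (f^[i] x)

lemma smooth_bump_iter (hf : IsCircleDiffeoLift f) (i : ℕ) : Smooth fun x => bump L z (f^[i] x) :=
  smooth_bump.comp (hf.iter i).smooth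

lemma smooth_visits (hf : IsCircleDiffeoLift f) : Smooth (visits f L q z) :=
  ContDiff.sum fun i _ => smooth_bump_iter hf i

lemma smooth_times (hf : IsCircleDiffeoLift f) : Smooth (times f L q z) :=
  ContDiff.sum fun i _ => contDiff_const.mul (smooth_bump_iter hf i)

lemma smooth_coord (hf : IsCircleDiffeoLift f) : Smooth (coord f L q z) :=
  ContDiff.sum fun i _ => (smooth_prim smooth_bump).comp (hf.iter i).smooth

lemma deriv_coord (hf : IsCircleDiffeoLift f) : deriv (coord f L q z) =
    fun x => ∑ i ∈ Finset.range q, bump L z (f^[i] x) * deriv f^[i] x := by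
  funext x
  have : HasDerivAt (coord f L q z) (∑ i ∈ Finset.range q, bump L z (f^[i] x) * deriv f^[i] x) x := by
    refine HasDerivAt.fun_sum fun i _ => ?_
    have := ((smooth_prim (smooth_bump (L := L) (z := z))).hasDerivAt (f^[i] x)).comp x
      ((hf.iter i).smooth.hasDerivAt x)
    rwa [deriv_prim smooth_bump.continuous] at this
  exact this.deriv

/-- Each orbit segment of length `q` meets the largest gap. -/
lemma exists_visit (hf : IsCircleDiffeoLift f) (h : CycOrbit f p q z) {n : ℤ} {x : ℝ} (hx : x ∈ J z n) :
    ∃ i < q, (∃ k : ℤ, f^[i] x + k ∈ J z 0) ∧ gap z (n + i * p) = gap z 0 := by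
  obtain ⟨i, hi, k, e⟩ := h.exists_rep n 0
  refine ⟨i, hi, ⟨k, ?_⟩, ?_⟩
  · have := h.iter_mem hf hx i
    rw [J, e, h.per_int, show n + i * p + k * q + 1 = n + 1 + i * p + k * q by ring, h.per_int]
    exact ⟨by linarith [this.1], by linarith [this.2]⟩
  · rw [e, h.gap_per_int]

lemma one_le_visits (hc : Ctrl L Cs f) (h : CycOrbit f p q z) (hM : gap z 0 ≤ 1 / 4) (x : ℝ) :
    1 ≤ visits f L q z x := by
  obtain ⟨n, hn⟩ := h.exists_mem x
  obtain ⟨i, hi, ⟨k, hk⟩, _⟩ := h.exists_visit hc.lift hn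
  rw [← h.bump_eq_one hc hM hk, bump_int]
  exact Finset.single_le_sum (f := fun i => bump L z (f^[i] x)) (fun i _ => bump_nonneg _) (Finset.mem_range.mpr hi)

lemma le_deriv_coord (hc : Ctrl L Cs f) (h : CycOrbit f p q z) (hM : gap z 0 ≤ 1 / 4) {n : ℤ} {x : ℝ}
    (hx : x ∈ J z n) : Real.exp (-(2 * L)) * (gap z 0 / gap z n) ≤ deriv (coord f L q z) x := by
  obtain ⟨i, hi, ⟨k, hk⟩, e⟩ := h.exists_visit hc.lift hx
  rw [deriv_coord hc.lift]
  refine le_trans ?_ (Finset.single_le_sum (f := fun i => bump L z (f^[i] x) * deriv f^[i] x)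
    (fun i _ => mul_nonneg (bump_nonneg _) ((hc.lift.iter i).pos x).le) (Finset.mem_range.mpr hi))
  rw [← bump_int _ k, h.bump_eq_one hc hM hk, one_mul, ← mul_div_assoc, div_le_iff₀ (h.gap_pos n), ← e]
  have := h.le_deriv_iter hc.lift hc.logLip hc.L_nonneg (l := i) (by omega) hx
  have e0 : Real.exp (-(2 * L)) * Real.exp (2 * L) = 1 := by rw [← Real.exp_add]; simp
  calc _ ≤ Real.exp (-(2 * L)) * (Real.exp (2 * L) * (deriv f^[i] x * gap z n)) := by gcongr
    _ = _ := by rw [← mul_assoc, e0, one_mul]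

lemma abs_times_le (f : ℝ → ℝ) (L : ℝ) (q : ℕ) (z : ℤ → ℝ) (x : ℝ) : |times f L q z x| ≤ q * visits f L q z x := by
  unfold times visits
  rw [Finset.mul_sum]
  refine (Finset.abs_sum_le_sum_abs _ _).trans (Finset.sum_le_sum fun i hi => ?_)
  rw [abs_mul, abs_neg, Nat.abs_cast, abs_of_nonneg (bump_nonneg _)]
  refine mul_le_mul_of_nonneg_right ?_ (bump_nonneg _)
  exact_mod_cast (Finset.mem_range.mp hi).le

lemma abs_clock_le (hc : Ctrl L Cs f) (h : CycOrbit f p q z) (hM : gap z 0 ≤ 1 / 4) (x : ℝ) :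
    |clock f L q z x| ≤ q := by
  have h1 := h.one_le_visits hc hM x
  unfold clock
  rw [abs_mul, abs_inv, abs_of_pos (by linarith : 0 < visits f L q z x), ← div_eq_mul_inv,
    div_le_iff₀ (by linarith)]
  exact abs_times_le _ _ _ _ _

lemma smooth_clock (hc : Ctrl L Cs f) (h : CycOrbit f p q z) (hM : gap z 0 ≤ 1 / 4) :
    Smooth (clock f L q z) :=
  (smooth_times hc.lift).mul ((smooth_visits hc.lift).inv fun x => by
    have := h.one_le_visits hc hM x; linarith)

lemma visits_comp (x : ℝ) : visits f L q z (f x) = visits f L q z x + bump L z (f^[q] x) - bump L z x := by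
  unfold visits
  have h1 := Finset.sum_range_succ (fun i => bump L z (f^[i] x)) q
  rw [Finset.sum_range_succ'] at h1
  simp only [Function.iterate_succ_apply, Function.iterate_zero, id] at h1
  linarith

lemma times_comp (x : ℝ) : times f L q z (f x) =
    times f L q z x + visits f L q z (f x) - q * bump L z (f^[q] x) := by
  unfold visits times
  have h1 := Finset.sum_range_succ (fun i => -(i : ℝ) * bump L z (f^[i] x)) q
  rw [Finset.sum_range_succ'] at h1
  simp only [Function.iterate_succ_apply, Function.iterate_zero, id, Nat.cast_add, Nat.cast_one,
    Nat.cast_zero, neg_zero, zero_mul, add_zero] at h1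
  have h2 : ∑ i ∈ Finset.range q, -((i : ℝ) + 1) * bump L z (f^[i] (f x)) =
      ∑ i ∈ Finset.range q, -(i : ℝ) * bump L z (f^[i] (f x)) - ∑ i ∈ Finset.range q, bump L z (f^[i] (f x)) := by
    rw [← Finset.sum_sub_distrib]
    exact Finset.sum_congr rfl fun i _ => by ring
  linarith

lemma clock_comp (hc : Ctrl L Cs f) (h : CycOrbit f p q z) (hM : gap z 0 ≤ 1 / 4) {x : ℝ}
    (h0 : bump L z x = 0) (h1 : bump L z (f^[q] x) = 0) :
    clock f L q z (f x) = clock f L q z x + 1 := by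
  have h3 := h.one_le_visits hc hM x
  unfold clock
  have h4 : visits f L q z x ≠ 0 := (by linarith : 0 < visits f L q z x).ne'
  rw [times_comp, visits_comp, h0, h1, add_zero, sub_zero, mul_zero, sub_zero, add_mul, mul_inv_cancel₀ h4]

lemma coord_comp (x : ℝ) : coord f L q z (f x) =
    coord f L q z x + prim (bump L z) (f^[q] x) - prim (bump L z) x := by
  unfold coord
  have h1 := Finset.sum_range_succ (fun i => prim (bump L z) (f^[i] x)) q
  rw [Finset.sum_range_succ'] at h1
  simp only [Function.iterate_succ_apply, Function.iterate_zero, id] at h1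
  linarith

lemma prim_bump_one : 0 ≤ prim (bump L z) 1 ∧ prim (bump L z) 1 ≤ 1 := by
  unfold prim
  constructor
  · exact intervalIntegral.integral_nonneg zero_le_one fun x _ => bump_nonneg x
  · have := intervalIntegral.integral_mono_on (μ := volume) (zero_le_one' ℝ)
      ((smooth_bump (L := L) (z := z)).continuous.intervalIntegrable 0 1)
      (continuous_const (y := (1 : ℝ)).intervalIntegrable 0 1) (fun x _ => bump_le_one x)
    simpa using this

lemma prim_bump_int (x : ℝ) (k : ℤ) :
    prim (bump L z) (x + k) = prim (bump L z) x + k * prim (bump L z) 1 :=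
  prim_add_int smooth_bump.continuous per_bump x k

lemma coord_add_one (hf : IsCircleDiffeoLift f) (x : ℝ) :
    coord f L q z (x + 1) = coord f L q z x + q * prim (bump L z) 1 := by
  unfold coord
  rw [Finset.sum_congr rfl fun i _ => show prim (bump L z) (f^[i] (x + 1)) =
    prim (bump L z) (f^[i] x) + prim (bump L z) 1 by
      rw [(hf.iter i).2.1, prim_add_one smooth_bump.continuous per_bump], Finset.sum_add_distrib]
  simp

lemma visits_add_one (hf : IsCircleDiffeoLift f) (x : ℝ) : visits f L q z (x + 1) = visits f L q z x := by
  unfold visits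
  exact Finset.sum_congr rfl fun i _ => by rw [(hf.iter i).2.1, per_bump]

lemma times_add_one (hf : IsCircleDiffeoLift f) (x : ℝ) : times f L q z (x + 1) = times f L q z x := by
  unfold times
  exact Finset.sum_congr rfl fun i _ => by rw [(hf.iter i).2.1, per_bump]

/-- The approximate conjugacy to the translation by `p / q + ω`. -/
def chart (f : ℝ → ℝ) (L : ℝ) (q : ℕ) (z : ℤ → ℝ) (ω : ℝ) : ℝ → ℝ :=
  fun x => coord f L q z x + q * prim (bump L z) 1 * ω * clock f L q z x

lemma smooth_chart (hc : Ctrl L Cs f) (h : CycOrbit f p q z) (hM : gap z 0 ≤ 1 / 4) (ω : ℝ) :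
    Smooth (chart f L q z ω) :=
  (smooth_coord hc.lift).add (contDiff_const.mul (h.smooth_clock hc hM))

lemma deriv_chart (hc : Ctrl L Cs f) (h : CycOrbit f p q z) (hM : gap z 0 ≤ 1 / 4) (ω : ℝ) :
    deriv (chart f L q z ω) = fun x => deriv (coord f L q z) x +
      q * prim (bump L z) 1 * ω * deriv (clock f L q z) x := by
  funext x
  exact (((smooth_coord hc.lift).hasDerivAt x).add
    (((h.smooth_clock hc hM).hasDerivAt x).const_mul _)).deriv

lemma chart_add_one (hf : IsCircleDiffeoLift f) (ω x : ℝ) :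
    chart f L q z ω (x + 1) = chart f L q z ω x + q * prim (bump L z) 1 := by
  unfold chart clock
  rw [coord_add_one hf, visits_add_one hf, times_add_one hf]; ring

lemma chart_comp (h : CycOrbit f p q z) (a x : ℝ) :
    chart f L q z (a - p / q) (f x) - (chart f L q z (a - p / q) x + q * prim (bump L z) 1 * a) =
    (prim (bump L z) (f^[q] x - p) - prim (bump L z) x) +
      q * prim (bump L z) 1 * (a - p / q) * (clock f L q z (f x) - clock f L q z x - 1) := by
  have hq : (q : ℝ) ≠ 0 := by exact_mod_cast h.q_pos.ne'
  have := prim_bump_int (L := L) (z := z) (f^[q] x) (-p)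
  push_cast at this
  rw [sub_eq_add_neg (f^[q] x), this]
  unfold chart
  rw [coord_comp]
  field_simp
  ring

end CycOrbit

namespace CycOrbit
variable {f : ℝ → ℝ} {p : ℤ} {q : ℕ} {z : ℤ → ℝ} {L : ℝ} {Cs : ℕ → ℝ}

lemma gap_le_one (h : CycOrbit f p q z) (n : ℤ) : gap z n ≤ 1 := (h.gap_le n).trans h.gap_zero_le_one

lemma pb_bump_iter (L : ℝ) (Cs : ℕ → ℝ) (j : ℕ) : ∃ N : ℕ, ∀ f p q z, Ctrl L Cs f → CycOrbit f p q z →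
    gap z 0 ≤ 1 / 4 → ∀ n, Big L z n → ∀ l ≤ q, PB (J z n) j (size z) N (fun x => bump L z (f^[l] x)) := by
  obtain ⟨N₁, h1⟩ := pb_bump L Cs (j + 1)
  obtain ⟨N₂, h2⟩ := pb_deriv_iter L Cs j
  refine ⟨N₁ + (j + N₂) * (j + 1), fun f p q z hc h hM n hn l hl => ?_⟩
  have hB := h.two_le_size
  have h3 : PB (J z n) j (size z) N₂ (deriv f^[l]) := (h2 f p q z hc h n hn l hl).mono_const zero_le_one
    (mul_le_of_le_one_right (by positivity) (h.gap_le_one _))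
  exact (PB.comp_succ hB (hc.lift.iter l).smooth smooth_bump (Set.mapsTo_univ _ _)
    (h1 f p q z hc h hM) h3).mono_order (by omega)

lemma pb_deriv_coord (L : ℝ) (Cs : ℕ → ℝ) (j : ℕ) : ∃ N : ℕ, ∀ f p q z, Ctrl L Cs f → CycOrbit f p q z →
    gap z 0 ≤ 1 / 4 → ∀ n, Big L z n → PB (J z n) j (size z) N (deriv (coord f L q z)) := by
  obtain ⟨N₁, h1⟩ := pb_bump_iter L Cs j
  obtain ⟨N₂, h2⟩ := pb_deriv_iter L Cs j
  refine ⟨j + (N₁ + N₂), fun f p q z hc h hM n hn => ?_⟩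
  have hB := h.two_le_size
  rw [deriv_coord hc.lift]
  refine (Bd.finset_sum (Finset.range q) (c := fun i => 2 ^ j * (size z ^ N₁ * (size z ^ N₂ * gap z (n + i * p))))
    (fun i _ => (smooth_bump_iter hc.lift i).mul (hc.lift.iter i).smooth.deriv) fun i hi =>
      Bd.mul zero_le_one (smooth_bump_iter hc.lift i) (hc.lift.iter i).smooth.deriv
        (h1 f p q z hc h hM n hn i (Finset.mem_range.mp hi).le)
        (h2 f p q z hc h n hn i (Finset.mem_range.mp hi).le)).mono_const zero_le_one ?_
  rw [← Finset.mul_sum, ← Finset.mul_sum, ← Finset.mul_sum, h.sum_gap, mul_one, pow_add, pow_add]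
  have := PB.two_pow hB j
  gcongr

lemma two_le_two_mul (h : CycOrbit f p q z) : (2 : ℝ) ≤ 2 * q := h.two_le_size.trans h.size_le

lemma size_pow_le (h : CycOrbit f p q z) (N : ℕ) : size z ^ N ≤ (2 * q : ℝ) ^ N :=
  pow_le_pow_left₀ (by linarith [h.two_le_size]) h.size_le N

lemma pb_clock (L : ℝ) (Cs : ℕ → ℝ) (j : ℕ) : ∃ N : ℕ, ∀ f p q z, Ctrl L Cs f → CycOrbit f p q z →
    gap z 0 ≤ 1 / 4 → ∀ n, Big L z n → PB (J z n) j (2 * q) N (clock f L q z) := by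
  obtain ⟨N, h1⟩ := pb_bump_iter L Cs j
  refine ⟨j + ((N + 2) + (0 + (2 * j + (0 + (N + 1))) * 3 ^ j)), fun f p q z hc h hM n hn => ?_⟩
  have hB := h.two_le_two_mul
  have hS := h.size_pow_le N
  have hq : (0 : ℝ) ≤ q := Nat.cast_nonneg q
  have h2 : PB (J z n) j (2 * q) (N + 1) (visits f L q z) := by
    refine (Bd.finset_sum (Finset.range q) (c := fun _ => size z ^ N)
      (fun i _ => smooth_bump_iter hc.lift i) fun i hi =>
        h1 f p q z hc h hM n hn i (Finset.mem_range.mp hi).le).mono_const zero_le_one ?_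
    rw [Finset.sum_const, Finset.card_range, nsmul_eq_mul, pow_succ, mul_comm]
    gcongr
    linarith
  have h3 : PB (J z n) j (2 * q) (N + 2) (times f L q z) := by
    refine (Bd.finset_sum (Finset.range q) (c := fun _ => q * size z ^ N)
      (fun i _ => contDiff_const.mul (smooth_bump_iter hc.lift i)) fun i hi =>
        (Bd.const_mul _ (h1 f p q z hc h hM n hn i (Finset.mem_range.mp hi).le)).mono_const zero_le_one ?_).mono_const
          zero_le_one ?_
    · rw [abs_neg, Nat.abs_cast]
      refine mul_le_mul_of_nonneg_right ?_ (by have := h.two_le_size; positivity)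
      exact_mod_cast (Finset.mem_range.mp hi).le
    · rw [Finset.sum_const, Finset.card_range, nsmul_eq_mul, pow_succ, pow_succ, mul_comm, mul_comm (q : ℝ)]
      gcongr <;> linarith
  have hv : ∀ x, 0 < visits f L q z x := fun x => by linarith [h.one_le_visits hc hM x]
  exact h3.mul hB (smooth_times hc.lift) ((smooth_visits hc.lift).inv fun x => (hv x).ne')
    (h2.inv hB (smooth_visits hc.lift) hv fun x _ => by simpa using h.one_le_visits hc hM x)

lemma abs_coeff_le (ω : ℝ) : |q * prim (bump L z) 1 * ω| ≤ |ω| * (2 * q) := by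
  have hb := prim_bump_one (L := L) (z := z)
  rw [abs_mul, abs_mul, Nat.abs_cast, abs_of_nonneg hb.1, mul_comm]
  have : (0 : ℝ) ≤ q := Nat.cast_nonneg q
  refine mul_le_mul_of_nonneg_left ?_ (abs_nonneg _)
  nlinarith [hb.2]

lemma pb_deriv_chart (L : ℝ) (Cs : ℕ → ℝ) (j : ℕ) : ∃ N K : ℕ, ∀ f p q z, Ctrl L Cs f → CycOrbit f p q z →
    gap z 0 ≤ 1 / 4 → ∀ ω : ℝ, |ω| * (2 * q) ^ K ≤ 1 → ∀ n, Big L z n →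
    PB (J z n) j (size z) N (deriv (chart f L q z ω)) := by
  obtain ⟨N₁, h1⟩ := pb_deriv_coord L Cs j
  obtain ⟨N₂, h2⟩ := pb_clock L Cs (j + 1)
  refine ⟨N₁ + 0 + 1, N₂ + 1, fun f p q z hc h hM ω hω n hn => ?_⟩
  have hB := h.two_le_size
  have hs := h.smooth_clock hc hM
  have h3 : PB (J z n) j (2 * q) N₂ (deriv (clock f L q z)) :=
    (Bd.succ_iff.mp (h2 f p q z hc h hM n hn)).2.mono_const zero_le_one (by rw [mul_one])
  rw [h.deriv_chart hc hM]
  have h4 : PB (J z n) j (size z) 0 (fun x => q * prim (bump L z) 1 * ω * deriv (clock f L q z) x) := by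
    refine (Bd.const_mul _ h3).mono_const zero_le_one ?_
    rw [pow_zero]
    refine le_trans ?_ hω
    rw [pow_succ', ← mul_assoc]
    exact mul_le_mul_of_nonneg_right (abs_coeff_le ω) (by positivity)
  exact (h1 f p q z hc h hM n hn).add hB (smooth_coord hc.lift).deriv (contDiff_const.mul hs.deriv) h4

lemma abs_sum_bump_le {N : ℕ} (hc : Ctrl L Cs f) (h : CycOrbit f p q z)
    (hb : PB Set.univ 1 (size z) N (bump L z)) {n : ℤ} {x c : ℝ} (hx : x ∈ J z n) (e : ℕ → ℝ)
    (he : ∀ i < q, |e i| ≤ c) (hc0 : 0 ≤ c) :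
    |∑ i ∈ Finset.range q, e i * (deriv (bump L z) (f^[i] x) * deriv f^[i] x)| ≤
      c * (size z ^ N * Real.exp (2 * L) * (gap z n)⁻¹) := by
  have hg := h.gap_pos n
  calc _ ≤ ∑ i ∈ Finset.range q, c * (size z ^ N * Real.exp (2 * L) * (gap z n)⁻¹) * gap z (n + i * p) := by
        refine (Finset.abs_sum_le_sum_abs _ _).trans (Finset.sum_le_sum fun i hi => ?_)
        have hi' := Finset.mem_range.mp hi
        have h1 := h.deriv_iter_le' hc (l := i) (by omega) hx
        have h2 : |deriv (bump L z) (f^[i] x)| ≤ size z ^ N := by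
          simpa using hb 1 le_rfl (f^[i] x) trivial
        have h3 := (hc.lift.iter i).pos x
        have h4 := h.gap_pos (n + i * p)
        rw [abs_mul, abs_mul, abs_of_pos h3]
        calc _ ≤ c * (size z ^ N * (Real.exp (2 * L) * (gap z (n + i * p) / gap z n))) := by
              have := he i hi'
              gcongr
              exact (abs_nonneg _).trans h2
          _ = _ := by rw [div_eq_mul_inv]; ring
    _ = _ := by rw [← Finset.mul_sum, h.sum_gap, mul_one]

lemma abs_deriv_clock_le {N : ℕ} (hc : Ctrl L Cs f) (h : CycOrbit f p q z) (hM : gap z 0 ≤ 1 / 4)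
    (hb : PB Set.univ 1 (size z) N (bump L z)) {n : ℤ} {x : ℝ} (hx : x ∈ J z n) :
    |deriv (clock f L q z) x| ≤ 2 * q * (size z ^ N * Real.exp (2 * L) * (gap z n)⁻¹) := by
  have hd : ∀ i, HasDerivAt (fun x => bump L z (f^[i] x)) (deriv (bump L z) (f^[i] x) * deriv f^[i] x) x :=
    fun i => (smooth_bump.hasDerivAt _).comp x ((hc.lift.iter i).smooth.hasDerivAt x)
  have h1 : HasDerivAt (times f L q z)
      (∑ i ∈ Finset.range q, -(i : ℝ) * (deriv (bump L z) (f^[i] x) * deriv f^[i] x)) x :=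
    HasDerivAt.fun_sum fun i _ => (hd i).const_mul _
  have h2 : HasDerivAt (visits f L q z)
      (∑ i ∈ Finset.range q, deriv (bump L z) (f^[i] x) * deriv f^[i] x) x :=
    HasDerivAt.fun_sum fun i _ => hd i
  have hT := h.abs_sum_bump_le hc hb hx (fun i => -(i : ℝ)) (c := q) (fun i hi => by
    rw [abs_neg, Nat.abs_cast]; exact_mod_cast hi.le) (Nat.cast_nonneg q)
  have hV := h.abs_sum_bump_le hc hb hx (fun i => 1) (c := 1) (fun i hi => by simp) zero_le_one
  simp only [one_mul] at hV
  have hv := h.one_le_visits hc hM x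
  have hcl := h.abs_clock_le hc hM x
  have h3 := h1.mul (h2.inv (by linarith : 0 < visits f L q z x).ne')
  rw [show deriv (clock f L q z) x = _ from h3.deriv]
  set T := ∑ i ∈ Finset.range q, -(i : ℝ) * (deriv (bump L z) (f^[i] x) * deriv f^[i] x)
  set V := ∑ i ∈ Finset.range q, deriv (bump L z) (f^[i] x) * deriv f^[i] x
  set D := size z ^ N * Real.exp (2 * L) * (gap z n)⁻¹
  have hv0 : 0 < visits f L q z x := by linarith
  have e : T * (visits f L q z)⁻¹ x + times f L q z x * (-V / visits f L q z x ^ 2) =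
      (T - clock f L q z x * V) * (visits f L q z x)⁻¹ := by
    simp only [clock, Pi.inv_apply]; field_simp; ring
  rw [e, abs_mul, abs_inv, abs_of_pos hv0]
  have h4 : |T - clock f L q z x * V| ≤ 2 * q * D := by
    refine (abs_sub _ _).trans ?_
    rw [abs_mul]
    have := mul_le_mul hcl hV (abs_nonneg _) (Nat.cast_nonneg q)
    linarith
  exact (mul_le_of_le_one_right (abs_nonneg _) (inv_le_one_of_one_le₀ hv)).trans h4

lemma le_deriv_chart (L : ℝ) (Cs : ℕ → ℝ) : ∃ K : ℕ, ∀ f p q z, Ctrl L Cs f → CycOrbit f p q z →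
    gap z 0 ≤ 1 / 4 → ∀ ω : ℝ, |ω| * (2 * q) ^ K ≤ 1 → ∀ x,
    Real.exp (-(2 * L)) / 2 ≤ deriv (chart f L q z ω) x := by
  obtain ⟨N, hN⟩ := pb_bump L Cs 1
  set M := ⌈2 * Real.exp (4 * L)⌉₊ with hMdef
  refine ⟨N + 3 + M, fun f p q z hc h hM ω hω x => ?_⟩
  obtain ⟨n, hn⟩ := h.exists_mem x
  have h1 := h.le_deriv_coord hc hM hn
  have h2 := h.abs_deriv_clock_le hc hM (hN f p q z hc h hM) hn
  have h3 : |q * prim (bump L z) 1 * ω| ≤ |ω| * (2 * q) := abs_coeff_le ω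
  have hg := h.gap_pos n
  have hg0 := h.gap_pos 0
  have hB := h.two_le_two_mul
  have hM' := le_pow_ceil (2 * Real.exp (4 * L)) hB
  rw [← hMdef] at hM'
  have hq := h.one_le_q_mul
  have e4 : Real.exp (4 * L) = Real.exp (2 * L) * Real.exp (2 * L) := by rw [← Real.exp_add]; ring_nf
  have e0 : Real.exp (-(2 * L)) * Real.exp (2 * L) = 1 := by rw [← Real.exp_add]; simp
  have e2 := Real.exp_pos (2 * L)
  have e3 := Real.exp_pos (-(2 * L))
  have key : |q * prim (bump L z) 1 * ω * deriv (clock f L q z) x| ≤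
      Real.exp (-(2 * L)) * (gap z 0 / gap z n) / 2 := by
    rw [abs_mul]
    calc _ ≤ |ω| * (2 * q) * (2 * q * (size z ^ N * Real.exp (2 * L) * (gap z n)⁻¹)) :=
          mul_le_mul h3 h2 (abs_nonneg _) (by positivity)
      _ ≤ |ω| * (2 * q) * (2 * q * ((2 * q) ^ N * Real.exp (2 * L) * (gap z n)⁻¹)) := by
          have := h.size_pow_le N
          gcongr
      _ = |ω| * (2 * q) ^ (N + 2) * (2 * Real.exp (4 * L)) * 1 * (Real.exp (-(2 * L)) * (gap z n)⁻¹ / 2) := by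
          rw [e4, pow_add]; linear_combination (-(|ω| * (2 * q)^N * (2 * q)^2 * Real.exp (2 * L) * (gap z n)⁻¹)) * e0
      _ ≤ |ω| * (2 * q) ^ (N + 2) * (2 * q) ^ M * (2 * q * gap z 0) * (Real.exp (-(2 * L)) * (gap z n)⁻¹ / 2) := by
          have : 1 ≤ 2 * q * gap z 0 := by linarith
          gcongr
      _ = |ω| * (2 * q) ^ (N + 3 + M) * (Real.exp (-(2 * L)) * (gap z 0 / gap z n) / 2) := by
          rw [div_eq_mul_inv (gap z 0), pow_add _ (N + 3), pow_add, pow_add]; ring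
      _ ≤ 1 * (Real.exp (-(2 * L)) * (gap z 0 / gap z n) / 2) := by gcongr
      _ = _ := one_mul _
  have h5 := neg_le_of_abs_le key
  rw [h.deriv_chart hc hM]
  have h6 : 1 ≤ gap z 0 / gap z n := (one_le_div hg).mpr (h.gap_le n)
  show _ ≤ deriv (coord f L q z) x + q * prim (bump L z) 1 * ω * deriv (clock f L q z) x
  nlinarith

end CycOrbit

namespace CycOrbit
variable {f F : ℝ → ℝ} {p : ℤ} {q : ℕ} {z : ℤ → ℝ} {L a : ℝ} {Cs : ℕ → ℝ}

lemma return_mem (hc : Ctrl L Cs f) (h : CycOrbit f p q z) {m n : ℤ} {x : ℝ} (hx : x ∈ Set.Icc (z m) (z n)) :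
    f^[q] x - p ∈ Set.Icc (z m) (z n) := by
  have h1 := h.iter_mem hc.lift hx q
  have e : ∀ m, z (m + q * p) = z m + p := fun m => by rw [mul_comm, h.per_int]
  rw [e, e] at h1
  exact ⟨by linarith [h1.1], by linarith [h1.2]⟩

lemma bump_return_eq_zero (hc : Ctrl L Cs f) (h : CycOrbit f p q z) (hM : gap z 0 ≤ 1 / 4) {x : ℝ}
    (hx : x ∈ Set.Icc (z 2) (z (q - 1))) : bump L z (f^[q] x) = 0 := by
  rw [← bump_int _ (-p)]
  push_cast
  exact h.bump_eq_zero hc hM (h.return_mem hc hx)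

lemma chart_comp_eq (hc : Ctrl L Cs f) (h : CycOrbit f p q z) (hM : gap z 0 ≤ 1 / 4) (a : ℝ) {x : ℝ}
    (hx : x ∈ Set.Icc (z 2) (z (q - 1))) :
    chart f L q z (a - p / q) (f x) = chart f L q z (a - p / q) x + q * prim (bump L z) 1 * a := by
  have h1 := h.chart_comp (L := L) a x
  have h2 := h.clock_comp hc hM (h.bump_eq_zero hc hM hx) (h.bump_return_eq_zero hc hM hx)
  have h3 : prim (bump L z) (f^[q] x - p) = prim (bump L z) x :=
    eq_of_deriv_zero (smooth_prim smooth_bump) (fun y hy => by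
      rw [deriv_prim smooth_bump.continuous]; exact h.bump_eq_zero hc hM hy) (h.return_mem hc hx) hx
  rw [h2, h3] at h1
  linarith

lemma abs_prim_sub_le (x y : ℝ) : |prim (bump L z) y - prim (bump L z) x| ≤ |y - x| := by
  have := Convex.norm_image_sub_le_of_norm_deriv_le (f := prim (bump L z)) (s := Set.univ) (C := 1)
    (fun y _ => (smooth_prim smooth_bump).diff y) (fun y _ => by
      rw [deriv_prim smooth_bump.continuous, Real.norm_eq_abs, abs_of_nonneg (bump_nonneg _)]
      exact bump_le_one y) convex_univ (Set.mem_univ x) (Set.mem_univ y)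
  simpa using this

lemma chart_comp_le (hc : Ctrl L Cs f) (h : CycOrbit f p q z) (hM : gap z 0 ≤ 1 / 4) (a x : ℝ) :
    |chart f L q z (a - p / q) (f x) - (chart f L q z (a - p / q) x + q * prim (bump L z) 1 * a)| ≤
      |f^[q] x - p - x| + |a - p / q| * (2 * q) ^ 3 := by
  rw [h.chart_comp a x]
  refine (abs_add_le _ _).trans (add_le_add (abs_prim_sub_le _ _) ?_)
  rw [abs_mul]
  have hB := h.two_le_two_mul
  have h1 : |clock f L q z (f x) - clock f L q z x - 1| ≤ (2 * q) ^ 2 := by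
    have := abs_le.mp (h.abs_clock_le hc hM (f x))
    have := abs_le.mp (h.abs_clock_le hc hM x)
    rw [abs_le]
    constructor <;> nlinarith
  calc _ ≤ |a - p / q| * (2 * q) * (2 * q) ^ 2 := mul_le_mul (abs_coeff_le _) h1 (abs_nonneg _) (by positivity)
    _ = _ := by ring

lemma abs_sub_le_of_deriv {X : ℝ → ℝ} (hX : Smooth X) {c : ℝ} (h : ∀ x, c ≤ deriv X x) (u v : ℝ) :
    c * |u - v| ≤ |X u - X v| := by
  have key : ∀ u v, v ≤ u → c * |u - v| ≤ |X u - X v| := fun u v huv => by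
    rw [abs_of_nonneg (by linarith : 0 ≤ u - v)]
    exact (mul_sub_le_image_sub_of_le_deriv hX.diff h huv).trans (le_abs_self _)
  rcases le_total v u with h1 | h1
  · exact key u v h1
  · rw [abs_sub_comm, abs_sub_comm (X u)]; exact key v u h1

lemma pb_of_big {j N : ℕ} {B : ℝ} {u : ℝ → ℝ} {m : ℤ} (h : ∀ k : ℤ, -1 ≤ k → k ≤ 1 → PB (J z (k + m)) j B N u) :
    PB (Set.Icc (z (m - 1)) (z (m + 2))) j B N u := fun b hb x hx => by
  obtain ⟨k, h1, h2, h3⟩ := exists_mem_three hx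
  exact h k h1 h2 b hb x h3

/-- Bounds on a core and vanishing on the complement give global bounds of a periodic function. -/
lemma bound_of_core (h : CycOrbit f p q z) {u : ℝ → ℝ} (hu : Smooth u) (hp : Per u)
    (h0 : ∀ x ∈ Set.Icc (z 2) (z (q - 1)), u x = 0) {b : ℕ} {T : ℝ} (hT : 0 ≤ T)
    (hb : ∀ x ∈ Set.Icc (z (-1)) (z 2), |iteratedDeriv b u x| ≤ T) (x : ℝ) : |iteratedDeriv b u x| ≤ T := by
  obtain ⟨k, hk⟩ := h.exists_int_mem x
  rw [← (hp.iteratedDeriv b).int x k]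
  rcases hk with hk | ⟨hlt, hk⟩
  · exact hb _ hk
  · rw [iteratedDeriv_eq_zero_on hu hlt h0 b _ hk]; simpa using hT

lemma two_le_pred (h : CycOrbit f p q z) : z 2 ≤ z (q - 1) :=
  h.mono.monotone (by have := h.three_le; omega)

lemma z_pred (h : CycOrbit f p q z) : z (q - 1) = z (-1) + 1 := by rw [← h.per]; congr 1

lemma pb_deriv_solution (L : ℝ) (Cs : ℕ → ℝ) (j : ℕ) : ∃ N K : ℕ, ∀ f p q z, Ctrl L Cs f → CycOrbit f p q z →
    gap z 0 ≤ 1 / 4 → ∀ ω : ℝ, |ω| * (2 * q) ^ K ≤ 1 → ∀ F, Smooth F →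
    Set.MapsTo F (Set.Icc (z (-1)) (z 2)) (Set.Icc (z (p - 1)) (z (p + 2))) →
    (∀ x, deriv F x = deriv (chart f L q z ω) x * (deriv (chart f L q z ω) (F x))⁻¹) →
    PB (Set.Icc (z (-1)) (z 2)) j (size z) N (deriv F) := by
  obtain ⟨N, K₁, h1⟩ := pb_deriv_chart L Cs j
  obtain ⟨K₂, h2⟩ := le_deriv_chart L Cs
  set N₁ := ⌈(Real.exp (-(2 * L)) / 2)⁻¹⌉₊
  set N₂ := N + (N₁ + (2 * j + (N₁ + N)) * 3 ^ j)
  obtain ⟨N', h3⟩ := PB.of_ode j N₂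
  refine ⟨N', K₁ + K₂, fun f p q z hc h hM ω hω F hF hm he => ?_⟩
  have hB := h.two_le_size
  have hB2 := h.two_le_two_mul
  have hω1 : |ω| * (2 * q) ^ K₁ ≤ 1 := le_trans (mul_le_mul_of_nonneg_left
    (pow_le_pow_right₀ (by linarith) (by omega)) (abs_nonneg _)) hω
  have hω2 : |ω| * (2 * q) ^ K₂ ≤ 1 := le_trans (mul_le_mul_of_nonneg_left
    (pow_le_pow_right₀ (by linarith) (by omega)) (abs_nonneg _)) hω
  have hs := h.smooth_chart hc hM ω
  have hl := h2 f p q z hc h hM ω hω2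
  have he0 : 0 < Real.exp (-(2 * L)) / 2 := by positivity
  have hpos : ∀ x, 0 < deriv (chart f L q z ω) x := fun x => by linarith [hl x]
  have hinv : Smooth fun x => (deriv (chart f L q z ω) x)⁻¹ := hs.deriv.inv fun x => (hpos x).ne'
  refine h3 (size z) hB _ _ F _ _ hF hs.deriv hinv hm he (PB.mono (N := N) ?_ hB (by omega))
    (PB.mono (N := N₁ + (2 * j + (N₁ + N)) * 3 ^ j) ?_ hB (by omega))
  · exact pb_of_big (m := 0) fun k hk1 hk2 => h1 f p q z hc h hM ω hω1 _ (by
      rw [add_zero]; exact h.big_near hc hk1 hk2)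
  · refine PB.inv hB hs.deriv hpos (fun x _ => ?_) (pb_of_big fun k hk1 hk2 =>
      h1 f p q z hc h hM ω hω1 _ (h.big_image hc hk1 hk2))
    refine le_trans ?_ (hl x)
    exact inv_le_of_inv_le₀ he0 (le_pow_ceil _ hB)

/-- Near a diffeomorphism with a periodic orbit of small gaps, whose rotation number is a good
approximation of `a`, there is a diffeomorphism smoothly conjugate to the translation by `a`. -/
lemma surgery (L : ℝ) (Cs : ℕ → ℝ) (r : ℕ) {ε : ℝ} (hε : 0 < ε) : ∃ η : ℝ, 0 < η ∧ ∃ K : ℕ, ∀ f p q z,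
    Ctrl L Cs f → CycOrbit f p q z → gap z 0 ≤ η → ∀ a : ℝ, |a - p / q| * (2 * q) ^ K ≤ 1 →
    ∃ F, IsCircleDiffeoLift F ∧ IsSmoothConj a F ∧ Close r ε F f := by
  obtain ⟨Na, K₁, h1⟩ := pb_deriv_solution L Cs r
  obtain ⟨Nb, h2⟩ := pb_deriv_iter L Cs r
  obtain ⟨K₂, h3⟩ := le_deriv_chart L Cs
  set N := Na + Nb + 1
  set N₂ := (N + 1) * 2 ^ r
  obtain ⟨C, hC0, hC⟩ := return_small L Cs (2 * (N₂ + 1)) (by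
    have : 1 ≤ N₂ := Nat.one_le_iff_ne_zero.mpr (by positivity)
    omega)
  set c := Real.exp (-(2 * L)) / 2 with hcdef
  have hc0 : 0 < c := by positivity
  set P := ⌈2 / c⌉₊
  refine ⟨min (1 / 4) (min (ε / 4) (c / (2 * C * 2 ^ N₂))), by positivity, K₁ + K₂ + (3 + N₂ + P),
    fun f p q z hc h hη a ha => ?_⟩
  have hM : gap z 0 ≤ 1 / 4 := hη.trans (min_le_left _ _)
  have hη2 : gap z 0 ≤ ε / 4 := hη.trans ((min_le_right _ _).trans (min_le_left _ _))
  have hη3 : gap z 0 ≤ c / (2 * C * 2 ^ N₂) := hη.trans ((min_le_right _ _).trans (min_le_right _ _))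
  have hB := h.two_le_size
  have hB2 := h.two_le_two_mul
  have hsub : ∀ {k}, k ≤ K₁ + K₂ + (3 + N₂ + P) → |a - p / q| * (2 * q) ^ k ≤ 1 := fun hk =>
    le_trans (mul_le_mul_of_nonneg_left (pow_le_pow_right₀ (by linarith) hk) (abs_nonneg _)) ha
  set X := chart f L q z (a - p / q) with hX
  have hXs : Smooth X := h.smooth_chart hc hM _
  have hXl : ∀ x, c ≤ deriv X x := h3 f p q z hc h hM _ (hsub (by omega))
  obtain ⟨F, hF, hconj, hXF, hdF⟩ := exists_conj hXs (fun x => hc0.trans_le (hXl x))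
    (fun x => chart_add_one hc.lift _ x) a
  refine ⟨F, hF, hconj, ?_⟩
  have hdist : ∀ x, c * |F x - f x| ≤ |f^[q] x - p - x| + |a - p / q| * (2 * q) ^ 3 := fun x => by
    refine (abs_sub_le_of_deriv hXs hXl _ _).trans ?_
    rw [hXF, abs_sub_comm]
    exact h.chart_comp_le hc hM a x
  have hzero : ∀ x ∈ Set.Icc (z 2) (z (q - 1)), F x - f x = 0 := fun x hx => by
    have := abs_sub_le_of_deriv hXs hXl (F x) (f x)
    rw [hXF, ← h.chart_comp_eq hc hM a hx, ← hX, sub_self, abs_zero] at this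
    have h5 : |F x - f x| ≤ 0 := by
      by_contra! h6
      nlinarith
    exact abs_nonpos_iff.mp h5
  have hper := hF.per_sub hc.lift
  have hm : Set.MapsTo F (Set.Icc (z (-1)) (z 2)) (Set.Icc (z (p - 1)) (z (p + 2))) := fun x hx => by
    have e1 : F (z (-1)) = z (p - 1) := by
      have h6 := hper (z (-1))
      simp only at h6
      rw [← h.z_pred, hzero _ ⟨h.two_le_pred, le_rfl⟩, h.map, show -1 + p = p - 1 by ring] at h6
      linarith
    have e2 : F (z 2) = z (p + 2) := by
      have h6 := hzero _ ⟨le_rfl, h.two_le_pred⟩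
      rw [h.map, show 2 + p = p + 2 by ring] at h6
      linarith
    rw [← e1, ← e2]
    exact ⟨hF.strictMono.monotone hx.1, hF.strictMono.monotone hx.2⟩
  have hu : Smooth fun x => F x - f x := hF.smooth.sub hc.lift.smooth
  have hdu : deriv (fun x => F x - f x) = fun x => deriv F x - deriv f x :=
    funext fun x => deriv_fun_sub (hF.smooth.diff x) (hc.lift.smooth.diff x)
  have hB0 : 0 < size z := by linarith
  have hpd : PB (Set.Icc (z (-1)) (z 2)) r (size z) N (deriv fun x => F x - f x) := by
    rw [hdu]
    have h7 : PB (Set.Icc (z (-1)) (z 2)) r (size z) Nb (deriv f) :=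
      pb_of_big (m := 0) fun k hk1 hk2 => by
        have := h2 f p q z hc h (k + 0) (by rw [add_zero]; exact h.big_near hc hk1 hk2) 1
          (by have := h.three_le; omega)
        rw [Function.iterate_one] at this
        exact this.mono_const zero_le_one (mul_le_of_le_one_right (by positivity) (h.gap_le_one _))
    have h8 := h1 f p q z hc h hM _ (hsub (by omega)) F hF.smooth hm hdF
    simpa [sub_eq_add_neg] using PB.add hB hF.smooth.deriv hc.lift.smooth.deriv.neg h8 h7.neg
  have hsmall : ∀ x ∈ Set.Icc (z (-1)) (z 2), |F x - f x| ≤ (size z ^ N₂)⁻¹ := fun x hx => by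
    have h4 := hdist x
    have h5 := hC f p q z hc h x hx
    have e1 : √(gap z 0) ^ (2 * (N₂ + 1)) = gap z 0 * (2 ^ N₂ * (size z ^ N₂)⁻¹) := by
      have hg := h.gap_pos 0
      rw [pow_mul, Real.sq_sqrt hg.le, pow_succ', size, div_pow]
      field_simp
    rw [e1] at h5
    have h6 : C * (gap z 0 * (2 ^ N₂ * (size z ^ N₂)⁻¹)) ≤ c / 2 * (size z ^ N₂)⁻¹ := by
      rw [le_div_iff₀ (by positivity)] at hη3
      have : 0 ≤ (size z ^ N₂)⁻¹ := by positivity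
      nlinarith
    have h7 : |a - p / q| * (2 * q) ^ 3 ≤ c / 2 * (size z ^ N₂)⁻¹ := by
      have h8 := hsub (k := 3 + N₂ + P) (by omega)
      rw [pow_add, pow_add, ← mul_assoc, ← mul_assoc] at h8
      have h9 : 2 / c ≤ (2 * q) ^ P := le_pow_ceil _ hB2
      have h10 := h.size_pow_le N₂
      have h11 : |a - p / q| * (2 * q) ^ 3 * size z ^ N₂ * (2 / c) ≤ 1 := le_trans (by gcongr) h8
      rw [← div_eq_mul_inv, le_div_iff₀ (by positivity)]
      rw [mul_div_assoc', div_le_one hc0] at h11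
      linarith
    have : c * |F x - f x| ≤ c * (size z ^ N₂)⁻¹ := by linarith
    exact le_of_mul_le_mul_left this hc0
  have hT1 : ((size z)⁻¹) ^ (N + 1) ≤ 1 := pow_le_one₀ (by positivity) (inv_le_one_of_one_le₀ (by linarith))
  have hT2 : (size z ^ N₂)⁻¹ ≤ size z ^ N * (((size z)⁻¹) ^ (N + 1)) ^ 2 ^ r := by
    rw [← pow_mul, inv_pow]
    exact le_mul_of_one_le_left (by positivity) (one_le_pow₀ (by linarith))
  have hall : ∀ x, |F x - f x| ≤ (size z ^ N₂)⁻¹ := fun x => by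
    have := h.bound_of_core hu hper hzero (b := 0) (T := (size z ^ N₂)⁻¹) (by positivity)
      (fun x hx => by simpa using hsmall x hx) x
    simpa using this
  have hinterp := interp hu (T := size z ^ N) (s := ((size z)⁻¹) ^ (N + 1)) (r := r) (by positivity)
    (by positivity) (fun b hb x => ?_) (fun x => (hall x).trans hT2) hT1
  · intro b hb x
    refine (hinterp b hb x).trans ?_
    rw [inv_pow, pow_succ (size z) N, mul_inv, size]
    have hg := h.gap_pos 0
    have e : 8 * (2 / gap z 0) ^ N * (((2 / gap z 0) ^ N)⁻¹ * (2 / gap z 0)⁻¹) = 4 * gap z 0 := by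
      have : (2 / gap z 0) ^ N ≠ 0 := by positivity
      rw [mul_assoc, mul_inv_cancel_left₀ this]
      field_simp
      norm_num
    rw [e]
    linarith
  · cases b with
    | zero =>
      simp only [iteratedDeriv_zero]
      refine ((hall x).trans hT2).trans (mul_le_of_le_one_right (by positivity) (pow_le_one₀ (by positivity) hT1))
    | succ b =>
      refine h.bound_of_core hu hper hzero (by positivity) (fun y hy => ?_) x
      rw [iteratedDeriv_succ']
      simpa using hpd b (by omega) y hy

end CycOrbit

lemma Liouville.exists_approx {a : ℝ} (ha : Liouville a) (K M : ℕ) : ∃ (p : ℤ) (q : ℕ), M ≤ q ∧ 0 < q ∧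
    IsCoprime p (q : ℤ) ∧ |a - p / q| * (2 * q) ^ K ≤ 1 := by
  have h1 := ha.irrational.eventually_forall_le_dist_cast_rat_of_den_le M
  obtain ⟨δ, hδ0, hδ⟩ := Metric.eventually_nhds_iff.mp h1
  have h2 : dist (δ / 2) 0 < δ := by rw [Real.dist_eq, sub_zero, abs_of_pos (by linarith)]; linarith
  have h3 := hδ h2
  obtain ⟨n, hn⟩ := exists_nat_gt (2 / δ)
  obtain ⟨b, ⟨m, -, hm⟩, hb⟩ := ((ha.frequently_exists_num (2 * K + 1)).and_eventually
    (eventually_ge_atTop (max 2 n))).exists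
  have hb2 : (2 : ℝ) ≤ b := by exact_mod_cast (le_max_left _ _).trans hb
  have hbn : (n : ℝ) ≤ b := by exact_mod_cast (le_max_right _ _).trans hb
  set r : ℚ := (m : ℚ) / (b : ℤ) with hr
  have hrc : (r : ℝ) = m / b := by rw [hr]; push_cast; rfl
  have hrd : (r : ℝ) = r.num / r.den := by exact_mod_cast (Rat.num_div_den r).symm
  have hden : (r.den : ℝ) ≤ b := by
    have hbp : 0 < b := by have := (le_max_left _ _).trans hb; omega
    have hdvd : (r.den : ℤ) ∣ b := by
      have := Rat.den_dvd m b
      rwa [Rat.divInt_eq_div, ← hr] at this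
    exact Nat.cast_le.mpr (Nat.le_of_dvd hbp (Int.natCast_dvd_natCast.mp hdvd))
  have hb0 : (0 : ℝ) < b := by linarith
  rw [← hrc] at hm
  refine ⟨r.num, r.den, ?_, r.den_pos, ?_, ?_⟩
  · by_contra! hlt
    have h4 := h3 r hlt.le
    rw [Real.dist_eq] at h4
    have h5 : 1 / (b : ℝ) ^ (2 * K + 1) ≤ 1 / b := by
      refine one_div_le_one_div_of_le hb0 ?_
      exact le_self_pow₀ (by linarith) (by omega)
    have h6 : 1 / (b : ℝ) < δ / 2 := by
      rw [div_lt_iff₀ hδ0] at hn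
      rw [div_lt_div_iff₀ hb0 two_pos]
      nlinarith
    linarith
  · exact Int.isCoprime_iff_gcd_eq_one.mpr r.reduced
  · rw [← hrd]
    calc |a - r| * (2 * r.den) ^ K ≤ 1 / (b : ℝ) ^ (2 * K + 1) * (b * b) ^ K := by gcongr
      _ = 1 / b := by rw [← pow_two, ← pow_mul]; field_simp; ring
      _ ≤ 1 := by rw [div_le_one hb0]; linarith

lemma liouville_add_int {a : ℝ} (ha : Liouville a) (k : ℤ) : Liouville (a + k) :=
  forall_liouvilleWith_iff.mp fun p => (ha.liouvilleWith p).add_int k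

lemma deriv_add_const_fun (g : ℝ → ℝ) (t : ℝ) : deriv (fun x => g x + t) = deriv g :=
  funext fun _ => deriv_add_const t

lemma exists_ctrl {g : ℝ → ℝ} (hg : IsCircleDiffeoLift g) : ∃ L Cs, ∀ t, Ctrl L Cs (fun x => g x + t) := by
  obtain ⟨L, hL⟩ := hg.per_nonlin.bdd hg.smooth_nonlin.continuous
  choose Cs hCs using fun j => hg.per_schwarz.bdd_iter hg.smooth_schwarz j
  refine ⟨L, Cs, fun t => ⟨hg.add_const t, (abs_nonneg _).trans (hL 0), fun x y => ?_, fun j => ?_⟩⟩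
  · rw [deriv_add_const_fun]
    have hd : ∀ x, HasDerivAt (fun x => Real.log (deriv g x)) (nonlin g x) x := fun x => by
      have := (hg.smooth.deriv.hasDerivAt x).log (hg.pos x).ne'
      rwa [div_eq_mul_inv] at this
    have := Convex.norm_image_sub_le_of_norm_hasDerivWithin_le (f := fun x => Real.log (deriv g x))
      (s := Set.univ) (fun x _ => (hd x).hasDerivWithinAt) (fun x _ => hL x) convex_univ
      (Set.mem_univ y) (Set.mem_univ x)
    simpa using this
  · have : schwarz (fun x => g x + t) = schwarz g := by
      unfold schwarz nonlin
      rw [deriv_add_const_fun]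
    rw [this]
    exact (hCs j).2

/-- Diffeomorphisms smoothly conjugate to a Liouville rotation are dense. -/
lemma exists_close_conj {g : ℝ → ℝ} (hg : IsCircleDiffeoLift g) {a : ℝ} (ha : Liouville a) (hga : HasTrans g a)
    (r : ℕ) {ε : ℝ} (hε : 0 < ε) : ∃ F, IsCircleDiffeoLift F ∧ IsSmoothConj a F ∧ Close r ε F g := by
  obtain ⟨L, Cs, hc⟩ := exists_ctrl hg
  obtain ⟨η, hη, K, hs⟩ := CycOrbit.surgery L Cs r (half_pos hε)
  obtain ⟨γ, hγ, q₀, hq₀⟩ := max_gap_small ha.irrational (hc 0).L_nonneg (lt_min hη (half_pos hε))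
  obtain ⟨n, hn⟩ := exists_nat_gt (1 / γ)
  obtain ⟨p, q, hq, hq0, hcop, hap⟩ := ha.exists_approx (K + 3) (max 3 (max q₀ n))
  have hq3 : 3 ≤ q := (le_max_left _ _).trans hq
  have hqq : q₀ ≤ q := (le_max_left _ _).trans ((le_max_right _ _).trans hq)
  have hqn : (n : ℝ) ≤ q := by exact_mod_cast (le_max_right _ _).trans ((le_max_right _ _).trans hq)
  have hqr : (3 : ℝ) ≤ q := by exact_mod_cast hq3
  have hle : ∀ {k}, k ≤ K + 3 → |a - p / q| * (2 * q) ^ k ≤ 1 := fun hk =>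
    le_trans (mul_le_mul_of_nonneg_left (pow_le_pow_right₀ (by linarith) hk) (abs_nonneg _)) hap
  have hlt : |a - p / q| < 1 / (q : ℝ) ^ 2 := by
    have := hle (k := 2) (by omega)
    rw [lt_div_iff₀ (by positivity)]
    have h0 := abs_nonneg (a - p / q)
    rcases h0.eq_or_lt with h0 | h0
    · rw [← h0]; norm_num
    · nlinarith [mul_pos h0 (by positivity : (0 : ℝ) < (q : ℝ) ^ 2)]
  have hγ' : |(p / q : ℝ) - a| < γ := by
    rw [abs_sub_comm]
    refine hlt.trans ?_
    rw [div_lt_iff₀ hγ] at hn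
    rw [div_lt_iff₀ (by positivity)]
    nlinarith
  obtain ⟨t, z, hz⟩ := exists_shift_cycOrbit hg hcop hq3
  have hgap := hq₀ _ p q z (hg.add_const t) (hc t).logLip hz hqq hγ'
  obtain ⟨F, hF, hconj, hcl⟩ := hs _ p q z (hc t) hz (hgap.trans (min_le_left _ _)) a (hle (by omega))
  have ht : |t| ≤ ε / 2 := (cycOrbit_shift_le hg hga hz hlt).trans (by
    have := hgap.trans (min_le_right _ _)
    simpa [gap] using this)
  refine ⟨F, hF, hconj, ?_⟩
  have h2 : Close r (ε / 2) (fun x => g x + t) g := fun b hb x => by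
    have e : (fun x => g x + t - g x) = fun _ => t := by funext x; ring
    rw [e, iteratedDeriv_const]
    split_ifs
    · exact ht
    · simpa using (half_pos hε).le
  have := hcl.trans hF.smooth (hg.add_const t).smooth hg.smooth h2
  rwa [add_halves] at this

lemma Irrational.exists_nat_mul_sub_int_near {a : ℝ} (ha : Irrational a) (c : ℝ) {τ : ℝ} (hτ : 0 < τ) :
    ∃ (i : ℕ) (m : ℤ), |i * a - m - c| < τ := by
  obtain ⟨n, hn⟩ := exists_nat_gt (1 / τ)
  have hn0 : 0 < n := by
    have : (0 : ℝ) < n := (by positivity : 0 < 1 / τ).trans hn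
    exact_mod_cast this
  obtain ⟨k, hk0, -, hk⟩ := Real.exists_nat_abs_mul_sub_round_le a hn0
  set β : ℝ := k * a - round (k * a) with hβ
  have hβτ : |β| < τ := by
    refine hk.trans_lt ?_
    rw [div_lt_iff₀ (by positivity)]
    rw [div_lt_iff₀ hτ] at hn
    nlinarith
  have hβ0 : β ≠ 0 := fun h => by
    have h1 := (ha.natCast_mul hk0.ne').ne_int (round (k * a))
    exact h1 (by linarith)
  obtain ⟨j, m', hjm⟩ : ∃ (j : ℕ) (m' : ℤ), |j * β - (c + m')| ≤ |β| := by
    rcases lt_or_gt_of_ne hβ0 with hneg | hpos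
    · refine ⟨⌊(c + (-⌈c⌉ : ℤ)) / β⌋₊, -⌈c⌉, ?_⟩
      have h0 : 0 ≤ (c + (-⌈c⌉ : ℤ)) / β := by
        refine div_nonneg_of_nonpos ?_ hneg.le
        push_cast; linarith [Int.le_ceil c]
      have h1 := Nat.floor_le h0
      have h2 := Nat.lt_floor_add_one ((c + (-⌈c⌉ : ℤ)) / β)
      rw [le_div_iff_of_neg hneg] at h1
      rw [div_lt_iff_of_neg hneg] at h2
      rw [abs_of_neg hneg, abs_le]
      constructor <;> linarith
    · refine ⟨⌊(c + (-⌊c⌋ : ℤ)) / β⌋₊, -⌊c⌋, ?_⟩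
      have h0 : 0 ≤ (c + (-⌊c⌋ : ℤ)) / β := by
        refine div_nonneg ?_ hpos.le
        push_cast; linarith [Int.floor_le c]
      have h1 := Nat.floor_le h0
      have h2 := Nat.lt_floor_add_one ((c + (-⌊c⌋ : ℤ)) / β)
      rw [le_div_iff₀ hpos] at h1
      rw [div_lt_iff₀ hpos] at h2
      rw [abs_of_pos hpos, abs_le]
      constructor <;> linarith
  refine ⟨j * k, j * round (k * a) + m', ?_⟩
  have e : ((j * k : ℕ) : ℝ) * a - ((j * round (k * a) + m' : ℤ) : ℝ) - c = j * β - (c + m') := by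
    push_cast; rw [hβ]; ring
  rw [e]
  exact hjm.trans_lt hβτ

/-- Near `0` and on scale `κ`, moving by about `1/2` in the coordinate `A` rescales by about `t`. -/
lemma exists_model {t e : ℝ} (ht : 0 < t) (he : 0 < e) : ∃ A : ℝ → ℝ, IsCircleDiffeoLift A ∧
    ∃ κ > 0, κ ≤ 1 / 8 ∧ ∀ y s θ, |y| ≤ κ → |s - 1 / 2| ≤ κ → A θ = A y + s →
      |θ - 1 / 2| ≤ 1 / 8 ∧ |deriv A y / deriv A θ - t| ≤ e := by
  set c : ℝ := (t - 1) / (t + 1) with hc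
  have hc1 : -1 < c := by rw [hc, lt_div_iff₀ (by linarith)]; linarith
  have hc2 : c < 1 := by rw [hc, div_lt_iff₀ (by linarith)]; linarith
  have hπ := Real.pi_pos
  set A : ℝ → ℝ := fun y => y + c / (2 * Real.pi) * Real.sin (2 * Real.pi * y) with hA
  have hd : ∀ y, deriv A y = 1 + c * Real.cos (2 * Real.pi * y) := fun y => by
    have h1 := (((hasDerivAt_id y).const_mul (2 * Real.pi)).sin.const_mul (c / (2 * Real.pi)))
    have h2 := ((hasDerivAt_id y).add h1).deriv
    have e1 : (id + fun y : ℝ => c / (2 * Real.pi) * Real.sin (2 * Real.pi * id y)) = A := rfl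
    rw [e1] at h2
    rw [h2]
    simp only [id]
    field_simp
  have hAl : IsCircleDiffeoLift A := by
    refine ⟨contDiff_id.add (contDiff_const.mul (Real.contDiff_sin.comp (contDiff_const.mul contDiff_id))),
      fun x => ?_, fun x => ?_⟩
    · simp only [hA]
      rw [mul_add, mul_one, Real.sin_add_two_pi]; ring
    · rw [hd]
      have h1 := Real.neg_one_le_cos (2 * Real.pi * x)
      have h2 := Real.cos_le_one (2 * Real.pi * x)
      rcases le_total 0 c with h | h <;> nlinarith
  have hA0 : A 0 = 0 := by simp [hA]
  have hA2 : A (1 / 2) = 1 / 2 := by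
    simp only [hA]
    rw [show 2 * Real.pi * (1 / 2) = Real.pi by ring, Real.sin_pi, mul_zero, add_zero]
  set ψ : ℝ × ℝ → ℝ := fun p => Function.invFun A (A p.1 + p.2) with hψ
  have hψc : Continuous ψ := hAl.inv.cont.comp ((hAl.cont.comp continuous_fst).add continuous_snd)
  have hψ0 : ψ (0, 1 / 2) = 1 / 2 := hAl.invFun_eq (by rw [hA0, hA2]; ring)
  have hAc : Continuous (deriv A) := hAl.smooth.deriv.continuous
  have hρc : Continuous fun p => deriv A p.1 / deriv A (ψ p) :=
    (hAc.comp continuous_fst).div (hAc.comp hψc) fun p => (hAl.pos _).ne'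
  have hρ0 : deriv A 0 / deriv A (ψ (0, 1 / 2)) = t := by
    rw [hψ0, hd, hd]
    have : 2 * Real.pi * (1 / 2) = Real.pi := by ring
    rw [this, mul_zero, Real.cos_zero, Real.cos_pi, hc]
    have : t + 1 ≠ 0 := by linarith
    field_simp
    ring
  obtain ⟨δ₁, hδ₁, h₁⟩ := Metric.continuous_iff.mp hψc (0, 1 / 2) (1 / 8) (by norm_num)
  obtain ⟨δ₂, hδ₂, h₂⟩ := Metric.continuous_iff.mp hρc (0, 1 / 2) e he
  refine ⟨A, hAl, min (1 / 8) (min δ₁ δ₂ / 2), by positivity, min_le_left _ _, fun y s θ hy hs hθ => ?_⟩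
  have eθ : ψ (y, s) = θ := hAl.invFun_eq hθ
  have hdist : dist (y, s) ((0 : ℝ), (1 / 2 : ℝ)) < min δ₁ δ₂ := by
    rw [Prod.dist_eq, Real.dist_eq, Real.dist_eq, sub_zero]
    have h3 : min (1 / 8) (min δ₁ δ₂ / 2) < min δ₁ δ₂ :=
      (min_le_right _ _).trans_lt (half_lt_self (lt_min hδ₁ hδ₂))
    exact max_lt (hy.trans_lt h3) (hs.trans_lt h3)
  have h4 := h₁ _ (hdist.trans_le (min_le_left _ _))
  have h5 := h₂ _ (hdist.trans_le (min_le_right _ _))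
  rw [hψ0, eθ, Real.dist_eq] at h4
  simp only [hρ0] at h5
  rw [eθ, Real.dist_eq] at h5
  exact ⟨h4.le, h5.le⟩

/-- Some iterate of `f` multiplies lengths by about `t` on a definite part of a short interval
around every point, and maps that part into the same interval modulo `ℤ`. -/
def Good (t e κ η : ℝ) (f : ℝ → ℝ) : Prop :=
  ∃ i : ℕ, ∀ x, ∃ (a b c d : ℝ) (m : ℤ), a ≤ x ∧ x ≤ b ∧ a < b ∧ b - a < η ∧ a ≤ c ∧ d ≤ b ∧
    κ * (b - a) ≤ d - c ∧ ∀ y ∈ Set.Icc c d, f^[i] y - m ∈ Set.Icc a b ∧ |deriv f^[i] y - t| < e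

lemma iterate_robust {f : ℝ → ℝ} (hf : IsCircleDiffeoLift f) (i : ℕ) {σ : ℝ} (hσ : 0 < σ) :
    ∃ δ > 0, ∀ F, IsCircleDiffeoLift F → (∀ x, |F x - f x| ≤ δ) → (∀ x, |deriv F x - deriv f x| ≤ δ) →
      ∀ x, |F^[i] x - f^[i] x| ≤ σ ∧ |deriv F^[i] x - deriv f^[i] x| ≤ σ := by
  induction i generalizing σ with
  | zero => exact ⟨1, one_pos, fun F _ _ _ x => by simp [hσ.le]⟩
  | succ i ih =>
    obtain ⟨L, hL0, hL⟩ := hf.of_bdd 1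
    obtain ⟨M, hM0, hM⟩ := (hf.iter i).of_bdd 0
    have hL1 : ∀ x, |deriv f x| ≤ L := fun x => hL.abs_le (Set.mem_univ x)
    have hL2 : ∀ x, |deriv (deriv f) x| ≤ L := fun x => by
      simpa using hL 1 le_rfl x (Set.mem_univ x)
    have hM1 : ∀ x, |deriv f^[i] x| ≤ M := fun x => hM.abs_le (Set.mem_univ x)
    set s : ℝ := min 1 (σ / (2 * (L * (M + 1) + L))) with hs
    have hs0 : 0 < s := by positivity
    have hs1 : s ≤ 1 := min_le_left _ _
    have hs2 : (L * (M + 1) + L) * s ≤ σ / 2 := by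
      have := min_le_right 1 (σ / (2 * (L * (M + 1) + L)))
      rw [← hs, le_div_iff₀ (by positivity)] at this
      linarith
    obtain ⟨δ, hδ0, hδ⟩ := ih hs0
    refine ⟨min δ (σ / (2 * (M + 2))), by positivity, fun F hF h0 h1 x => ?_⟩
    obtain ⟨h2, h3⟩ := hδ F hF (fun x => (h0 x).trans (min_le_left _ _))
      (fun x => (h1 x).trans (min_le_left _ _)) x
    set δ' := min δ (σ / (2 * (M + 2))) with hδ'
    have hδ'0 : 0 < δ' := by positivity
    have hδ'M : δ' * (M + 2) ≤ σ / 2 := by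
      have := min_le_right δ (σ / (2 * (M + 2)))
      rw [← hδ', le_div_iff₀ (by positivity)] at this
      linarith
    have lip : ∀ {u : ℝ → ℝ}, Smooth u → (∀ x, |deriv u x| ≤ L) → ∀ x y, |u x - u y| ≤ L * |x - y| := by
      intro u hu hd x y
      simpa [Real.norm_eq_abs] using Convex.norm_image_sub_le_of_norm_deriv_le (f := u) (s := Set.univ) (C := L)
        (fun x _ => hu.diff x) (fun x _ => hd x) convex_univ (Set.mem_univ y) (Set.mem_univ x)
    have l0 := lip hf.smooth hL1 (F^[i] x) (f^[i] x)
    have l1 := lip hf.smooth.deriv hL2 (F^[i] x) (f^[i] x)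
    have l2 : L * |F^[i] x - f^[i] x| ≤ L * s := mul_le_mul_of_nonneg_left h2 hL0.le
    have hLs : 0 ≤ L * s := by positivity
    have hV : |deriv F^[i] x| ≤ M + 1 := by
      calc |deriv F^[i] x| = |deriv f^[i] x + (deriv F^[i] x - deriv f^[i] x)| := by ring_nf
        _ ≤ _ := (abs_add_le _ _).trans (add_le_add (hM1 x) (h3.trans hs1))
    have dF : ∀ G, IsCircleDiffeoLift G → deriv G^[i + 1] x = deriv G (G^[i] x) * deriv G^[i] x := by
      intro G hG
      rw [Function.iterate_succ']
      exact hG.deriv_comp (hG.iter i) x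
    constructor
    · rw [Function.iterate_succ_apply', Function.iterate_succ_apply']
      calc |F (F^[i] x) - f (f^[i] x)| = |(F (F^[i] x) - f (F^[i] x)) + (f (F^[i] x) - f (f^[i] x))| := by
            ring_nf
        _ ≤ δ' + L * s := (abs_add_le _ _).trans (add_le_add (h0 _) (l0.trans l2))
        _ ≤ σ := by nlinarith
    · rw [dF F hF, dF f hf]
      have hu : |deriv F (F^[i] x) - deriv f (f^[i] x)| ≤ δ' + L * s := by
        calc _ = |(deriv F (F^[i] x) - deriv f (F^[i] x)) +
              (deriv f (F^[i] x) - deriv f (f^[i] x))| := by ring_nf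
          _ ≤ _ := (abs_add_le _ _).trans (add_le_add (h1 _) (l1.trans l2))
      calc |deriv F (F^[i] x) * deriv F^[i] x - deriv f (f^[i] x) * deriv f^[i] x|
          = |(deriv F (F^[i] x) - deriv f (f^[i] x)) * deriv F^[i] x +
              deriv f (f^[i] x) * (deriv F^[i] x - deriv f^[i] x)| := by ring_nf
        _ ≤ (δ' + L * s) * (M + 1) + L * s := by
            refine (abs_add_le _ _).trans ?_
            rw [abs_mul, abs_mul]
            refine add_le_add (mul_le_mul hu hV (abs_nonneg _) (by positivity)) ?_
            exact mul_le_mul (hL1 _) h3 (abs_nonneg _) hL0.le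
        _ ≤ σ := by nlinarith

lemma abs_sub_le_of_deriv_le {u : ℝ → ℝ} {L : ℝ} (hu : Differentiable ℝ u) (hd : ∀ x, |deriv u x| ≤ L)
    (x y : ℝ) : |u x - u y| ≤ L * |x - y| := by
  simpa [Real.norm_eq_abs] using Convex.norm_image_sub_le_of_norm_deriv_le (f := u) (s := Set.univ) (C := L)
    (fun x _ => hu x) (fun x _ => hd x) convex_univ (Set.mem_univ y) (Set.mem_univ x)

lemma abs_sub_le_of_le_deriv {u : ℝ → ℝ} {c : ℝ} (hu : Differentiable ℝ u) (hd : ∀ x, c ≤ deriv u x)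
    (x y : ℝ) : c * |x - y| ≤ |u x - u y| := by
  wlog h : y ≤ x generalizing x y
  · rw [abs_sub_comm, abs_sub_comm (u x)]; exact this y x (le_of_not_ge h)
  · rw [abs_of_nonneg (sub_nonneg.mpr h)]
    refine (convex_univ.mul_sub_le_image_sub_of_le_deriv hu.continuous.continuousOn
      hu.differentiableOn (fun x _ => hd x) y (Set.mem_univ y) x (Set.mem_univ x) h).trans (le_abs_self _)

lemma good_of_conj {A H : ℝ → ℝ} {t e κ η a : ℝ} (hA : IsCircleDiffeoLift A) (hκ0 : 0 < κ) (hκ8 : κ ≤ 1 / 8)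
    (he : 0 < e) (hη : 0 < η) (ht : 0 < t)
    (hm : ∀ y s θ, |y| ≤ κ → |s - 1 / 2| ≤ κ → A θ = A y + s →
      |θ - 1 / 2| ≤ 1 / 8 ∧ |deriv A y / deriv A θ - t| ≤ e / 2)
    (hH : IsCircleDiffeoLift H) (ha : Irrational a) :
    ∃ M : ℕ, ∀ q : ℕ, M ≤ q → 0 < q → ∀ F, IsCircleDiffeoLift F →
      (∀ x, A (q * H (F x)) = A (q * H x) + q * a) →
      ∃ δ > 0, ∀ G, IsCircleDiffeoLift G → (∀ x, |G x - F x| ≤ δ) → (∀ x, |deriv G x - deriv F x| ≤ δ) →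
        Good t e κ η G := by
  obtain ⟨c₀, hc0, hc⟩ := hH.pos_min
  obtain ⟨L, hL0, hL⟩ := hH.of_bdd 1
  have hL1 : ∀ x, |deriv H x| ≤ L := fun x => hL.abs_le (Set.mem_univ x)
  have hL2 : ∀ x, |deriv (deriv H) x| ≤ L := fun x => by
    simpa using hL 1 le_rfl x (Set.mem_univ x)
  set ϖ : ℝ := min 1 (e / (4 * (t + e))) with hϖ
  have hϖ0 : 0 < ϖ := by positivity
  have hϖ1 : ϖ ≤ 1 := min_le_left _ _
  have hϖ2 : (t + e) * ϖ ≤ e / 4 := by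
    have := min_le_right 1 (e / (4 * (t + e)))
    rw [← hϖ, le_div_iff₀ (by positivity)] at this
    linarith
  obtain ⟨M, hM⟩ := exists_nat_gt (max (1 / (c₀ * η)) (L / (ϖ * c₀ * c₀)))
  refine ⟨M, fun q hMq hq F hF hid => ?_⟩
  have hq0 : (0 : ℝ) < q := by exact_mod_cast hq
  have hMq' : (M : ℝ) ≤ q := by exact_mod_cast hMq
  have hq1 : 1 < q * (c₀ * η) := by
    have := (le_max_left _ _).trans_lt (hM.trans_le hMq')
    rwa [div_lt_iff₀ (by positivity)] at this
  have hq2 : L < q * (ϖ * c₀ * c₀) := by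
    have := (le_max_right _ _).trans_lt (hM.trans_le hMq')
    rwa [div_lt_iff₀ (by positivity)] at this
  obtain ⟨i, m, him⟩ := ha.exists_nat_mul_sub_int_near (1 / (2 * q)) (div_pos hκ0 hq0)
  set σ : ℝ := min (e / 8) (1 / (8 * q * L)) with hσ
  have hσ0 : 0 < σ := by positivity
  have hσe : σ ≤ e / 8 := min_le_left _ _
  have hσL : q * (L * σ) ≤ 1 / 8 := by
    have := min_le_right (e / 8) (1 / (8 * q * L))
    rw [← hσ, le_div_iff₀ (by positivity)] at this
    linarith
  obtain ⟨δ, hδ0, hδ⟩ := iterate_robust hF i hσ0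
  refine ⟨δ, hδ0, fun G hG h0 h1 => ⟨i, fun x => ?_⟩⟩
  have hG2 := hδ G hG h0 h1
  set s : ℝ := q * (i * a - m) with hs
  have hs2 : |s - 1 / 2| ≤ κ := by
    have e1 : s - 1 / 2 = q * (i * a - m - 1 / (2 * q)) := by rw [hs]; field_simp
    rw [e1, abs_mul, abs_of_pos hq0]
    rw [lt_div_iff₀ hq0] at him
    linarith
  have hit : ∀ n : ℕ, ∀ y, A (q * H (F^[n] y)) = A (q * H y) + n * (q * a) := by
    intro n y
    induction n with
    | zero => simp
    | succ n ih => rw [Function.iterate_succ_apply', hid, ih]; push_cast; ring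
  have hder : ∀ y, deriv A (q * H (F^[i] y)) * (deriv H (F^[i] y) * deriv F^[i] y) =
      deriv A (q * H y) * deriv H y := by
    intro y
    have d1 := (hA.smooth.hasDerivAt _).comp y ((hH.smooth.hasDerivAt y).const_mul (q : ℝ))
    have d2 := (hA.smooth.hasDerivAt _).comp y
      (((hH.smooth.hasDerivAt _).comp y ((hF.iter i).smooth.hasDerivAt y)).const_mul (q : ℝ))
    have d3 := (d1.add_const (i * (q * a))).unique
      (d2.congr_of_eventuallyEq (Eventually.of_forall fun y => by
        simpa using (hit i y).symm))
    simp only [Function.comp_apply] at d3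
    have := mul_left_cancel₀ hq0.ne' (show (q : ℝ) * _ = q * _ from
      (by linear_combination d3 : (q : ℝ) * (deriv A (q * H y) * deriv H y) =
        q * (deriv A (q * H (F^[i] y)) * (deriv H (F^[i] y) * deriv F^[i] y))))
    exact this.symm
  set j : ℤ := ⌊q * H x + 1 / 4⌋ with hj
  have hj1 : (j : ℝ) ≤ q * H x + 1 / 4 := Int.floor_le _
  have hj2 : q * H x + 1 / 4 < j + 1 := Int.lt_floor_add_one _
  set J := Function.invFun H with hJ
  have hJm : StrictMono J := hH.inv.strictMono
  have hHJ : ∀ y, H (J y) = y := hH.inv_right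
  have hJH : ∀ y, J (H y) = y := hH.inv_left
  have hle : ∀ {u v : ℝ}, u ≤ H v → J u ≤ v := fun {u v} h => by
    have := hJm.monotone h; rwa [hJH] at this
  have hge : ∀ {u v : ℝ}, H v ≤ u → v ≤ J u := fun {u v} h => by
    have := hJm.monotone h; rwa [hJH] at this
  set α := J ((j - 1 / 4) / q) with hα
  set β := J ((j + 3 / 4) / q) with hβ
  have hαβ : α < β := hJm (by gcongr; linarith)
  have hHαβ : H β - H α = 1 / q := by rw [hα, hβ, hHJ, hHJ]; ring
  have hlen : c₀ * (β - α) ≤ 1 / q := by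
    have := abs_sub_le_of_le_deriv hH.smooth.diff hc β α
    rwa [hHαβ, abs_of_pos (sub_pos.mpr hαβ), abs_of_pos (by positivity)] at this
  have hlenq : q * (c₀ * (β - α)) ≤ 1 := by
    rwa [le_div_iff₀' hq0] at hlen
  have hosc : ∀ u ∈ Set.Icc α β, ∀ v ∈ Set.Icc α β, |deriv H u - deriv H v| ≤ ϖ * deriv H v := by
    intro u hu v hv
    have h2 := abs_sub_le_of_deriv_le hH.smooth.deriv.diff hL2 u v
    have h3 : |u - v| ≤ β - α := abs_le.mpr ⟨by linarith [hu.1, hv.2], by linarith [hu.2, hv.1]⟩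
    have h4 : L * (β - α) ≤ ϖ * c₀ := by
      have h5 : L * (β - α) ≤ q * (ϖ * c₀ * c₀) * (β - α) :=
        mul_le_mul_of_nonneg_right hq2.le (sub_pos.mpr hαβ).le
      have h6 : q * (ϖ * c₀ * c₀) * (β - α) = (ϖ * c₀) * (q * (c₀ * (β - α))) := by ring
      rw [h6] at h5
      exact h5.trans (mul_le_of_le_one_right (by positivity) hlenq)
    exact h2.trans ((mul_le_mul_of_nonneg_left h3 hL0.le).trans (h4.trans
      (mul_le_mul_of_nonneg_left (hc v) hϖ0.le)))
  set c := J ((j - κ) / q) with hcdef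
  set d := J ((j + κ) / q) with hddef
  have hαc : α ≤ c := hJm.monotone (by gcongr; linarith)
  have hdβ : d ≤ β := hJm.monotone (by gcongr; linarith)
  have hcd : c < d := hJm (by gcongr; linarith)
  refine ⟨α, β, c, d, m, hle ?_, hge ?_, hαβ, ?_, hαc, hdβ, ?_, fun y hy => ?_⟩
  · rw [div_le_iff₀ hq0]; linarith
  · rw [le_div_iff₀ hq0]; linarith
  · by_contra! hlt
    have := mul_le_mul_of_nonneg_left hlt hc0.le
    nlinarith
  · obtain ⟨ξ, hξ, e1⟩ := exists_deriv_eq_slope H hαβ hH.cont.continuousOn hH.smooth.diff.differentiableOn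
    obtain ⟨ζ, hζ, e2⟩ := exists_deriv_eq_slope H hcd hH.cont.continuousOn hH.smooth.diff.differentiableOn
    have hHcd : H d - H c = 2 * κ / q := by rw [hcdef, hddef, hHJ, hHJ]; ring
    rw [hHαβ, eq_div_iff (sub_pos.mpr hαβ).ne'] at e1
    rw [hHcd, eq_div_iff (sub_pos.mpr hcd).ne'] at e2
    have h2 := (abs_le.mp (hosc ζ ⟨hαc.trans hζ.1.le, hζ.2.le.trans hdβ⟩ ξ ⟨hξ.1.le, hξ.2.le⟩)).2
    have h3 : deriv H ζ ≤ 2 * deriv H ξ := by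
      have := mul_le_mul_of_nonneg_right hϖ1 (hH.pos ξ).le
      linarith
    have h4 := mul_le_mul_of_nonneg_right h3 (sub_pos.mpr hcd).le
    have h5 : 2 * κ * (deriv H ξ * (β - α)) = deriv H ζ * (d - c) := by rw [e1, e2]; ring
    have h6 := hH.pos ξ
    by_contra! hlt
    have := mul_lt_mul_of_pos_left hlt h6
    linarith
  · have hY1 : (j - κ) / q ≤ H y := by
      have := hH.strictMono.monotone hy.1; rwa [hcdef, hHJ] at this
    have hY2 : H y ≤ (j + κ) / q := by
      have := hH.strictMono.monotone hy.2; rwa [hddef, hHJ] at this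
    rw [div_le_iff₀ hq0] at hY1
    rw [le_div_iff₀ hq0] at hY2
    set θ : ℝ := q * H (F^[i] y) - ((q * m + j : ℤ) : ℝ) with hθ
    have hAθ : A θ = A (q * H y - j) + s := by
      rw [hθ, hA.sub_int, hA.sub_int, hit, hs]; push_cast; ring
    obtain ⟨k1, k2⟩ := hm (q * H y - j) s θ (abs_le.mpr ⟨by linarith, by linarith⟩) hs2 hAθ
    have p1 : deriv A θ = deriv A (q * H (F^[i] y)) := by
      have := hA.per_deriv.int θ (q * m + j)
      rw [← this, hθ, sub_add_cancel]
    have p2 : deriv A (q * H y - j) = deriv A (q * H y) := by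
      have := hA.per_deriv.int (q * H y - j) j
      rw [← this, sub_add_cancel]
    rw [p1, p2] at k2
    have hθ' : q * (H (F^[i] y) - m) = θ + j := by rw [hθ]; push_cast; ring
    obtain ⟨g1, g2⟩ := hG2 y
    have g3 := abs_sub_le_of_deriv_le hH.smooth.diff hL1 (G^[i] y) (F^[i] y)
    have g4 : |q * (H (G^[i] y) - m) - q * (H (F^[i] y) - m)| ≤ 1 / 8 := by
      rw [← mul_sub, sub_sub_sub_cancel_right, abs_mul, abs_of_pos hq0]
      exact (mul_le_mul_of_nonneg_left (g3.trans (mul_le_mul_of_nonneg_left g1 hL0.le)) hq0.le).trans hσL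
    rw [abs_le] at k1 g4
    have hy' : y ∈ Set.Icc α β := ⟨hαc.trans hy.1, hy.2.trans hdβ⟩
    have hFm : F^[i] y - m ∈ Set.Icc α β := by
      constructor
      · refine hle ?_
        rw [hH.sub_int, div_le_iff₀ hq0]; linarith
      · refine hge ?_
        rw [hH.sub_int, le_div_iff₀ hq0]; linarith
    refine ⟨⟨hle ?_, hge ?_⟩, ?_⟩
    · rw [hH.sub_int, div_le_iff₀ hq0]; linarith
    · rw [hH.sub_int, le_div_iff₀ hq0]; linarith
    · have hosc' := hosc y hy' _ hFm
      have p3 : deriv H (F^[i] y - m) = deriv H (F^[i] y) := by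
        have := hH.per_deriv.int (F^[i] y - m) m
        rw [← this, sub_add_cancel]
      rw [p3] at hosc'
      have b1 := hH.pos (F^[i] y)
      have b2 := hA.pos (q * H (F^[i] y))
      set R := deriv A (q * H y) / deriv A (q * H (F^[i] y)) with hR
      set ρ := deriv H y / deriv H (F^[i] y) with hρ
      have hdF : deriv F^[i] y = R * ρ := by
        rw [hR, hρ, div_mul_div_comm, eq_div_iff (by positivity)]
        linear_combination hder y
      have hρ1 : |ρ - 1| ≤ ϖ := by
        rw [hρ, div_sub_one b1.ne', abs_div, abs_of_pos b1, div_le_iff₀ b1]; exact hosc'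
      have hRa : |R| ≤ t + e := by
        have := abs_le.mp k2
        rw [abs_le]; constructor <;> linarith
      have hfin : |deriv F^[i] y - t| ≤ e / 2 + e / 4 := by
        rw [hdF]
        calc |R * ρ - t| = |(R - t) + R * (ρ - 1)| := by ring_nf
          _ ≤ e / 2 + (t + e) * ϖ := by
            refine (abs_add_le _ _).trans (add_le_add k2 ?_)
            rw [abs_mul]
            exact mul_le_mul hRa hρ1 (abs_nonneg _) (by linarith)
          _ ≤ _ := by linarith
      calc |deriv G^[i] y - t| = |(deriv G^[i] y - deriv F^[i] y) + (deriv F^[i] y - t)| := by ring_nf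
        _ ≤ e / 8 + (e / 2 + e / 4) := (abs_add_le _ _).trans (add_le_add (g2.trans hσe) hfin)
        _ < e := by linarith

lemma pb_of_conj {A H : ℝ → ℝ} (hA : IsCircleDiffeoLift A) (hH : IsCircleDiffeoLift H) (r : ℕ) :
    ∃ N : ℕ, ∀ q : ℕ, 2 ≤ q → ∀ F, IsCircleDiffeoLift F →
      (∀ x, deriv F x = deriv (fun x => A (q * H x)) x * (deriv (fun x => A (q * H x)) (F x))⁻¹) →
      PB Set.univ r q N (deriv F) := by
  obtain ⟨cA, hcA0, hcA⟩ := hA.pos_min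
  obtain ⟨cH, hcH0, hcH⟩ := hH.pos_min
  obtain ⟨CA, -, hCA⟩ := hA.of_bdd (r + 1)
  obtain ⟨CH, -, hCH⟩ := hH.of_bdd (r + 1)
  set N₃ := ⌈CA⌉₊ + (r + (r + (1 + ⌈CH⌉₊))) * (r + 1) with hN3
  set N₄ := r + (N₃ + (r + (1 + ⌈CH⌉₊))) with hN4
  set N₅ := ⌈(cA * cH)⁻¹⌉₊ with hN5
  set N₆ := N₅ + (2 * r + (N₅ + N₄)) * 3 ^ r with hN6
  obtain ⟨N, hN⟩ := PB.of_ode r (max N₄ N₆)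
  refine ⟨N, fun q hq F hF hd => ?_⟩
  have hB : (2 : ℝ) ≤ q := by exact_mod_cast hq
  have hq0 : (0 : ℝ) < q := by linarith
  have e1 : ∀ x, deriv (fun x => q * H x) x = q * deriv H x := fun x =>
    ((hH.smooth.hasDerivAt x).const_mul _).deriv
  have e2 : ∀ x, deriv (fun x => A (q * H x)) x = deriv A (q * H x) * (q * deriv H x) := fun x =>
    ((hA.smooth.hasDerivAt _).comp x ((hH.smooth.hasDerivAt x).const_mul (q : ℝ))).deriv
  have sφ : Smooth fun x => q * H x := contDiff_const.mul hH.smooth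
  have s1 : Smooth fun x => q * deriv H x := contDiff_const.mul hH.smooth.deriv
  have s2 : Smooth fun x => deriv A (q * H x) := hA.smooth.deriv.comp sφ
  have su : Smooth fun x => deriv A (q * H x) * (q * deriv H x) := s2.mul s1
  have b1 : PB Set.univ r q (r + (1 + ⌈CH⌉₊)) (fun x => q * deriv H x) := by
    refine PB.mul hB contDiff_const hH.smooth.deriv ?_ (PB.of_bd (hCH.mono_order (by omega)) hB)
    refine (Bd.const zero_le_one (q : ℝ)).mono_const zero_le_one ?_
    rw [pow_one, abs_of_pos hq0]
  have b2 : PB Set.univ r q N₃ (fun x => deriv A (q * H x)) := by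
    have := PB.comp_succ (u := deriv A) hB sφ hA.smooth.deriv (Set.mapsTo_univ _ _)
      (PB.of_bd hCA hB) (by rw [show deriv (fun x => q * H x) = _ from funext e1]; exact b1)
    exact this.mono_order (by omega)
  have b3 := PB.mul hB s2 s1 b2 b1
  have hpos : ∀ x, cA * cH ≤ deriv A (q * H x) * (q * deriv H x) := fun x =>
    mul_le_mul (hcA _) ((hcH x).trans (le_mul_of_one_le_left (hH.pos x).le (by linarith))) hcH0.le
      (hA.pos _).le
  have hpos' : ∀ x, 0 < deriv A (q * H x) * (q * deriv H x) := fun x =>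
    (mul_pos hcA0 hcH0).trans_le (hpos x)
  have b4 : PB Set.univ r q N₆ (fun x => (deriv A (q * H x) * (q * deriv H x))⁻¹) := by
    refine PB.inv hB su hpos' (fun x _ => ?_) b3
    refine le_trans ?_ (hpos x)
    rw [inv_le_comm₀ (by positivity) (by positivity)]
    exact le_pow_ceil _ hB
  refine hN q hB Set.univ Set.univ F _ _ hF.smooth su (su.inv fun x => (hpos' x).ne') (Set.mapsTo_univ _ _)
    (fun x => ?_) (b3.mono hB (le_max_left _ _)) (b4.mono hB (le_max_right _ _))
  rw [hd, e2, e2]; rfl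

lemma close_of_conj {A H f : ℝ → ℝ} {a : ℝ} (hA : IsCircleDiffeoLift A) (hH : IsCircleDiffeoLift H)
    (hf : IsCircleDiffeoLift f) (hHf : ∀ x, H (f x) = H x + a) (r : ℕ) {ε : ℝ} (hε : 0 < ε) :
    ∃ K M : ℕ, ∀ (p : ℤ) (q : ℕ), M ≤ q → |a - p / q| * (2 * q) ^ K ≤ 1 → ∀ F, IsCircleDiffeoLift F →
      (∀ x, A (q * H (F x)) = A (q * H x) + q * a) →
      (∀ x, deriv F x = deriv (fun x => A (q * H x)) x * (deriv (fun x => A (q * H x)) (F x))⁻¹) →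
      Close r ε F f := by
  obtain ⟨cA, hcA0, hcA⟩ := hA.pos_min
  obtain ⟨cH, hcH0, hcH⟩ := hH.pos_min
  obtain ⟨Cf, -, hCf⟩ := hf.of_bdd r
  obtain ⟨N₁, hN₁⟩ := pb_of_conj hA hH r
  set C : ℝ := (cA⁻¹ + 1) / cH with hC
  have hC0 : 0 < C := by positivity
  set N := N₁ + ⌈Cf⌉₊ + 1 with hN
  set K := 1 + (N + 4) * 2 ^ r with hK
  obtain ⟨M, hM⟩ := exists_nat_gt (max C (1 / ε))
  refine ⟨K, max M 2, fun p q hMq hω F hF hid hd => ?_⟩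
  have hq2 : 2 ≤ q := (le_max_right _ _).trans hMq
  have hB : (2 : ℝ) ≤ q := by exact_mod_cast hq2
  have hq0 : (0 : ℝ) < q := by linarith
  have hMq' : (M : ℝ) ≤ q := by exact_mod_cast (le_max_left _ _).trans hMq
  have hqC : C ≤ q := ((le_max_left _ _).trans_lt (hM.trans_le hMq')).le
  have hqε : 1 / (q : ℝ) ≤ ε := by
    have := ((le_max_right _ _).trans_lt (hM.trans_le hMq')).le
    rwa [div_le_iff₀ hε, mul_comm, ← div_le_iff₀ hq0] at this
  set ω : ℝ := a - p / q with hωdef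
  have hqω : (q : ℝ) * a = p + q * ω := by rw [hωdef]; field_simp; ring
  have small : ∀ x, |F x - f x| ≤ C * |ω| := by
    intro x
    have h1 := abs_sub_le_of_le_deriv hA.smooth.diff hcA (q * H (F x)) (q * H x + p)
    rw [hA.add_int, hid, hqω, show A (q * H x) + (p + q * ω) - (A (q * H x) + p) = q * ω by ring,
      abs_mul, abs_of_pos hq0] at h1
    have h2 : |H (F x) - H (f x)| ≤ (cA⁻¹ + 1) * |ω| := by
      have e : (q : ℝ) * (H (F x) - H (f x)) = (q * H (F x) - (q * H x + p)) - q * ω := by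
        rw [hHf]; linear_combination (-1 : ℝ) * hqω
      have h3 : (q : ℝ) * |H (F x) - H (f x)| ≤ q * ((cA⁻¹ + 1) * |ω|) := by
        calc (q : ℝ) * |H (F x) - H (f x)| = |(q * H (F x) - (q * H x + p)) - q * ω| := by
              rw [← e, abs_mul, abs_of_pos hq0]
          _ ≤ |q * H (F x) - (q * H x + p)| + |q * ω| := abs_sub _ _
          _ ≤ cA⁻¹ * (q * |ω|) + q * |ω| := by
              rw [abs_mul, abs_of_pos hq0]
              refine add_le_add ?_ le_rfl
              rwa [← div_eq_inv_mul, le_div_iff₀' hcA0]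
          _ = _ := by ring
      exact le_of_mul_le_mul_left h3 hq0
    have h4 := abs_sub_le_of_le_deriv hH.smooth.diff hcH (F x) (f x)
    rw [hC, div_mul_eq_mul_div, le_div_iff₀' hcH0]
    exact h4.trans h2
  set T : ℝ := (q : ℝ) ^ N with hT
  have hT1 : 1 ≤ T := one_le_pow₀ (by linarith)
  have hT0 : 0 < T := by linarith
  set s : ℝ := 1 / (8 * T * q) with hs
  have hs0 : 0 < s := by positivity
  have hs1 : s ≤ 1 := by
    rw [hs, div_le_one (by positivity)]; nlinarith
  have hsT : 8 * T * s = 1 / q := by rw [hs]; field_simp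
  have hslow : 1 / (q : ℝ) ^ (N + 4) ≤ s := by
    rw [hs]
    refine one_div_le_one_div_of_le (by positivity) ?_
    have : (8 : ℝ) ≤ q ^ 3 := by
      calc (8 : ℝ) = 2 ^ 3 := by norm_num
        _ ≤ _ := pow_le_pow_left₀ (by norm_num) hB 3
    calc 8 * T * q ≤ q ^ 3 * T * q := by gcongr
      _ = _ := by rw [hT]; ring
  have h0 : ∀ x, |F x - f x| ≤ T * s ^ (2 ^ r) := by
    intro x
    have h5 : |ω| * (q : ℝ) ^ K ≤ 1 := by
      refine le_trans (mul_le_mul_of_nonneg_left ?_ (abs_nonneg _)) hω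
      exact pow_le_pow_left₀ hq0.le (by linarith) _
    calc |F x - f x| ≤ C * |ω| := small x
      _ ≤ q * |ω| := mul_le_mul_of_nonneg_right hqC (abs_nonneg _)
      _ ≤ (1 / (q : ℝ) ^ (N + 4)) ^ 2 ^ r := by
        rw [div_pow, one_pow, ← pow_mul, le_div_iff₀ (by positivity)]
        rw [hK, pow_add, pow_one] at h5
        linarith
      _ ≤ s ^ 2 ^ r := pow_le_pow_left₀ (by positivity) hslow _
      _ ≤ T * s ^ 2 ^ r := le_mul_of_one_le_left (by positivity) hT1
  have hsub : PB Set.univ r q N (fun x => deriv F x + -deriv f x) :=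
    PB.add hB hF.smooth.deriv hf.smooth.deriv.neg (hN₁ q hq2 F hF hd) (PB.neg (PB.of_bd hCf hB))
  have hder : ∀ b ≤ r + 1, ∀ x, |iteratedDeriv b (fun x => F x - f x) x| ≤ T := by
    intro b hb x
    rcases b with _ | b
    · rw [iteratedDeriv_zero]
      exact (h0 x).trans (mul_le_of_le_one_right hT0.le (pow_le_one₀ hs0.le hs1))
    · rw [iteratedDeriv_succ', show deriv (fun x => F x - f x) = fun x => deriv F x + -deriv f x from
        funext fun y => by rw [deriv_fun_sub (hF.smooth.diff y) (hf.smooth.diff y), sub_eq_add_neg]]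
      simpa using hsub b (by omega) x (Set.mem_univ x)
  intro b hb x
  have := interp (hF.smooth.sub hf.smooth) hT0 hs0.le hder h0 hs1 b hb x
  rw [hsT] at this
  exact this.trans hqε

/-- The inductive step: a smoothly conjugate perturbation which robustly is `Good`. -/
lemma exists_good {t e : ℝ} (ht : 0 < t) (he : 0 < e) : ∃ κ > 0, ∀ (f : ℝ → ℝ) (a : ℝ), Liouville a →
    IsCircleDiffeoLift f → IsSmoothConj a f → ∀ (r : ℕ) (ε η : ℝ), 0 < ε → 0 < η →
    ∃ F, IsCircleDiffeoLift F ∧ IsSmoothConj a F ∧ Close r ε F f ∧ ∃ δ > 0, ∀ G, IsCircleDiffeoLift G →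
      Close 1 δ G F → Good t e κ η G := by
  obtain ⟨A, hA, κ, hκ0, hκ8, hm⟩ := exists_model ht (half_pos he)
  refine ⟨κ, hκ0, fun f a ha hf ⟨H, hH, hHf⟩ r ε η hε hη => ?_⟩
  obtain ⟨M₁, h₁⟩ := good_of_conj hA hκ0 hκ8 he hη ht hm hH ha.irrational
  obtain ⟨K, M₂, h₂⟩ := close_of_conj hA hH hf hHf r hε
  obtain ⟨p, q, hq, hq0, -, hpq⟩ := ha.exists_approx K (max M₁ M₂)
  have hq0' : (0 : ℝ) < q := by exact_mod_cast hq0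
  have hd : ∀ x, deriv (fun x => A (q * H x)) x = deriv A (q * H x) * (q * deriv H x) := fun x =>
    ((hA.smooth.hasDerivAt _).comp x ((hH.smooth.hasDerivAt x).const_mul (q : ℝ))).deriv
  obtain ⟨F, hF, hFc, hid, hFd⟩ := exists_conj (H := fun x => A (q * H x)) (Q := q)
    (hA.smooth.comp (contDiff_const.mul hH.smooth))
    (fun x => by rw [hd]; exact mul_pos (hA.pos _) (mul_pos hq0' (hH.pos x)))
    (fun x => by
      have := hA.add_int (q * H x) q
      push_cast at this
      rw [hH.2.1, mul_add, mul_one, this]) a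
  obtain ⟨δ, hδ, hδG⟩ := h₁ q ((le_max_left _ _).trans hq) hq0 F hF hid
  exact ⟨F, hF, hFc, h₂ p q ((le_max_right _ _).trans hq) hpq F hF hid hFd, δ, hδ, fun G hG hc =>
    hδG G hG hc.val (hc.der hG.smooth hF.smooth le_rfl)⟩

lemma exists_smooth_limit {f : ℕ → ℝ → ℝ} {e : ℕ → ℝ} {r : ℕ} (hf : ∀ n, Smooth (f n))
    (he : ∀ n, e (n + 1) ≤ e n / 2)
    (hc : ∀ n, Close (r + n) (e n / 2) (f (n + 1)) (f n)) :
    ∃ F, Smooth F ∧ ∀ n, Close (r + n) (e n) F (f n) := by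
  set u : ℕ → ℝ → ℝ := fun i x => f (i + 1) x - f i x with hu
  have us : ∀ i, Smooth (u i) := fun i => (hf (i + 1)).sub (hf i)
  have hen : ∀ n i, e (i + n) ≤ e n * (1 / 2) ^ i := by
    intro n i
    induction i with
    | zero => simp
    | succ i ih =>
      rw [show i + 1 + n = i + n + 1 by ring]
      refine (he _).trans ?_
      rw [pow_succ]; linarith
  have hub : ∀ n i, ∀ b ≤ r + n, ∀ x, ‖iteratedFDeriv ℝ b (u (i + n)) x‖ ≤ e n / 2 * (1 / 2) ^ i := by
    intro n i b hb x
    rw [norm_iteratedFDeriv_eq_norm_iteratedDeriv]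
    refine (hc (i + n) b (by omega) x).trans ?_
    linarith [hen n i]
  have hsum : ∀ n, HasSum (fun i : ℕ => e n / 2 * (1 / 2) ^ i) (e n) := fun n => by
    have := hasSum_geometric_two.mul_left (e n / 2)
    rwa [div_mul_cancel₀ _ two_ne_zero] at this
  have husum : ∀ n x, Summable fun i => u (i + n) x := fun n x => by
    refine Summable.of_norm_bounded (hsum n).summable fun i => ?_
    simpa using hub n i 0 (by omega) x
  set F : ℝ → ℝ := fun x => f 0 x + ∑' i, u i x with hF
  have htail : ∀ n, (fun x => F x - f n x) = fun x => ∑' i, u (i + n) x := by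
    intro n
    funext x
    have h1 := (husum 0 x).sum_add_tsum_nat_add n
    simp only [add_zero] at h1
    have h2 := Finset.sum_range_sub (fun i => f i x) n
    have h3 : F x = f 0 x + ∑' i, u i x := rfl
    rw [h3, ← h1]
    have h4 : ∑ i ∈ Finset.range n, u i x = f n x - f 0 x := h2
    rw [h4]; ring
  have hT : ∀ n, ContDiff ℝ ((r + n : ℕ) : ℕ∞) fun x => ∑' i, u (i + n) x := fun n =>
    contDiff_tsum (v := fun _ i => e n / 2 * (1 / 2) ^ i) (fun i => (us _).of_nat _)
      (fun _ _ => (hsum n).summable) (fun k i x hk => hub n i k (by exact_mod_cast hk) x)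
  refine ⟨F, contDiff_infty.mpr fun n => ?_, fun n b hb x => ?_⟩
  · have h1 : F = fun x => f n x + ∑' i, u (i + n) x := by
      funext x
      linarith [congrFun (htail n) x]
    rw [h1]
    refine ((hf n).of_nat n).add ((hT n).of_le ?_)
    exact_mod_cast Nat.le_add_left n r
  · rw [htail, ← Real.norm_eq_abs, ← norm_iteratedFDeriv_eq_norm_iteratedDeriv]
    rw [iteratedFDeriv_tsum_apply (N := ((r + n : ℕ) : ℕ∞)) (v := fun _ i => e n / 2 * (1 / 2) ^ i)
      (fun i => (us _).of_nat _) (fun _ _ => (hsum n).summable)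
      (fun k i x hk => hub n i k (by exact_mod_cast hk) x) (by exact_mod_cast hb)]
    exact tsum_of_norm_bounded (hsum n) fun i => hub n i b hb x

lemma IsCircleDiffeoLift.abs_sub_id_le {H : ℝ → ℝ} (hH : IsCircleDiffeoLift H) (u v : ℝ) :
    |(H u - u) - (H v - v)| ≤ 1 := by
  have h1 : (⌊u - v⌋ : ℝ) ≤ u - v := Int.floor_le _
  have h2 : u - v < ⌊u - v⌋ + 1 := Int.lt_floor_add_one _
  have h3 := hH.strictMono.monotone (show v + (⌊u - v⌋ : ℝ) ≤ u by linarith)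
  have h4 := hH.strictMono.monotone (show u ≤ v + ((⌊u - v⌋ + 1 : ℤ) : ℝ) by push_cast; linarith)
  rw [hH.add_int] at h3 h4
  push_cast at h4
  rw [abs_le]
  constructor <;> linarith

lemma IsSmoothConj.abs_iterate_le {a : ℝ} {f : ℝ → ℝ} (h : IsSmoothConj a f) (n : ℕ) :
    |f^[n] 0 - n * a| ≤ 1 := by
  obtain ⟨H, hH, hc⟩ := h
  have hit : ∀ n : ℕ, H (f^[n] 0) = H 0 + n * a := by
    intro n
    induction n with
    | zero => simp
    | succ n ih => rw [Function.iterate_succ_apply', hc, ih]; push_cast; ring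
  have := hH.abs_sub_id_le 0 (f^[n] 0)
  rw [hit] at this
  convert this using 2
  ring

lemma hasTrans_of_bdd {f : ℝ → ℝ} {a C : ℝ} (h : ∀ n : ℕ, |f^[n] 0 - n * a| ≤ C) : HasTrans f a := by
  rw [HasTrans, tendsto_iff_norm_sub_tendsto_zero]
  refine squeeze_zero' (Eventually.of_forall fun n => norm_nonneg _) ?_ (tendsto_const_div_atTop_nhds_zero_nat C)
  filter_upwards [eventually_gt_atTop 0] with n hn
  have hn' : (0 : ℝ) < n := by exact_mod_cast hn
  rw [div_sub' hn'.ne', norm_div, Real.norm_eq_abs, Real.norm_eq_abs, abs_of_pos hn']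
  gcongr
  exact h n

lemma exists_close_good {g : ℝ → ℝ} {a : ℝ} (ha : Liouville a) (hg : IsCircleDiffeoLift g)
    (hga : IsSmoothConj a g) (r : ℕ) {ε : ℝ} (hε : 0 < ε) : ∃ f, IsCircleDiffeoLift f ∧ HasTrans f a ∧
      Close r ε f g ∧ ∀ t e : ℚ, 0 < t → 0 < e → ∃ κ > 0, ∀ η > 0, Good t e κ η f := by
  obtain ⟨ν, hν⟩ := exists_surjective_nat ({x : ℚ // 0 < x} × {x : ℚ // 0 < x} × ℕ)
  have hκ := fun t e : {x : ℚ // 0 < x} => exists_good (t := (t : ℚ)) (e := (e : ℚ))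
    (by exact_mod_cast t.2) (by exact_mod_cast e.2)
  choose κ hκ0 hκ using hκ
  obtain ⟨c, hc0, hc⟩ := hg.pos_min
  have step : ∀ (n : ℕ) (p : {p : (ℝ → ℝ) × ℝ // IsCircleDiffeoLift p.1 ∧ IsSmoothConj a p.1 ∧ 0 < p.2}),
      ∃ p' : {p : (ℝ → ℝ) × ℝ // IsCircleDiffeoLift p.1 ∧ IsSmoothConj a p.1 ∧ 0 < p.2},
        Close (r + 1 + n) (p.1.2 / 2) p'.1.1 p.1.1 ∧ p'.1.2 ≤ p.1.2 / 2 ∧ ∀ G, IsCircleDiffeoLift G →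
          Close 1 p'.1.2 G p'.1.1 → Good (ν n).1 (ν n).2.1 (κ (ν n).1 (ν n).2.1) (1 / ((ν n).2.2 + 1)) G := by
    rintro n ⟨⟨f, e⟩, hf, hfc, he⟩
    obtain ⟨F, hF, hFc, hcl, δ, hδ, hG⟩ := hκ (ν n).1 (ν n).2.1 f a ha hf hfc (r + 1 + n) (e / 2)
      (1 / ((ν n).2.2 + 1)) (half_pos he) (by positivity)
    exact ⟨⟨(F, min δ (e / 2)), hF, hFc, lt_min hδ (half_pos he)⟩, hcl, min_le_right _ _,
      fun G hGl hGc => hG G hGl (hGc.mono le_rfl (min_le_left _ _))⟩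
  choose next hn1 hn2 hn3 using step
  let st : ℕ → {p : (ℝ → ℝ) × ℝ // IsCircleDiffeoLift p.1 ∧ IsSmoothConj a p.1 ∧ 0 < p.2} :=
    fun n => Nat.rec ⟨(g, min ε (c / 2)), hg, hga, by positivity⟩ next n
  have hst : ∀ n, st (n + 1) = next n (st n) := fun n => rfl
  obtain ⟨f, hfs, hfc⟩ := exists_smooth_limit (f := fun n => (st n).1.1) (e := fun n => (st n).1.2) (r := r + 1)
    (fun n => (st n).2.1.smooth) (fun n => by simp only [hst]; exact hn2 _ _)
    (fun n => by simp only [hst]; exact hn1 _ _)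
  have he : ∀ n, (st n).1.2 ≤ min ε (c / 2) * (1 / 2) ^ n := by
    intro n
    induction n with
    | zero => rw [pow_zero, mul_one]; exact le_rfl
    | succ n ih =>
      rw [hst, pow_succ]
      exact (hn2 _ _).trans (by linarith)
  have hval : ∀ n x, |f x - (st n).1.1 x| ≤ min ε (c / 2) * (1 / 2) ^ n := fun n x =>
    ((hfc n).val x).trans (he n)
  have hlim : Tendsto (fun n : ℕ => min ε (c / 2) * (1 / 2 : ℝ) ^ n) atTop (𝓝 0) := by
    simpa using (tendsto_pow_atTop_nhds_zero_of_lt_one (by norm_num : (0 : ℝ) ≤ 1 / 2) (by norm_num)).const_mul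
      (min ε (c / 2))
  have hcl0 : Close (r + 1) (min ε (c / 2)) f g := by
    have := hfc 0
    rwa [add_zero] at this
  have hf : IsCircleDiffeoLift f := by
    refine ⟨hfs, fun x => ?_, fun x => ?_⟩
    · have hp : ∀ y, Tendsto (fun n => (st n).1.1 y) atTop (𝓝 (f y)) := fun y => by
        rw [tendsto_iff_norm_sub_tendsto_zero]
        exact squeeze_zero (fun n => norm_nonneg _)
          (fun n => by rw [norm_sub_rev]; exact hval n y) hlim
      refine tendsto_nhds_unique (hp (x + 1)) (((hp x).add_const 1).congr fun n => ?_)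
      exact ((st n).2.1.2.1 x).symm
    · have h1 := hcl0.der hfs hg.smooth (by omega) x
      have h2 := (abs_le.mp (h1.trans (min_le_right _ _))).1
      linarith [hc x]
  refine ⟨f, hf, hasTrans_of_bdd (C := 2) fun N => ?_, hcl0.mono (by omega) (min_le_left _ _),
    fun t e ht he' => ?_⟩
  · obtain ⟨δ, hδ, hr⟩ := iterate_robust hf N one_pos
    obtain ⟨n, hn⟩ := (hlim.eventually (gt_mem_nhds hδ)).exists
    have hd : Close 1 δ f (st n).1.1 := ((hfc n).mono (by omega) ((he n).trans hn.le))
    have h1 := (hr _ (st n).2.1 (fun x => by rw [abs_sub_comm]; exact hd.val x)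
      (fun x => by rw [abs_sub_comm]; exact hd.der hfs (st n).2.1.smooth le_rfl x) 0).1
    have h2 := (st n).2.2.1.abs_iterate_le N
    rw [abs_le] at h1 h2 ⊢
    constructor <;> linarith
  · refine ⟨κ ⟨t, ht⟩ ⟨e, he'⟩, hκ0 _ _, fun η hη => ?_⟩
    obtain ⟨k, hk⟩ := exists_nat_one_div_lt hη
    obtain ⟨n, hn⟩ := hν (⟨t, ht⟩, ⟨e, he'⟩, k)
    have h1 := hn3 n (st n) f hf (by
      have := (hfc (n + 1)).mono (s := 1) (by omega) le_rfl
      simpa only [hst] using this)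
    rw [hn] at h1
    obtain ⟨i, hi⟩ := h1
    refine ⟨i, fun x => ?_⟩
    obtain ⟨a, b, c, d, m, h1, h2, h3, h4, h5⟩ := hi x
    exact ⟨a, b, c, d, m, h1, h2, h3, h4.trans hk, h5⟩

lemma exists_return {f : ℝ → ℝ} (hf : IsCircleDiffeoLift f) {t e κ : ℝ} (ht : 0 < t) (he : e ≤ t / 2)
    (hκ : 0 < κ) (hG : ∀ η > 0, Good t e κ η f) {S : Set ℝ} (hS : MeasurableSet S) (hS0 : volume S ≠ 0)
    (hper : ∀ x : ℝ, ∀ m : ℤ, x - (m : ℝ) ∈ S → x ∈ S) :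
    ∃ i : ℕ, volume {y | y ∈ S ∧ f^[i] y ∈ S ∧ |deriv f^[i] y - t| < e} ≠ 0 := by
  obtain ⟨x, hx⟩ : ∃ x, ∀ {ι : Type} {l : Filter ι} (w : ι → ℝ) (δ : ι → ℝ), Tendsto δ l (𝓝[>] 0) →
      (∀ᶠ j in l, x ∈ Metric.closedBall (w j) (1 * δ j)) →
      Tendsto (fun j => volume (S ∩ Metric.closedBall (w j) (δ j)) / volume (Metric.closedBall (w j) (δ j)))
        l (𝓝 1) := by
    have h1 := IsUnifLocDoublingMeasure.ae_tendsto_measure_inter_div volume S 1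
    have : (ae (volume.restrict S)).NeBot := ae_neBot.mpr (by rwa [Ne, Measure.restrict_eq_zero])
    obtain ⟨x, hx⟩ := h1.exists
    exact ⟨x, fun {ι l} w δ => hx w δ⟩
  choose i hi using fun n : ℕ => hG (1 / (n + 1)) (by positivity)
  choose a b c d m hax hxb hab hlen hac hdb hcd hmap using fun n => hi n x
  set θ : ℝ := min (1 / 2) (κ / (2 * (1 + 2 / t))) with hθ
  have hθ0 : 0 < θ := by positivity
  have hθ1 : θ ≤ 1 / 2 := min_le_left _ _
  have hθκ : θ * (1 + 2 / t) ≤ κ / 2 := by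
    have := min_le_right (1 / 2) (κ / (2 * (1 + 2 / t)))
    rw [← hθ, le_div_iff₀ (by positivity)] at this
    linarith
  have hball : ∀ n, Metric.closedBall ((a n + b n) / 2) ((b n - a n) / 2) = Set.Icc (a n) (b n) := fun n => by
    rw [Real.closedBall_eq_Icc]; congr 1 <;> ring
  have hden := hx (l := atTop) (fun n => (a n + b n) / 2) (fun n => (b n - a n) / 2) (by
      refine tendsto_nhdsWithin_iff.mpr ⟨?_, Eventually.of_forall fun n => half_pos (sub_pos.mpr (hab n))⟩
      refine squeeze_zero (fun n => (half_pos (sub_pos.mpr (hab n))).le) (fun n => ?_)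
        tendsto_one_div_add_atTop_nhds_zero_nat
      linarith [hlen n, hab n])
    (Eventually.of_forall fun n => by rw [one_mul, hball]; exact ⟨hax n, hxb n⟩)
  simp only [hball] at hden
  obtain ⟨n, hn⟩ := (hden.eventually (lt_mem_nhds (show ENNReal.ofReal (1 - θ) < 1 by
    rw [ENNReal.ofReal_lt_one]; linarith))).exists
  refine ⟨i n, fun h0 => ?_⟩
  have hab' := sub_pos.mpr (hab n)
  set I := Set.Icc (a n) (b n) with hI
  have hIv : volume I = ENNReal.ofReal (b n - a n) := Real.volume_Icc
  set P := I \ S with hP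
  have hPm : MeasurableSet P := measurableSet_Icc.diff hS
  have hPv : volume P ≤ ENNReal.ofReal (θ * (b n - a n)) := by
    have h1 := measure_inter_add_sdiff (μ := volume) I hS
    rw [ENNReal.lt_div_iff_mul_lt (Or.inl (by rw [hIv]; simpa using hab n)) (Or.inl (by rw [hIv]; simp)),
      Set.inter_comm, hIv, ← ENNReal.ofReal_mul (by linarith)] at hn
    by_contra! hlt
    have h2 := ENNReal.add_lt_add hn hlt
    rw [h1, hIv, ← ENNReal.ofReal_add (mul_nonneg (by linarith) hab'.le) (by positivity)] at h2
    have : (1 - θ) * (b n - a n) + θ * (b n - a n) = b n - a n := by ring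
    rw [this] at h2
    exact lt_irrefl _ h2
  set φ : ℝ → ℝ := fun y => f^[i n] y - m n with hφ
  have hfi := hf.iter (i n)
  have hφc : Continuous φ := hfi.cont.sub continuous_const
  have hφd : ∀ y, HasDerivAt φ (deriv f^[i n] y) y := fun y => (hfi.smooth.hasDerivAt y).sub_const _
  set Q := Set.Icc (c n) (d n) ∩ φ ⁻¹' P with hQ
  have hQm : MeasurableSet Q := measurableSet_Icc.inter (hφc.measurable hPm)
  have hQv : ENNReal.ofReal (t / 2) * volume Q ≤ volume P := by
    have h1 := lintegral_image_eq_lintegral_abs_deriv_mul hQm (fun y _ => (hφd y).hasDerivWithinAt)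
      (fun u _ v _ huv => hfi.strictMono.injective (by simpa [hφ] using huv)) (fun _ => 1)
    simp only [mul_one, lintegral_one, Measure.restrict_apply_univ] at h1
    calc ENNReal.ofReal (t / 2) * volume Q = ∫⁻ _ in Q, ENNReal.ofReal (t / 2) := by
          rw [setLIntegral_const]
      _ ≤ ∫⁻ y in Q, ENNReal.ofReal |deriv f^[i n] y| := by
          refine setLIntegral_mono' hQm fun y hy => ENNReal.ofReal_le_ofReal ?_
          have := (abs_lt.mp (hmap n y hy.1).2).1
          exact (by linarith : t / 2 ≤ deriv f^[i n] y).trans (le_abs_self _)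
      _ = volume (φ '' Q) := h1.symm
      _ ≤ volume P := measure_mono (by rintro _ ⟨y, hy, rfl⟩; exact hy.2)
  have hQv' : volume Q ≤ ENNReal.ofReal (2 / t * (θ * (b n - a n))) := by
    have h1 := hQv.trans hPv
    have h2 := mul_le_mul_right h1 (ENNReal.ofReal (2 / t))
    rw [← mul_assoc, ← ENNReal.ofReal_mul (by positivity), ← ENNReal.ofReal_mul (by positivity),
      show 2 / t * (t / 2) = 1 by field_simp, ENNReal.ofReal_one, one_mul] at h2
    exact h2
  have hsub : Set.Icc (c n) (d n) ⊆
      {y | y ∈ S ∧ f^[i n] y ∈ S ∧ |deriv f^[i n] y - t| < e} ∪ (P ∪ Q) := by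
    intro y hy
    obtain ⟨h1, h2⟩ := hmap n y hy
    by_cases hyS : y ∈ S
    · by_cases hfS : φ y ∈ S
      · exact Or.inl ⟨hyS, hper _ _ hfS, h2⟩
      · exact Or.inr (Or.inr ⟨hy, h1, hfS⟩)
    · exact Or.inr (Or.inl ⟨⟨(hac n).trans hy.1, hy.2.trans (hdb n)⟩, hyS⟩)
  have hfin : ENNReal.ofReal (d n - c n) ≤
      ENNReal.ofReal (θ * (b n - a n) + 2 / t * (θ * (b n - a n))) := by
    rw [← Real.volume_Icc, ENNReal.ofReal_add (by positivity) (by positivity)]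
    refine (measure_mono hsub).trans ((measure_union_le _ _).trans ?_)
    rw [h0, zero_add]
    exact (measure_union_le _ _).trans (add_le_add hPv hQv')
  rw [ENNReal.ofReal_le_ofReal_iff (by positivity)] at hfin
  have h3 := hcd n
  have h4 := mul_le_mul_of_nonneg_right hθκ hab'.le
  have h5 := mul_pos hκ hab'
  nlinarith

lemma zpowLift_lift {f : ℝ → ℝ} (hf : IsCircleDiffeoLift f) (i : ℤ) : IsCircleDiffeoLift (zpowLift f i) := by
  unfold zpowLift
  split_ifs
  · exact hf.iter _
  · exact hf.inv.iter _

lemma zpowLift_natCast (f : ℝ → ℝ) (i : ℕ) : zpowLift f i = f^[i] := by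
  simp [zpowLift]

lemma UnitAddCircle.volume_preimage_eq_zero_iff {B : Set UnitAddCircle} (hB : MeasurableSet B) :
    volume ((fun x : ℝ => (x : UnitAddCircle)) ⁻¹' B) = 0 ↔ volume B = 0 := by
  have hmp := fun k : ℝ => UnitAddCircle.measurePreserving_mk k
  have hm : MeasurableSet ((fun x : ℝ => (x : UnitAddCircle)) ⁻¹' B) :=
    (AddCircle.measurable_mk' (a := 1)) hB
  constructor
  · intro h
    rw [← (hmp 0).measure_preimage hB.nullMeasurableSet, Measure.restrict_apply hm]
    exact measure_mono_null Set.inter_subset_left h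
  · intro h
    have h1 : ((fun x : ℝ => (x : UnitAddCircle)) ⁻¹' B) ⊆
        ⋃ k : ℤ, ((fun x : ℝ => (x : UnitAddCircle)) ⁻¹' B) ∩ Set.Ioc (k : ℝ) (k + 1) := fun x hx =>
      Set.mem_iUnion.mpr ⟨⌈x⌉ - 1, hx, by push_cast; linarith [Int.ceil_lt_add_one x],
        by push_cast; linarith [Int.le_ceil x]⟩
    refine measure_mono_null h1 (measure_iUnion_null fun k => ?_)
    rw [← Measure.restrict_apply hm, (hmp k).measure_preimage hB.nullMeasurableSet, h]

lemma exists_ratioSet_eq {f : ℝ → ℝ} (hf : IsCircleDiffeoLift f)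
    (hG : ∀ t e : ℚ, 0 < t → 0 < e → ∃ κ > 0, ∀ η > 0, Good t e κ η f) :
    ∃ Fz : ℤ → UnitAddCircle → UnitAddCircle, ∃ D : ℤ → UnitAddCircle → ℝ,
      (∀ i : ℤ, ∀ x : ℝ, Fz i ↑x = ↑(zpowLift f i x)) ∧
      (∀ i : ℤ, ∀ x : ℝ, D i ↑x = deriv (zpowLift f i) x) ∧
      ratioSet Fz D = Set.Ici (0 : ℝ) := by
  have hz := zpowLift_lift hf
  have p1 : ∀ i, Function.Periodic (fun x : ℝ => (zpowLift f i x : UnitAddCircle)) 1 := fun i x => by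
    simp only [(hz i).2.1]
    exact AddCircle.coe_add_period 1 _
  have p2 : ∀ i, Function.Periodic (deriv (zpowLift f i)) 1 := fun i => (hz i).per_deriv
  have hq : IsQuotientMap (fun x : ℝ => (x : UnitAddCircle)) := QuotientAddGroup.isQuotientMap_mk _
  have cF : ∀ i, Continuous ((p1 i).lift : UnitAddCircle → UnitAddCircle) := fun i =>
    hq.continuous_iff.mpr ((AddCircle.continuous_mk' 1).comp (hz i).cont)
  have cD : ∀ i, Continuous ((p2 i).lift : UnitAddCircle → ℝ) := fun i =>
    hq.continuous_iff.mpr (hz i).smooth.deriv.continuous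
  refine ⟨fun i => (p1 i).lift, fun i => (p2 i).lift, fun i x => rfl, fun i x => rfl, ?_⟩
  refine Set.Subset.antisymm (fun t ht => ht.1) fun t ht => ⟨ht, fun A hA hA0 ε hε => ?_⟩
  have ht0 : (0 : ℝ) ≤ t := ht
  obtain ⟨t', ht1, ht2⟩ := exists_rat_btwn (show t < t + ε / 2 by linarith)
  have ht'0 : (0 : ℝ) < t' := ht0.trans_lt ht1
  obtain ⟨e, he0, he1⟩ := exists_rat_btwn (show (0 : ℝ) < min (ε / 2) (t' / 2) by positivity)
  obtain ⟨κ, hκ, hgood⟩ := hG t' e (by exact_mod_cast ht'0) (by exact_mod_cast he0)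
  set S : Set ℝ := (fun x : ℝ => (x : UnitAddCircle)) ⁻¹' A with hS
  obtain ⟨i, hi⟩ := exists_return hf ht'0 (he1.le.trans (min_le_right _ _)) hκ hgood
    (S := S) ((AddCircle.measurable_mk' (a := 1)) hA)
    (fun h => hA0.ne' ((UnitAddCircle.volume_preimage_eq_zero_iff hA).mp h))
    (fun (x : ℝ) (m : ℤ) hx => by
      have e1 : ((x - m : ℝ) : UnitAddCircle) = x := by
        rw [AddCircle.coe_sub, sub_eq_self]
        exact AddCircle.coe_eq_zero_iff 1 |>.mpr ⟨m, by simp⟩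
      simpa only [hS, Set.mem_preimage, e1] using hx)
  set B : Set UnitAddCircle := A ∩ ((p1 i).lift ⁻¹' A ∩ {x | |(p2 i).lift x - t| < ε}) with hB
  have hBm : MeasurableSet B := hA.inter (((cF i).measurable hA).inter
    (isOpen_lt ((cD i).sub continuous_const).abs continuous_const).measurableSet)
  refine ⟨B, hBm, Set.inter_subset_left, pos_iff_ne_zero.mpr fun hB0 => hi ?_, i, ?_, fun x hx => hx.2.2⟩
  · refine measure_mono_null (fun y hy => ?_) ((UnitAddCircle.volume_preimage_eq_zero_iff hBm).mpr hB0)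
    obtain ⟨h1, h2, h3⟩ := hy
    refine ⟨h1, ?_, ?_⟩
    · change ((zpowLift f i y : ℝ) : UnitAddCircle) ∈ A
      rw [zpowLift_natCast]; exact h2
    · change |deriv (zpowLift f i) y - t| < ε
      rw [zpowLift_natCast]
      have h4 := abs_lt.mp (h3.trans (he1.trans_le (min_le_left _ _)))
      rw [abs_lt]
      constructor <;> linarith
  · rintro _ ⟨x, hx, rfl⟩
    exact hx.2.1

lemma CrNorm_le {r : ℕ} {δ : ℝ} {f g : ℝ → ℝ} (h : Close r δ f g) : CrNorm r (fun x => f x - g x) ≤ δ :=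
  Finset.sup'_le _ _ fun i hi => ciSup_le fun x => h i (by simpa [Nat.lt_succ_iff] using hi) x

/-- For a Liouville number `α ∈ (0,1)`, type `III_∞` diffeomorphisms are `C^∞`-dense in
the set of smooth circle diffeomorphisms with rotation number `α`. -/
theorem stmt_3 (α : ℝ) (hα0 : 0 < α) (hα1 : α < 1) (hL : Liouville α)
    (g : ℝ → ℝ) (hg : IsCircleDiffeoLift g) (hρg : HasRotationNumber g α)
    (r : ℕ) (ε : ℝ) (hε : 0 < ε) :
    ∃ f : ℝ → ℝ, IsCircleDiffeoLift f ∧ HasRotationNumber f α ∧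
      liftDist r f g < ε ∧
      ∃ Fz : ℤ → UnitAddCircle → UnitAddCircle, ∃ D : ℤ → UnitAddCircle → ℝ,
        (∀ i : ℤ, ∀ x : ℝ, Fz i ↑x = ↑(zpowLift f i x)) ∧
        (∀ i : ℤ, ∀ x : ℝ, D i ↑x = deriv (zpowLift f i) x) ∧
        ratioSet Fz D = Set.Ici (0 : ℝ) := by
  obtain ⟨k, hk⟩ := hρg
  have ha := liouville_add_int hL k
  obtain ⟨δ, hδ, hinv⟩ := close_inv hg r (half_pos hε)
  have hε' : 0 < min (ε / 2) δ / 2 := by positivity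
  obtain ⟨F, hF, hFa, hFg⟩ := exists_close_conj hg ha hk (r + 1) hε'
  obtain ⟨f, hf, hfa, hfF, hgood⟩ := exists_close_good ha hF hFa (r + 1) hε'
  have hfg := Close.trans hf.smooth hF.smooth hg.smooth hfF hFg
  rw [add_halves] at hfg
  refine ⟨f, hf, ⟨k, hfa⟩, max_lt ?_ ?_, exists_ratioSet_eq hf hgood⟩
  · exact (CrNorm_le (hfg.mono (Nat.le_succ r) (min_le_left _ _))).trans_lt (half_lt_self hε)
  · exact (CrNorm_le (hinv f hf (hfg.mono le_rfl (min_le_right _ _)))).trans_lt (half_lt_self hε)
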